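/- Let G ⊆ ℝ² be open and convex and define 𝔯(G) := sup{ r ∈ [0,∞) : ∃ x ∈ G such that the closed ball B_r(x) is contained in cl(G) }. If either (i) 𝔯(G) = ∞, or (ii) the supremum defining 𝔯(G) is attained (i.e. there exist r = 𝔯(G) < ∞ and x ∈ G with B_r(x) ⊆ cl(G)), then for every L ∈ [0, Per(G)) there exists a convex Lebesgue measurable set E ⊆ cl(G) with Per(E) = L such that L²(E') ≤ L²(E) for every measurable E' ⊆ cl(G) with Per(E') = L. -/

import Mathlib

open MeasureTheory
open scoped ENNReal

/-- The divergence of a vector field on `ℝⁿ`. -/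
noncomputable def vecDiv {n : ℕ} (φ : EuclideanSpace ℝ (Fin n) → EuclideanSpace ℝ (Fin n))
    (x : EuclideanSpace ℝ (Fin n)) : ℝ :=
  ∑ i : Fin n, fderiv ℝ φ x (EuclideanSpace.single i 1) i

/-- The perimeter of a set `E` relative to an open set `F`:
`Per(E;F) = sup { ∫_E div φ dx : φ ∈ C¹_0(F, ℝⁿ), |φ| ≤ 1 }`. -/
noncomputable def perIn {n : ℕ} (E F : Set (EuclideanSpace ℝ (Fin n))) : ℝ≥0∞ :=
  ⨆ φ : {φ : EuclideanSpace ℝ (Fin n) → EuclideanSpace ℝ (Fin n) //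
      ContDiff ℝ 1 φ ∧ HasCompactSupport φ ∧ tsupport φ ⊆ F ∧ ∀ x, ‖φ x‖ ≤ 1},
    ENNReal.ofReal (∫ x in E, vecDiv φ.1 x)

/-- The perimeter of `E` (relative to all of `ℝⁿ`). -/
noncomputable def per {n : ℕ} (E : Set (EuclideanSpace ℝ (Fin n))) : ℝ≥0∞ :=
  perIn E Set.univ

namespace PlaneGeom

open Set Filter Topology Metric

/-! ### Orthonormal frames and the Cauchy perimeter -/

/-- The Euclidean plane. -/
abbrev Plane := EuclideanSpace ℝ (Fin 2)

/-- The unit vector at angle `θ`. -/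
noncomputable def dir (θ : ℝ) : Plane := !₂[Real.cos θ, Real.sin θ]

/-- The unit vector at angle `θ + π / 2`. -/
noncomputable def nor (θ : ℝ) : Plane := !₂[-Real.sin θ, Real.cos θ]

/-- The parametrization of the plane by the orthonormal frame `dir θ, nor θ`. -/
noncomputable def frame (θ : ℝ) (p : ℝ × ℝ) : Plane := p.1 • dir θ + p.2 • nor θ

/-- The coordinate in direction `dir θ`. -/
noncomputable def coord (θ : ℝ) (x : Plane) : ℝ := Real.cos θ * x 0 + Real.sin θ * x 1

@[simp] lemma dir_zero_apply (θ : ℝ) : dir θ 0 = Real.cos θ := rfl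
@[simp] lemma dir_one_apply (θ : ℝ) : dir θ 1 = Real.sin θ := rfl
@[simp] lemma nor_zero_apply (θ : ℝ) : nor θ 0 = -Real.sin θ := rfl
@[simp] lemma nor_one_apply (θ : ℝ) : nor θ 1 = Real.cos θ := rfl

lemma plane_ext {x y : Plane} (h0 : x 0 = y 0) (h1 : x 1 = y 1) : x = y := by
  ext i; fin_cases i <;> assumption

lemma norm_sq_plane (x : Plane) : ‖x‖ ^ 2 = x 0 ^ 2 + x 1 ^ 2 := by
  rw [EuclideanSpace.norm_sq_eq]; simp

lemma norm_dir (θ : ℝ) : ‖dir θ‖ = 1 := by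
  have h := norm_sq_plane (dir θ)
  simp only [dir_zero_apply, dir_one_apply, Real.cos_sq_add_sin_sq] at h
  nlinarith [norm_nonneg (dir θ)]

lemma norm_nor (θ : ℝ) : ‖nor θ‖ = 1 := by
  have h := norm_sq_plane (nor θ)
  simp only [nor_zero_apply, nor_one_apply, neg_sq, Real.sin_sq_add_cos_sq] at h
  nlinarith [norm_nonneg (nor θ)]

lemma coord_frame (θ : ℝ) (p : ℝ × ℝ) : coord θ (frame θ p) = p.1 := by
  simp only [coord, frame, PiLp.add_apply, PiLp.smul_apply, dir_zero_apply, nor_zero_apply,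
    dir_one_apply, nor_one_apply, smul_eq_mul]
  linear_combination p.1 * Real.cos_sq_add_sin_sq θ

lemma frame_coord (θ : ℝ) (x : Plane) :
    frame θ (coord θ x, -Real.sin θ * x 0 + Real.cos θ * x 1) = x := by
  apply plane_ext <;>
  simp only [coord, frame, PiLp.add_apply, PiLp.smul_apply, dir_zero_apply, nor_zero_apply,
    dir_one_apply, nor_one_apply, smul_eq_mul]
  · linear_combination x 0 * Real.cos_sq_add_sin_sq θ
  · linear_combination x 1 * Real.cos_sq_add_sin_sq θ

lemma coord_add (θ : ℝ) (x y : Plane) : coord θ (x + y) = coord θ x + coord θ y := by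
  simp only [coord, PiLp.add_apply]; ring

lemma coord_smul (θ c : ℝ) (x : Plane) : coord θ (c • x) = c * coord θ x := by
  simp only [coord, PiLp.smul_apply, smul_eq_mul]; ring

lemma coord_dir (θ : ℝ) : coord θ (dir θ) = 1 := by
  simp only [coord, dir_zero_apply, dir_one_apply]
  linear_combination Real.cos_sq_add_sin_sq θ

lemma coord_sub (θ : ℝ) (x y : Plane) : coord θ (x - y) = coord θ x - coord θ y := by
  simp only [coord, PiLp.sub_apply]; ring

lemma abs_coord_le (θ : ℝ) (x : Plane) : |coord θ x| ≤ ‖x‖ := by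
  refine abs_le_of_sq_le_sq ?_ (norm_nonneg x)
  rw [norm_sq_plane, coord]
  nlinarith [Real.cos_sq_add_sin_sq θ, sq_nonneg (Real.cos θ * x 1 - Real.sin θ * x 0)]

lemma continuous_dir : Continuous dir := by
  unfold dir; fun_prop

lemma continuous_nor : Continuous nor := by
  unfold nor; fun_prop

lemma continuous_frame₂ : Continuous fun q : ℝ × (ℝ × ℝ) => frame q.1 q.2 := by
  unfold frame
  have := continuous_dir; have := continuous_nor
  fun_prop

lemma continuous_frame (θ : ℝ) : Continuous (frame θ) :=
  continuous_frame₂.comp (Continuous.prodMk_right θ)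

lemma continuous_coord₂ : Continuous fun q : ℝ × Plane => coord q.1 q.2 := by
  unfold coord; fun_prop

lemma continuous_coord (θ : ℝ) : Continuous (coord θ) :=
  continuous_coord₂.comp (Continuous.prodMk_right θ)

lemma orthonormal_frame (θ : ℝ) : Orthonormal ℝ ![dir θ, nor θ] := by
  rw [orthonormal_iff_ite]
  intro i j
  fin_cases i <;> fin_cases j <;>
    simp [norm_dir, norm_nor, PiLp.inner_apply, Fin.sum_univ_two] <;> ring

lemma measurePreserving_frame (θ : ℝ) : MeasurePreserving (frame θ) volume volume := by
  have hc : Fintype.card (Fin 2) = Module.finrank ℝ Plane := by simp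
  let b := basisOfOrthonormalOfCardEqFinrank (orthonormal_frame θ) hc
  have hb : Orthonormal ℝ b := by
    simpa [b] using orthonormal_frame θ
  let ob := b.toOrthonormalBasis hb
  have h1 := ob.measurePreserving_repr_symm
  have h2 := PiLp.volume_preserving_toLp (Fin 2)
  have h3 := (volume_preserving_finTwoArrow ℝ).symm
  have h := h1.comp (h2.comp h3)
  convert h using 1
  funext p
  simp [Fin.sum_univ_two, ob, b, frame, MeasurableEquiv.finTwoArrow]

lemma exists_eq_norm_smul_dir (v : Plane) : ∃ α : ℝ, v = ‖v‖ • dir α := by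
  set z : ℂ := ⟨v 0, v 1⟩ with hz
  have hn : ‖z‖ = ‖v‖ := by
    have h1 := norm_sq_plane v
    have h2 : ‖z‖ ^ 2 = v 0 ^ 2 + v 1 ^ 2 := by
      rw [← Complex.normSq_eq_norm_sq, Complex.normSq_apply]; ring
    exact (sq_eq_sq₀ (norm_nonneg _) (norm_nonneg _)).1 (h2.trans h1.symm)
  refine ⟨z.arg, plane_ext ?_ ?_⟩
  · simp only [PiLp.smul_apply, dir_zero_apply, smul_eq_mul]
    rw [← hn, Complex.norm_mul_cos_arg]
  · simp only [PiLp.smul_apply, dir_one_apply, smul_eq_mul]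
    rw [← hn, Complex.norm_mul_sin_arg]

lemma integral_abs_sin_sub (α : ℝ) : ∫ θ in (0 : ℝ)..Real.pi, |Real.sin (α - θ)| = 2 := by
  have hper : Function.Periodic (fun θ : ℝ => |Real.sin (α - θ)|) Real.pi := by
    intro θ
    have : α - (θ + Real.pi) = (α - θ) - Real.pi := by ring
    simp only [this, Real.sin_sub_pi, abs_neg]
  have h := hper.intervalIntegral_add_eq 0 α
  rw [zero_add] at h
  rw [h]
  have h2 : ∫ θ in α..α + Real.pi, |Real.sin (α - θ)| =
      ∫ θ in (0 : ℝ)..Real.pi, |Real.sin θ| := by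
    have := intervalIntegral.integral_comp_sub_right (a := α) (b := α + Real.pi)
      (fun θ => |Real.sin θ|) α
    simp only [sub_self, add_sub_cancel_left] at this
    rw [← this]
    congr 1; funext θ
    rw [← abs_neg, ← Real.sin_neg, neg_sub]
  rw [h2]
  have h3 : ∫ θ in (0 : ℝ)..Real.pi, |Real.sin θ| = ∫ θ in (0 : ℝ)..Real.pi, Real.sin θ := by
    apply intervalIntegral.integral_congr
    intro θ hθ
    rw [uIcc_of_le Real.pi_pos.le] at hθ
    exact abs_of_nonneg (Real.sin_nonneg_of_nonneg_of_le_pi hθ.1 hθ.2)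
  rw [h3, integral_sin]; simp; norm_num

lemma lintegral_enorm_apply_nor (l : Plane →L[ℝ] ℝ) :
    ∫⁻ θ in Ioc 0 Real.pi, ‖l (nor θ)‖ₑ = 2 * ‖l‖ₑ := by
  obtain ⟨v, rfl⟩ := (InnerProductSpace.toDual ℝ Plane).surjective l
  obtain ⟨α, hα⟩ := exists_eq_norm_smul_dir v
  have hv : ∀ θ, ‖InnerProductSpace.toDual ℝ Plane v (nor θ)‖ₑ =
      ‖v‖ₑ * ENNReal.ofReal |Real.sin (α - θ)| := by
    intro θ
    have : InnerProductSpace.toDual ℝ Plane v (nor θ) = ‖v‖ * Real.sin (α - θ) := by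
      rw [InnerProductSpace.toDual_apply_apply]
      nth_rewrite 1 [hα]
      rw [inner_smul_left, PiLp.inner_apply, Fin.sum_univ_two, Real.sin_sub]
      simp; left; ring
    rw [this, enorm_mul, ← Real.norm_eq_abs, ofReal_norm]
    simp
  simp only [hv]
  rw [lintegral_const_mul' _ _ (by simp), ← ofReal_integral_eq_lintegral_ofReal]
  · rw [← intervalIntegral.integral_of_le Real.pi_pos.le, integral_abs_sin_sub, mul_comm]
    have : ‖(InnerProductSpace.toDual ℝ Plane) v‖ₑ = ‖v‖ₑ := by
      rw [← ofReal_norm, ← ofReal_norm, LinearIsometryEquiv.norm_map]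
    rw [this]; simp
  · apply Continuous.integrableOn_Ioc; fun_prop
  · exact Eventually.of_forall fun θ => abs_nonneg _

/-- Cauchy–Crofton formula for a measurable field of linear forms. -/
lemma two_mul_lintegral_enorm {g : Plane → (Plane →L[ℝ] ℝ)} (hg : Measurable g) :
    2 * ∫⁻ x, ‖g x‖ₑ =
      ∫⁻ θ in Ioc 0 Real.pi, ∫⁻ s : ℝ, ∫⁻ τ : ℝ, ‖g (frame θ (s, τ)) (nor θ)‖ₑ := by
  have hm : Measurable fun q : Plane × ℝ => ‖g q.1 (nor q.2)‖ₑ := by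
    have hc : Continuous fun p : (Plane →L[ℝ] ℝ) × Plane => p.1 p.2 :=
      isBoundedBilinearMap_apply.continuous
    exact (hc.measurable.comp ((hg.comp measurable_fst).prodMk
      (continuous_nor.measurable.comp measurable_snd))).enorm
  rw [← lintegral_const_mul _ hg.enorm]
  simp only [← lintegral_enorm_apply_nor]
  rw [lintegral_lintegral_swap hm.aemeasurable]
  apply lintegral_congr
  intro θ
  have hmθ : Measurable fun x : Plane => ‖g x (nor θ)‖ₑ :=
    hm.comp (measurable_id.prodMk measurable_const)
  rw [← (measurePreserving_frame θ).lintegral_comp hmθ, Measure.volume_eq_prod]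
  exact lintegral_prod _ (hmθ.comp (continuous_frame θ).measurable).aemeasurable

/-- The total length of the projections of a set on all lines (the Cauchy perimeter). -/
noncomputable def cauchyPer (S : Set Plane) : ℝ≥0∞ :=
  ∫⁻ θ in Ioc 0 Real.pi, volume (coord θ '' S)

lemma mem_coord_image {θ s : ℝ} {S : Set Plane} :
    s ∈ coord θ '' S ↔ ∃ τ, frame θ (s, τ) ∈ S := by
  constructor
  · rintro ⟨x, hx, rfl⟩
    exact ⟨_, (frame_coord θ x).symm ▸ hx⟩
  · rintro ⟨τ, h⟩
    exact ⟨_, h, coord_frame θ _⟩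

lemma cauchyPer_mono {S T : Set Plane} (h : S ⊆ T) : cauchyPer S ≤ cauchyPer T :=
  lintegral_mono fun _ => measure_mono (image_mono h)

lemma measurableSet_proj {S : Set Plane} (hS : IsOpen S) :
    MeasurableSet {q : ℝ × ℝ | q.2 ∈ coord q.1 '' S} := by
  have : {q : ℝ × ℝ | q.2 ∈ coord q.1 '' S} =
      Prod.fst '' {r : (ℝ × ℝ) × ℝ | frame r.1.1 (r.1.2, r.2) ∈ S} := by
    ext q
    rw [mem_ofPred_eq, mem_coord_image]
    simp only [mem_ofPred_eq, mem_image, Prod.exists, exists_and_right, exists_eq_right]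
  rw [this]
  apply (isOpenMap_fst _ _).measurableSet
  exact hS.preimage (continuous_frame₂.comp (by fun_prop :
    Continuous fun r : (ℝ × ℝ) × ℝ => (r.1.1, (r.1.2, r.2))))

lemma measurable_volume_proj {S : Set Plane} (hS : IsOpen S) :
    Measurable fun θ => volume (coord θ '' S) :=
  measurable_measure_prodMk_left (measurableSet_proj hS)

/-! ### The coarea formula for quasiconcave functions -/

lemma lintegral_enorm_deriv_of_monotoneOn {φ : ℝ → ℝ} {K : NNReal} (hφ : LipschitzWith K φ)
    {a b : ℝ} (hab : a ≤ b) (hm : MonotoneOn φ (Icc a b)) :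
    ∫⁻ τ in Ioo a b, ‖deriv φ τ‖ₑ = ENNReal.ofReal (φ b - φ a) := by
  have hac : AbsolutelyContinuousOnInterval φ a b :=
    (hφ.lipschitzOnWith (s := uIcc a b)).absolutelyContinuousOnInterval
  have h_int := hac.intervalIntegrable_deriv
  have hnn : ∀ τ ∈ Ioo a b, 0 ≤ deriv φ τ := by
    intro τ hτ
    rw [← derivWithin_of_mem_nhds (Icc_mem_nhds hτ.1 hτ.2)]
    exact hm.derivWithin_nonneg
  rw [← hac.integral_deriv_eq_sub, intervalIntegral.integral_of_le hab,
    integral_Ioc_eq_integral_Ioo, ofReal_integral_eq_lintegral_ofReal]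
  · refine setLIntegral_congr_fun measurableSet_Ioo fun τ hτ => ?_
    exact Real.enorm_of_nonneg (hnn τ hτ)
  · exact (intervalIntegrable_iff_integrableOn_Ioo_of_le hab).1 h_int
  · exact (ae_restrict_iff' measurableSet_Ioo).2 (Eventually.of_forall hnn)

lemma lintegral_enorm_deriv_of_antitoneOn {φ : ℝ → ℝ} {K : NNReal} (hφ : LipschitzWith K φ)
    {a b : ℝ} (hab : a ≤ b) (hm : AntitoneOn φ (Icc a b)) :
    ∫⁻ τ in Ioo a b, ‖deriv φ τ‖ₑ = ENNReal.ofReal (φ a - φ b) := by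
  have h := lintegral_enorm_deriv_of_monotoneOn (φ := fun x => -φ x) (K := K)
    (hφ.neg) hab hm.neg
  simp only [deriv.fun_neg, enorm_neg] at h
  rw [h]; congr 1; ring

/-- The total variation of a compactly supported Lipschitz quasiconcave function on the line. -/
lemma lintegral_enorm_deriv_of_quasiconcave {φ : ℝ → ℝ} {K : NNReal} (hφ : LipschitzWith K φ)
    (hc : HasCompactSupport φ) (h0 : ∀ τ, 0 ≤ φ τ)
    (hq : ∀ t, 0 ≤ t → Convex ℝ {τ | t < φ τ}) :
    ∫⁻ τ, ‖deriv φ τ‖ₑ =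
      2 * ∫⁻ t in Ioi (0 : ℝ), {t : ℝ | ∃ τ, t < φ τ}.indicator 1 t := by
  obtain ⟨m, hm⟩ : ∃ m, ∀ y, φ y ≤ φ m :=
    hφ.continuous.exists_forall_ge_of_hasCompactSupport hc
  have hmono : ∀ x y, x ≤ y → y ≤ m → φ x ≤ φ y := by
    intro x y hxy hym
    by_contra! hlt
    have := (hq (φ y) (h0 y)).ordConnected.out (show x ∈ {τ | φ y < φ τ} from hlt)
      (show m ∈ {τ | φ y < φ τ} from hlt.trans_le (hm x)) ⟨hxy, hym⟩
    exact lt_irrefl _ (mem_ofPred_eq ▸ this)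
  have hanti : ∀ x y, m ≤ x → x ≤ y → φ y ≤ φ x := by
    intro x y hmx hxy
    by_contra! hlt
    have := (hq (φ x) (h0 x)).ordConnected.out
      (show m ∈ {τ | φ x < φ τ} from hlt.trans_le (hm y))
      (show y ∈ {τ | φ x < φ τ} from hlt) ⟨hmx, hxy⟩
    exact lt_irrefl _ (mem_ofPred_eq ▸ this)
  obtain ⟨R, hR⟩ := hc.isCompact.isBounded.subset_closedBall 0
  have hz : ∀ x, R < |x| → φ x = 0 := by
    intro x hx
    by_contra hne
    have := hR (subset_tsupport φ hne)
    rw [mem_closedBall_zero_iff, Real.norm_eq_abs] at this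
    linarith
  set M := max R |m| + 1 with hM
  have hMR : R < M := by have := le_max_left R |m|; linarith
  have hMm : |m| < M := by have := le_max_right R |m|; linarith
  have hM0 : 0 < M := (abs_nonneg m).trans_lt hMm
  obtain ⟨hm1, hm2⟩ := abs_lt.1 hMm
  have hφa : φ (-M) = 0 := hz _ (by rwa [abs_neg, abs_of_pos hM0])
  have hφb : φ M = 0 := hz _ (by rwa [abs_of_pos hM0])
  have hder : ∀ x, M < |x| → deriv φ x = 0 := by
    intro x hx
    have : φ =ᶠ[𝓝 x] fun _ => (0 : ℝ) := by
      filter_upwards [(isOpen_lt continuous_const continuous_abs).mem_nhds hx] with y hy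
      exact hz y (hMR.trans hy)
    rw [this.deriv_eq, deriv_const]
  have hsplit : ∫⁻ τ, ‖deriv φ τ‖ₑ =
      (∫⁻ τ in Ioo (-M) m, ‖deriv φ τ‖ₑ) + ∫⁻ τ in Ioo m M, ‖deriv φ τ‖ₑ := by
    have hdis : Disjoint (Ioo (-M) m) (Ioo m M) := by
      rw [disjoint_left]; intro x hx hx'; exact lt_asymm hx.2 hx'.1
    rw [← lintegral_union measurableSet_Ioo hdis, ← lintegral_indicator
      (measurableSet_Ioo.union measurableSet_Ioo)]
    apply lintegral_congr_ae
    have hnull : ∀ᵐ x : ℝ, x ∉ ({-M, m, M} : Set ℝ) :=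
      measure_eq_zero_iff_ae_notMem.1 ((Set.toFinite _).measure_zero _)
    filter_upwards [hnull] with x hx
    simp only [mem_insert_iff, mem_singleton_iff, not_or] at hx
    by_cases hxM : M < |x|
    · rw [indicator_apply]; split_ifs <;> simp [hder x hxM]
    · rw [indicator_of_mem]
      rw [not_lt, abs_le] at hxM
      rcases lt_or_gt_of_ne hx.2.1 with h | h
      · exact Or.inl ⟨lt_of_le_of_ne hxM.1 (Ne.symm hx.1), h⟩
      · exact Or.inr ⟨h, lt_of_le_of_ne hxM.2 hx.2.2⟩
  rw [hsplit, lintegral_enorm_deriv_of_monotoneOn hφ hm1.le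
      (fun x _ y hy hxy => hmono x y hxy hy.2),
    lintegral_enorm_deriv_of_antitoneOn hφ hm2.le (fun x hx y _ hxy => hanti x y hx.1 hxy),
    hφa, hφb, sub_zero, ← two_mul]
  congr 1
  have : {t : ℝ | ∃ τ, t < φ τ} = Iio (φ m) := by
    ext t
    exact ⟨fun ⟨τ, h⟩ => lt_of_lt_of_le h (hm τ), fun h => ⟨m, h⟩⟩
  rw [this, lintegral_indicator_one measurableSet_Iio, Measure.restrict_apply measurableSet_Iio,
    inter_comm, Ioi_inter_Iio, Real.volume_Ioo, sub_zero]

lemma isOpen_superlevel_proj {f : Plane → ℝ} (hf : Continuous f) (θ : ℝ) :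
    IsOpen {q : ℝ × ℝ | q.1 ∈ coord θ '' {x | q.2 < f x}} := by
  have : {q : ℝ × ℝ | q.1 ∈ coord θ '' {x | q.2 < f x}} =
      Prod.fst '' {r : (ℝ × ℝ) × ℝ | r.1.2 < f (frame θ (r.1.1, r.2))} := by
    ext q
    rw [mem_ofPred_eq, mem_coord_image]
    simp only [mem_ofPred_eq, mem_image, Prod.exists, exists_and_right, exists_eq_right]
  rw [this]
  apply isOpenMap_fst
  have := continuous_frame θ
  exact isOpen_lt (by fun_prop) (by fun_prop)

lemma isOpen_superlevel_proj₂ {f : Plane → ℝ} (hf : Continuous f) :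
    IsOpen {q : (ℝ × ℝ) × ℝ | q.2 ∈ coord q.1.1 '' {x | q.1.2 < f x}} := by
  have : {q : (ℝ × ℝ) × ℝ | q.2 ∈ coord q.1.1 '' {x | q.1.2 < f x}} =
      Prod.fst '' {r : ((ℝ × ℝ) × ℝ) × ℝ | r.1.1.2 < f (frame r.1.1.1 (r.1.2, r.2))} := by
    ext q
    rw [mem_ofPred_eq, mem_coord_image]
    simp only [mem_ofPred_eq, mem_image, Prod.exists, exists_and_right, exists_eq_right]
  rw [this]
  apply isOpenMap_fst
  have := continuous_frame₂
  exact isOpen_lt (by fun_prop) (hf.comp (this.comp (by fun_prop :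
    Continuous fun r : ((ℝ × ℝ) × ℝ) × ℝ => (r.1.1.1, (r.1.2, r.2)))))

lemma hasCompactSupport_comp_frame {f : Plane → ℝ} (hc : HasCompactSupport f) (θ s : ℝ) :
    HasCompactSupport fun τ => f (frame θ (s, τ)) := by
  obtain ⟨R, hR⟩ := hc.isCompact.isBounded.subset_closedBall 0
  apply HasCompactSupport.of_support_subset_isCompact
    (isCompact_closedBall (0 : ℝ) (R + |s|))
  intro τ hτ
  have := hR (subset_tsupport f (by exact hτ : frame θ (s, τ) ∈ Function.support f))
  rw [mem_closedBall_zero_iff] at this ⊢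
  have h2 : τ • nor θ = frame θ (s, τ) - s • dir θ := by simp [frame]
  calc ‖τ‖ = ‖τ • nor θ‖ := by rw [norm_smul, norm_nor, mul_one]
    _ ≤ ‖frame θ (s, τ)‖ + ‖s • dir θ‖ := by rw [h2]; exact norm_sub_le _ _
    _ ≤ R + |s| := by rw [norm_smul, norm_dir, mul_one, Real.norm_eq_abs]; linarith

lemma hasDerivAt_frame (θ s τ : ℝ) : HasDerivAt (fun τ => frame θ (s, τ)) (nor θ) τ := by
  unfold frame
  simpa using ((hasDerivAt_id τ).smul_const (nor θ)).const_add (s • dir θ)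

lemma isometry_frame (θ s : ℝ) : Isometry fun τ => frame θ (s, τ) := by
  apply Isometry.of_dist_eq
  intro a b
  rw [dist_eq_norm, dist_eq_norm]
  have : frame θ (s, a) - frame θ (s, b) = (a - b) • nor θ := by
    simp only [frame, sub_smul]; abel
  rw [this, norm_smul, norm_nor, mul_one]

lemma ae_differentiableAt_frame {f : Plane → ℝ} {K : NNReal} (hf : LipschitzWith K f) (θ : ℝ) :
    ∀ᵐ s : ℝ, ∀ᵐ τ : ℝ, DifferentiableAt ℝ f (frame θ (s, τ)) := by
  have h := (measurePreserving_frame θ).quasiMeasurePreserving.ae hf.ae_differentiableAt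
  rw [Measure.volume_eq_prod] at h
  exact Measure.ae_ae_of_ae_prod h

lemma fderiv_apply_nor {f : Plane → ℝ} {θ s τ : ℝ} (h : DifferentiableAt ℝ f (frame θ (s, τ))) :
    fderiv ℝ f (frame θ (s, τ)) (nor θ) = deriv (fun τ => f (frame θ (s, τ))) τ :=
  (HasFDerivAt.comp_hasDerivAt τ h.hasFDerivAt (hasDerivAt_frame θ s τ)).deriv.symm

lemma convex_preimage_frame {S : Set Plane} (hS : Convex ℝ S) (θ s : ℝ) :
    Convex ℝ {τ | frame θ (s, τ) ∈ S} := by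
  intro a ha b hb p q hp hq hpq
  have : frame θ (s, p • a + q • b) = p • frame θ (s, a) + q • frame θ (s, b) := by
    simp only [frame, smul_add, add_smul, smul_smul, smul_eq_mul]
    have : s • dir θ = (p * s) • dir θ + (q * s) • dir θ := by
      rw [← add_smul, ← add_mul, hpq, one_mul]
    rw [this]; abel
  show frame θ (s, p • a + q • b) ∈ S
  rw [this]
  exact hS ha hb hp hq hpq

/-- Coarea formula for Lipschitz functions with convex superlevel sets. -/
theorem lintegral_enorm_fderiv_eq {f : Plane → ℝ} {K : NNReal} (hf : LipschitzWith K f)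
    (hc : HasCompactSupport f) (h0 : ∀ x, 0 ≤ f x) (hq : ∀ t, 0 ≤ t → Convex ℝ {x | t < f x}) :
    ∫⁻ x, ‖fderiv ℝ f x‖ₑ = ∫⁻ t in Ioi (0 : ℝ), cauchyPer {x | t < f x} := by
  have key : 2 * ∫⁻ x, ‖fderiv ℝ f x‖ₑ =
      2 * ∫⁻ t in Ioi (0 : ℝ), cauchyPer {x | t < f x} := by
    rw [two_mul_lintegral_enorm (measurable_fderiv ℝ f)]
    have hline : ∀ θ : ℝ, ∫⁻ s : ℝ, ∫⁻ τ : ℝ, ‖fderiv ℝ f (frame θ (s, τ)) (nor θ)‖ₑ =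
        2 * ∫⁻ t in Ioi (0 : ℝ), volume (coord θ '' {x | t < f x}) := by
      intro θ
      have h1 : ∫⁻ s : ℝ, ∫⁻ τ : ℝ, ‖fderiv ℝ f (frame θ (s, τ)) (nor θ)‖ₑ =
          ∫⁻ s : ℝ, 2 * ∫⁻ t in Ioi (0 : ℝ),
            {q : ℝ × ℝ | q.1 ∈ coord θ '' {x | q.2 < f x}}.indicator 1 (s, t) := by
        apply lintegral_congr_ae
        filter_upwards [ae_differentiableAt_frame hf θ] with s hs
        have h2 : ∫⁻ τ : ℝ, ‖fderiv ℝ f (frame θ (s, τ)) (nor θ)‖ₑ =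
            ∫⁻ τ : ℝ, ‖deriv (fun τ => f (frame θ (s, τ))) τ‖ₑ := by
          apply lintegral_congr_ae
          filter_upwards [hs] with τ hτ
          rw [fderiv_apply_nor hτ]
        rw [h2, lintegral_enorm_deriv_of_quasiconcave
          (mul_one K ▸ hf.comp (isometry_frame θ s).lipschitz)
          (hasCompactSupport_comp_frame hc θ s) (fun τ => h0 _)
          (fun t ht => convex_preimage_frame (hq t ht) θ s)]
        congr 1
        apply lintegral_congr
        intro t
        have : (∃ τ, t < f (frame θ (s, τ))) ↔ s ∈ coord θ '' {x | t < f x} :=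
          (mem_coord_image (S := {x | t < f x})).symm
        by_cases h : s ∈ coord θ '' {x | t < f x}
        · rw [indicator_of_mem (mem_ofPred_eq ▸ this.2 h), indicator_of_mem (by exact h)]; rfl
        · rw [indicator_of_notMem (by rw [mem_ofPred_eq]; exact fun h' => h (this.1 h')),
            indicator_of_notMem (by exact h)]
      have hm := (isOpen_superlevel_proj hf.continuous θ).measurableSet
      have hm' : Measurable ({q : ℝ × ℝ | q.1 ∈ coord θ '' {x | q.2 < f x}}.indicator
          (1 : ℝ × ℝ → ℝ≥0∞)) := measurable_one.indicator hm
      rw [h1, lintegral_const_mul' _ _ (by simp), lintegral_lintegral_swap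
        (f := fun s t => {q : ℝ × ℝ | q.1 ∈ coord θ '' {x | q.2 < f x}}.indicator
          (1 : ℝ × ℝ → ℝ≥0∞) (s, t)) hm'.aemeasurable]
      congr 1
      apply lintegral_congr
      intro t
      have : (fun s : ℝ => {q : ℝ × ℝ | q.1 ∈ coord θ '' {x | q.2 < f x}}.indicator
          (1 : ℝ × ℝ → ℝ≥0∞) (s, t)) = (coord θ '' {x | t < f x}).indicator 1 := by
        funext s
        exact indicator_eq_indicator Iff.rfl rfl
      simp only [this]
      rw [lintegral_indicator_one]
      exact ((isOpen_superlevel_proj hf.continuous θ).preimage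
        (Continuous.prodMk_left t)).measurableSet
    simp only [hline]
    rw [lintegral_const_mul' _ _ (by simp), lintegral_lintegral_swap]
    · rfl
    · exact (measurable_measure_prodMk_left
        (isOpen_superlevel_proj₂ hf.continuous).measurableSet).aemeasurable
  exact (ENNReal.mul_right_inj (by simp) (by simp)).1 key

/-! ### Intervals and projections -/

lemma volume_add_le_of_forall {I J : Set ℝ} (hI : I.OrdConnected) (hne : I.Nonempty)
    (hb : Bornology.IsBounded I) {t : ℝ} (ht : 0 < t)
    (h : ∀ s ∈ I, ∀ u, |u| < t → s + u ∈ J) :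
    volume I + ENNReal.ofReal (2 * t) ≤ volume J := by
  have hba := hb.bddAbove
  have hbb := hb.bddBelow
  set a := sInf I
  set b := sSup I
  have hIsub : I ⊆ Icc a b := fun x hx => ⟨csInf_le hbb hx, le_csSup hba hx⟩
  have hab : a ≤ b := by obtain ⟨x, hx⟩ := hne; exact (hIsub hx).1.trans (hIsub hx).2
  have hJ : Ioo (a - t) (b + t) ⊆ J := by
    intro x hx
    obtain ⟨p, hp, hpx⟩ := exists_lt_of_csInf_lt hne (show sInf I < x + t by
      have := hx.1; change a < _; linarith)
    obtain ⟨q, hq, hqx⟩ := exists_lt_of_lt_csSup hne (show x - t < sSup I by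
      have := hx.2; change _ < b; linarith)
    by_cases hpx' : x ≤ p
    · have := h p hp (x - p) (by rw [abs_lt]; constructor <;> linarith)
      rwa [add_sub_cancel] at this
    by_cases hqx' : q ≤ x
    · have := h q hq (x - q) (by rw [abs_lt]; constructor <;> linarith)
      rwa [add_sub_cancel] at this
    · have := h x (hI.out hp hq ⟨by linarith, by linarith⟩) 0 (by simpa using ht)
      rwa [add_zero] at this
  calc volume I + ENNReal.ofReal (2 * t) ≤ volume (Icc a b) + ENNReal.ofReal (2 * t) := by
        gcongr
    _ = volume (Ioo (a - t) (b + t)) := by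
        rw [Real.volume_Icc, Real.volume_Ioo, ← ENNReal.ofReal_add (by linarith) (by linarith)]
        congr 1; ring
    _ ≤ volume J := measure_mono hJ

lemma volume_le_add_of_forall {I J : Set ℝ} (hI : I.OrdConnected) (hne : I.Nonempty)
    (hb : Bornology.IsBounded I) {t : ℝ} (ht : 0 ≤ t) (h : ∀ s ∈ J, ∃ s' ∈ I, |s - s'| ≤ t) :
    volume J ≤ volume I + ENNReal.ofReal (2 * t) := by
  have hba := hb.bddAbove
  have hbb := hb.bddBelow
  set a := sInf I
  set b := sSup I
  have hab : a ≤ b := by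
    obtain ⟨x, hx⟩ := hne; exact (csInf_le hbb hx).trans (le_csSup hba hx)
  have hJ : J ⊆ Icc (a - t) (b + t) := by
    intro x hx
    obtain ⟨s, hs, hst⟩ := h x hx
    have h1 : a ≤ s := csInf_le hbb hs
    have h2 : s ≤ b := le_csSup hba hs
    rw [abs_le] at hst
    constructor <;> linarith
  have hIsub : Ioo a b ⊆ I := by
    intro x hx
    obtain ⟨p, hp, hpx⟩ := exists_lt_of_csInf_lt hne hx.1
    obtain ⟨q, hq, hqx⟩ := exists_lt_of_lt_csSup hne hx.2
    exact hI.out hp hq ⟨hpx.le, hqx.le⟩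
  calc volume J ≤ volume (Icc (a - t) (b + t)) := measure_mono hJ
    _ = volume (Ioo a b) + ENNReal.ofReal (2 * t) := by
        rw [Real.volume_Icc, Real.volume_Ioo, ← ENNReal.ofReal_add (by linarith) (by linarith)]
        congr 1; ring
    _ ≤ volume I + ENNReal.ofReal (2 * t) := by gcongr

lemma ordConnected_proj {S : Set Plane} (hS : IsPreconnected S) (θ : ℝ) :
    (coord θ '' S).OrdConnected :=
  (hS.image _ (continuous_coord θ).continuousOn).ordConnected

lemma isBounded_proj {S : Set Plane} (hS : Bornology.IsBounded S) (θ : ℝ) :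
    Bornology.IsBounded (coord θ '' S) := by
  obtain ⟨R, hR⟩ := hS.subset_closedBall 0
  refine (isBounded_closedBall (x := (0 : ℝ)) (r := R)).subset ?_
  rintro _ ⟨x, hx, rfl⟩
  have := hR hx
  rw [mem_closedBall_zero_iff] at this ⊢
  exact (abs_coord_le θ x).trans this

lemma lintegral_const_Ioc_pi (c : ℝ) (hc : 0 ≤ c) :
    ∫⁻ _ in Ioc 0 Real.pi, ENNReal.ofReal (2 * c) = ENNReal.ofReal (2 * Real.pi * c) := by
  rw [setLIntegral_const, Real.volume_Ioc, sub_zero, ← ENNReal.ofReal_mul (by positivity)]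
  congr 1; ring

lemma cauchyPer_add_le {S H : Set Plane} (hS : IsPreconnected S) (hne : S.Nonempty)
    (hb : Bornology.IsBounded S) {t : ℝ} (ht : 0 < t) (h : ∀ x ∈ S, ball x t ⊆ H) :
    cauchyPer S + ENNReal.ofReal (2 * Real.pi * t) ≤ cauchyPer H := by
  rw [← lintegral_const_Ioc_pi t ht.le, cauchyPer, ← lintegral_add_right _ measurable_const]
  apply lintegral_mono
  intro θ
  apply volume_add_le_of_forall (ordConnected_proj hS θ) (hne.image _) (isBounded_proj hb θ) ht
  rintro _ ⟨x, hx, rfl⟩ u hu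
  refine ⟨x + u • dir θ, h x hx ?_, ?_⟩
  · rw [mem_ball, dist_eq_norm, add_sub_cancel_left, norm_smul, norm_dir, mul_one]
    exact hu
  · rw [coord_add, coord_smul, coord_dir, mul_one]

lemma cauchyPer_le_add {S H : Set Plane} (hS : IsPreconnected S) (hne : S.Nonempty)
    (hb : Bornology.IsBounded S) {t : ℝ} (ht : 0 ≤ t) (h : ∀ x ∈ H, ∃ y ∈ S, dist x y ≤ t) :
    cauchyPer H ≤ cauchyPer S + ENNReal.ofReal (2 * Real.pi * t) := by
  rw [← lintegral_const_Ioc_pi t ht, cauchyPer, cauchyPer, ← lintegral_add_right _ measurable_const]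
  apply lintegral_mono
  intro θ
  apply volume_le_add_of_forall (ordConnected_proj hS θ) (hne.image _) (isBounded_proj hb θ) ht
  rintro _ ⟨x, hx, rfl⟩
  obtain ⟨y, hy, hxy⟩ := h x hx
  refine ⟨coord θ y, mem_image_of_mem _ hy, ?_⟩
  rw [← coord_sub]
  exact (abs_coord_le θ _).trans (by rwa [← dist_eq_norm])

@[simp] lemma cauchyPer_singleton (x : Plane) : cauchyPer {x} = 0 := by
  simp [cauchyPer]

@[simp] lemma cauchyPer_empty : cauchyPer ∅ = 0 := by
  simp [cauchyPer]

lemma cauchyPer_lt_top {S : Set Plane} (hb : Bornology.IsBounded S) : cauchyPer S < ∞ := by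
  obtain ⟨R, hR⟩ := hb.subset_closedBall 0
  refine (cauchyPer_le_add (S := {0}) (t := max R 0) isPreconnected_singleton (singleton_nonempty _)
    Bornology.isBounded_singleton (le_max_right _ _) fun x hx => ⟨0, rfl, ?_⟩).trans_lt ?_
  · exact (mem_closedBall.1 (hR hx)).trans (le_max_left _ _)
  · simp

/-! ### Gradient of the distance function -/

lemma one_le_norm_fderiv_infDist {A : Set Plane} (hA : IsClosed A) (hne : A.Nonempty) {x : Plane}
    (hx : x ∉ A) (hd : DifferentiableAt ℝ (fun y => infDist y A) x) :
    1 ≤ ‖fderiv ℝ (fun y => infDist y A) x‖ := by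
  obtain ⟨p, hp, hpd⟩ := hA.exists_infDist_eq_dist hne x
  set d := dist x p with hdd
  have hd0 : 0 < d := dist_pos.2 fun h => hx (h ▸ hp)
  set f := fun y => infDist y A with hf
  have hnorm : ‖p - x‖ = d := by rw [hdd, dist_comm, dist_eq_norm]
  have hg : HasDerivAt (fun t : ℝ => f (x + t • (p - x))) (fderiv ℝ f x (p - x)) 0 := by
    have hline : HasDerivAt (fun t : ℝ => x + t • (p - x)) (p - x) 0 := by
      simpa using ((hasDerivAt_id (0 : ℝ)).smul_const (p - x)).const_add x
    have hd' : HasFDerivAt f (fderiv ℝ f x) (x + (0 : ℝ) • (p - x)) := by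
      simpa using hd.hasFDerivAt
    exact hd'.comp_hasDerivAt (0 : ℝ) hline
  have heq : ∀ t ∈ Icc (0 : ℝ) 1, f (x + t • (p - x)) = (1 - t) * d := by
    intro t ht
    apply le_antisymm
    · refine (infDist_le_dist_of_mem hp).trans_eq ?_
      rw [dist_eq_norm]
      have : x + t • (p - x) - p = (t - 1) • (p - x) := by rw [sub_smul, one_smul]; abel
      rw [this, norm_smul, hnorm, Real.norm_eq_abs, abs_of_nonpos (by linarith [ht.2])]; ring
    · have h1 : infDist x A ≤ infDist (x + t • (p - x)) A + dist x (x + t • (p - x)) :=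
        infDist_le_infDist_add_dist
      rw [dist_self_add_right, norm_smul, hnorm, Real.norm_eq_abs, abs_of_nonneg ht.1, hpd] at h1
      change _ ≤ infDist _ _
      linarith
  have hg2 : HasDerivWithinAt (fun t : ℝ => f (x + t • (p - x))) (-d) (Icc 0 1) 0 := by
    have : HasDerivAt (fun t : ℝ => (1 - t) * d) (-d) 0 := by
      simpa using ((hasDerivAt_id (0 : ℝ)).const_sub 1).mul_const d
    exact this.hasDerivWithinAt.congr heq (heq 0 (by simp))
  have hu : UniqueDiffWithinAt ℝ (Icc (0 : ℝ) 1) 0 :=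
    uniqueDiffOn_Icc one_pos 0 (by simp)
  have he : fderiv ℝ f x (p - x) = -d := hu.eq_deriv _ hg.hasDerivWithinAt hg2
  have := (fderiv ℝ f x).le_opNorm (p - x)
  rw [he, norm_neg, Real.norm_eq_abs, abs_of_pos hd0, hnorm] at this
  nlinarith

lemma le_infDist_compl_iff {H : Set Plane} (hne : Hᶜ.Nonempty) {x : Plane} {t : ℝ} :
    t ≤ infDist x Hᶜ ↔ ball x t ⊆ H := by
  rw [le_infDist hne]
  constructor
  · intro h y hy
    by_contra hyH
    have := h (y := y) hyH
    rw [mem_ball, dist_comm] at hy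
    linarith
  · intro h y hy
    by_contra! hlt
    exact hy (h (by rwa [mem_ball, dist_comm]))

lemma ball_combo_subset {H : Set Plane} (hH : Convex ℝ H) {x y : Plane} {t : ℝ}
    (hx : ball x t ⊆ H) (hy : ball y t ⊆ H) {a b : ℝ} (ha : 0 ≤ a) (hb : 0 ≤ b)
    (hab : a + b = 1) : ball (a • x + b • y) t ⊆ H := by
  intro z hz
  set w := z - (a • x + b • y) with hw
  have hwn : ‖w‖ < t := by rwa [hw, ← dist_eq_norm]
  have : z = a • (x + w) + b • (y + w) := by
    have : a • w + b • w = w := by rw [← add_smul, hab, one_smul]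
    calc z = (a • x + b • y) + w := by rw [hw]; abel
      _ = (a • x + b • y) + (a • w + b • w) := by rw [this]
      _ = _ := by rw [smul_add, smul_add]; abel
  rw [this]
  exact hH (hx (by simpa using hwn)) (hy (by simpa using hwn)) ha hb hab

lemma convex_lt_infDist_compl {H : Set Plane} (hH : Convex ℝ H) (hne : Hᶜ.Nonempty) (t : ℝ) :
    Convex ℝ {x | t < infDist x Hᶜ} := by
  intro x hx y hy a b ha hb hab
  rw [mem_ofPred_eq] at hx hy ⊢
  set s := min (infDist x Hᶜ) (infDist y Hᶜ)
  have hs : t < s := lt_min hx hy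
  refine hs.trans_le ((le_infDist_compl_iff hne).2 (ball_combo_subset hH ?_ ?_ ha hb hab))
  · exact (le_infDist_compl_iff hne).1 (min_le_left _ _)
  · exact (le_infDist_compl_iff hne).1 (min_le_right _ _)

/-! ### The inequalities of Bonnesen and Steiner -/

/-- The area swept by inner parallel sets up to depth `ρ` for initial perimeter `P`. -/
noncomputable def sweep (ρ : ℝ) (P : ℝ≥0∞) : ℝ≥0∞ :=
  ∫⁻ t in Ioo 0 ρ, (P - ENNReal.ofReal (2 * Real.pi * t))

lemma volume_le_sweep {H : Set Plane} (hHo : IsOpen H) (hHc : Convex ℝ H)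
    (hHb : Bornology.IsBounded H) {ρ : ℝ} (hρ : 0 < ρ) :
    volume H ≤ volume {x | ρ ≤ infDist x Hᶜ} + sweep ρ (cauchyPer H) := by
  have hne : Hᶜ.Nonempty := by
    by_contra h
    rw [not_nonempty_iff_eq_empty, compl_empty_iff] at h
    exact NormedSpace.unbounded_univ ℝ Plane (h ▸ hHb)
  have hcl : IsClosed Hᶜ := hHo.isClosed_compl
  set d := fun x : Plane => infDist x Hᶜ with hd
  have hdl : LipschitzWith 1 d := lipschitz_infDist_pt _
  set f := fun x : Plane => min (d x) ρ with hf
  have hfl : LipschitzWith 1 f := hdl.min_const ρ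
  have hd0 : ∀ x, x ∉ H → d x = 0 := fun x hx => infDist_zero_of_mem hx
  have hfc : HasCompactSupport f := by
    refine HasCompactSupport.of_support_subset_isCompact
      (hHb.isCompact_closure) fun x hx => subset_closure ?_
    by_contra hxH
    exact hx (by simp only [hf, hd0 x hxH]; exact min_eq_left hρ.le)
  have hf0 : ∀ x, 0 ≤ f x := fun x => le_min infDist_nonneg hρ.le
  have hset : ∀ t, t < ρ → {x | t < f x} = {x | t < d x} := by
    intro t ht; ext x
    rw [mem_ofPred_eq, mem_ofPred_eq, hf, lt_min_iff, and_iff_left ht]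
  have hset' : ∀ t, ρ ≤ t → {x | t < f x} = ∅ := by
    intro t ht
    rw [eq_empty_iff_forall_notMem]
    intro x hx
    exact absurd (lt_min_iff.1 hx).2 (not_lt.2 ht)
  have hq : ∀ t, 0 ≤ t → Convex ℝ {x | t < f x} := by
    intro t _
    rcases lt_or_ge t ρ with h | h
    · rw [hset t h]; exact convex_lt_infDist_compl hHc hne t
    · rw [hset' t h]; exact convex_empty
  have hco := lintegral_enorm_fderiv_eq hfl hfc hf0 hq
  have h1 : ∫⁻ t in Ioi (0 : ℝ), cauchyPer {x | t < f x} ≤ sweep ρ (cauchyPer H) := by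
    rw [sweep, ← lintegral_indicator measurableSet_Ioi, ← lintegral_indicator measurableSet_Ioo]
    apply lintegral_mono
    intro t
    by_cases ht : t ∈ Ioo 0 ρ
    · simp only [indicator_of_mem (show t ∈ Ioi 0 from ht.1), indicator_of_mem ht, hset t ht.2]
      rcases eq_empty_or_nonempty {x | t < d x} with he | hn
      · rw [he, cauchyPer_empty]; exact zero_le
      · apply ENNReal.le_sub_of_add_le_right (by simp)
        refine cauchyPer_add_le (convex_lt_infDist_compl hHc hne t).isPreconnected hn
          (hHb.subset fun x hx => ?_) ht.1 fun x hx => ?_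
        · by_contra hxH
          have : t < d x := hx
          rw [hd0 x hxH] at this
          exact lt_asymm this ht.1
        · exact (le_infDist_compl_iff hne).1 (le_of_lt hx)
    · by_cases ht0 : 0 < t
      · simp only [indicator_of_mem (show t ∈ Ioi 0 from ht0),
          hset' t (not_lt.1 fun h => ht ⟨ht0, h⟩), cauchyPer_empty]
        exact zero_le
      · simp only [indicator_of_notMem (show t ∉ Ioi 0 from ht0)]
        exact zero_le
  set A := {x | x ∈ H ∧ d x < ρ} with hA
  have hAo : IsOpen A := hHo.inter (isOpen_lt hdl.continuous continuous_const)
  have h2 : volume A ≤ ∫⁻ x, ‖fderiv ℝ f x‖ₑ := by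
    rw [← lintegral_indicator_one hAo.measurableSet]
    apply lintegral_mono_ae
    filter_upwards [hdl.ae_differentiableAt] with x hx
    by_cases hxA : x ∈ A
    · rw [indicator_of_mem hxA]
      have : f =ᶠ[𝓝 x] d := by
        filter_upwards [hAo.mem_nhds hxA] with y hy
        exact min_eq_left hy.2.le
      rw [this.fderiv_eq, ← ofReal_norm, Pi.one_apply, ← ENNReal.ofReal_one]
      exact ENNReal.ofReal_le_ofReal
        (one_le_norm_fderiv_infDist hcl hne (fun h => h hxA.1) hx)
    · rw [indicator_of_notMem hxA]; exact zero_le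
  calc volume H ≤ volume ({x | ρ ≤ d x} ∪ A) := by
        apply measure_mono
        intro x hx
        rcases le_or_gt ρ (d x) with h | h
        · exact Or.inl h
        · exact Or.inr ⟨hx, h⟩
    _ ≤ volume {x | ρ ≤ d x} + volume A := measure_union_le _ _
    _ ≤ _ := by gcongr; exact (h2.trans hco.le).trans h1

/-- The tent function of height `ρ` over the set `D`. -/
noncomputable def tent (ρ : ℝ) (D : Set Plane) (x : Plane) : ℝ := max (ρ - infDist x D) 0

lemma tent_nonneg (ρ : ℝ) (D : Set Plane) (x : Plane) : 0 ≤ tent ρ D x := le_max_right _ _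

lemma lipschitzWith_tent (ρ : ℝ) (D : Set Plane) : LipschitzWith 1 (tent ρ D) := by
  have : LipschitzWith 1 fun x => ρ - infDist x D := by
    apply LipschitzWith.of_dist_le_mul
    intro x y
    rw [dist_sub_left]
    exact (lipschitz_infDist_pt D).dist_le_mul x y
  exact this.max_const 0

lemma superlevel_tent {D : Set Plane} (hne : D.Nonempty) (ρ : ℝ) {t : ℝ} (ht : 0 ≤ t) :
    {x | t < tent ρ D x} = thickening (ρ - t) D := by
  ext x
  rw [mem_thickening_iff_infDist_lt hne, mem_ofPred_eq, tent, lt_max_iff]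
  constructor
  · rintro (h | h) <;> linarith
  · intro h; left; linarith

lemma hasCompactSupport_tent {D : Set Plane} (hD : IsCompact D) (hne : D.Nonempty) (ρ : ℝ) :
    HasCompactSupport (tent ρ D) := by
  refine HasCompactSupport.of_support_subset_isCompact (hD.cthickening (r := ρ)) fun x hx => ?_
  apply thickening_subset_cthickening
  rw [← sub_zero ρ, ← superlevel_tent hne ρ le_rfl]
  exact lt_of_le_of_ne (tent_nonneg ρ D x) (Ne.symm hx)

lemma lintegral_enorm_fderiv_tent {D : Set Plane} (hD : IsCompact D) (hDc : Convex ℝ D)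
    (hne : D.Nonempty) (ρ : ℝ) :
    ∫⁻ x, ‖fderiv ℝ (tent ρ D) x‖ₑ = ∫⁻ t in Ioi (0 : ℝ), cauchyPer {x | t < tent ρ D x} := by
  refine lintegral_enorm_fderiv_eq (lipschitzWith_tent ρ D) (hasCompactSupport_tent hD hne ρ)
    (tent_nonneg ρ D) fun t ht => ?_
  rw [superlevel_tent hne ρ ht]; exact hDc.thickening _

lemma add_sweep_le_volume_cthickening {D : Set Plane} (hD : IsCompact D) (hDc : Convex ℝ D)
    (hne : D.Nonempty) (ρ : ℝ) :
    volume D + sweep ρ (cauchyPer D + ENNReal.ofReal (2 * Real.pi * ρ)) ≤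
      volume (cthickening ρ D) := by
  set d := fun x : Plane => infDist x D with hd
  have hdl : LipschitzWith 1 d := lipschitz_infDist_pt _
  set f := tent ρ D with hf
  have hco := lintegral_enorm_fderiv_tent hD hDc hne ρ
  have h1 : sweep ρ (cauchyPer D + ENNReal.ofReal (2 * Real.pi * ρ)) ≤
      ∫⁻ t in Ioi (0 : ℝ), cauchyPer {x | t < f x} := by
    rw [sweep]
    refine (setLIntegral_mono' measurableSet_Ioo fun t ht => ?_).trans
      (lintegral_mono_set Ioo_subset_Ioi_self)
    rw [superlevel_tent hne ρ ht.1.le, tsub_le_iff_right]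
    refine le_trans ?_ (add_le_add_left (cauchyPer_add_le (t := ρ - t) hDc.isPreconnected hne
      hD.isBounded (by linarith [ht.2]) fun x hx => ball_subset_thickening hx _) _)
    rw [add_assoc, ← ENNReal.ofReal_add]
    · gcongr; apply le_of_eq; ring
    · have := ht.2; have := Real.pi_pos; apply mul_nonneg (by positivity); linarith
    · have := ht.1; positivity
  set A := {x | 0 < d x ∧ d x < ρ} with hA
  have hAo : IsOpen A := (isOpen_lt continuous_const hdl.continuous).inter
    (isOpen_lt hdl.continuous continuous_const)
  have h2 : ∫⁻ x, ‖fderiv ℝ f x‖ₑ ≤ volume A := by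
    rw [← lintegral_indicator_one hAo.measurableSet]
    apply lintegral_mono
    intro x
    by_cases hxA : x ∈ A
    · rw [indicator_of_mem hxA, Pi.one_apply]
      change ‖fderiv ℝ f x‖ₑ ≤ 1
      rw [← ofReal_norm]
      apply ENNReal.ofReal_le_one.2
      simpa using norm_fderiv_le_of_lipschitz ℝ (lipschitzWith_tent ρ D) (x₀ := x)
    · rw [indicator_of_notMem hxA]
      have : fderiv ℝ f x = 0 := by
        rcases le_or_gt (d x) 0 with h | h
        · apply IsLocalMax.fderiv_eq_zero
          refine Eventually.of_forall fun y => ?_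
          have h3 : 0 ≤ d y := infDist_nonneg
          exact max_le_max (by linarith) le_rfl
        · apply IsLocalMin.fderiv_eq_zero
          have h4 : ρ ≤ d x := not_lt.1 fun h' => hxA ⟨h, h'⟩
          refine Eventually.of_forall fun y => ?_
          have : f x = 0 := max_eq_right (by linarith)
          rw [this]; exact tent_nonneg ρ D y
      change ‖fderiv ℝ f x‖ₑ ≤ 0
      rw [← ofReal_norm, this, norm_zero, ENNReal.ofReal_zero]
  have hdis : Disjoint D A := by
    rw [disjoint_left]; intro x hx hxA
    have : d x = 0 := infDist_zero_of_mem hx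
    exact absurd hxA.1 (by rw [this]; exact lt_irrefl 0)
  calc _ ≤ volume D + volume A := by gcongr; exact h1.trans (hco.ge.trans h2)
    _ = volume (D ∪ A) := (measure_union hdis hAo.measurableSet).symm
    _ ≤ _ := by
      apply measure_mono
      rintro x (hx | hx)
      · exact self_subset_cthickening D hx
      · apply thickening_subset_cthickening
        rw [mem_thickening_iff_infDist_lt hne]; exact hx.2

/-! ### Divergence and the perimeter of convex sets -/

lemma continuous_vecDiv {φ : Plane → Plane} (hφ : ContDiff ℝ 1 φ) : Continuous (vecDiv φ) := by
  unfold vecDiv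
  have := hφ.continuous_fderiv one_ne_zero
  fun_prop

lemma hasCompactSupport_vecDiv {φ : Plane → Plane} (hc : HasCompactSupport φ) :
    HasCompactSupport (vecDiv φ) := by
  refine (hc.fderiv (𝕜 := ℝ)).mono fun x hx => ?_
  intro h
  apply hx
  simp [vecDiv, h]

lemma integrable_vecDiv {φ : Plane → Plane} (hφ : ContDiff ℝ 1 φ) (hc : HasCompactSupport φ) :
    Integrable (vecDiv φ) :=
  (continuous_vecDiv hφ).integrable_of_hasCompactSupport (hasCompactSupport_vecDiv hc)

lemma fderiv_apply_eq_sum (l : Plane →L[ℝ] ℝ) (w : Plane) :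
    l w = ∑ i, l (EuclideanSpace.single i 1) * w i := by
  have hw : w = ∑ i, w i • EuclideanSpace.single i (1 : ℝ) := by
    ext j; fin_cases j <;> simp
  conv_lhs => rw [hw]
  simp [mul_comm]

/-- Integration by parts of the divergence against a Lipschitz function. -/
lemma integral_mul_vecDiv {v : Plane → ℝ} {K : NNReal} (hv : LipschitzWith K v)
    (hvc : HasCompactSupport v) {φ : Plane → Plane} (hφ : ContDiff ℝ 1 φ)
    (hc : HasCompactSupport φ) :
    ∫ x, v x * vecDiv φ x = - ∫ x, fderiv ℝ v x (φ x) := by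
  have hφi : ∀ i, ContDiff ℝ 1 fun x => φ x i := fun i => by fun_prop
  have hci : ∀ i, HasCompactSupport fun x => φ x i := fun i => by
    refine hc.mono fun x hx h => hx ?_
    simp [h]
  have hpart : ∀ i, ∫ x, v x * fderiv ℝ φ x (EuclideanSpace.single i 1) i =
      - ∫ x, fderiv ℝ v x (EuclideanSpace.single i 1) * φ x i := by
    intro i
    obtain ⟨C, hC⟩ := (hφi i).lipschitzWith_of_hasCompactSupport (hci i) one_ne_zero
    have h := hC.integral_lineDeriv_mul_eq hv hvc (μ := volume) (EuclideanSpace.single i 1)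
    have h1 : ∀ x, lineDeriv ℝ (fun x => φ x i) x (EuclideanSpace.single i 1) =
        fderiv ℝ φ x (EuclideanSpace.single i 1) i := by
      intro x
      have hd : DifferentiableAt ℝ φ x := hφ.differentiable one_ne_zero x
      have hd' : HasFDerivAt (fun x => φ x i)
          ((EuclideanSpace.proj i : Plane →L[ℝ] ℝ).comp (fderiv ℝ φ x)) x :=
        (EuclideanSpace.proj i : Plane →L[ℝ] ℝ).hasFDerivAt.comp x hd.hasFDerivAt
      rw [hd'.differentiableAt.lineDeriv_eq_fderiv, hd'.fderiv]
      rfl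
    simp only [h1] at h
    rw [← integral_neg]
    calc _ = ∫ x, fderiv ℝ φ x (EuclideanSpace.single i 1) i * v x := by
          simp only [mul_comm]
      _ = _ := h
      _ = _ := by
        apply integral_congr_ae
        filter_upwards [hv.ae_differentiableAt] with x hx
        rw [hx.lineDeriv_eq_fderiv]; simp
  have hdc : Continuous fun x => fderiv ℝ φ x := hφ.continuous_fderiv one_ne_zero
  calc ∫ x, v x * vecDiv φ x
      = ∑ i, ∫ x, v x * fderiv ℝ φ x (EuclideanSpace.single i 1) i := by
        rw [← integral_finsetSum]
        · simp only [vecDiv, Finset.mul_sum]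
        · intro i _
          apply Continuous.integrable_of_hasCompactSupport
          · have := hv.continuous; fun_prop
          · exact hvc.mul_right
    _ = - ∑ i, ∫ x, fderiv ℝ v x (EuclideanSpace.single i 1) * φ x i := by
        simp only [hpart, Finset.sum_neg_distrib]
    _ = _ := by
        rw [← integral_finsetSum]
        · congr 2; funext x; rw [fderiv_apply_eq_sum]
        · intro i _
          have h_int : Integrable fun x => φ x i :=
            (hφi i).continuous.integrable_of_hasCompactSupport (hci i)
          refine h_int.bdd_mul (c := K) ?_ ?_
          · exact (measurable_fderiv_apply_const ℝ v _).aestronglyMeasurable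
          · refine Eventually.of_forall fun x => ?_
            refine ((fderiv ℝ v x).le_opNorm _).trans ?_
            simpa using norm_fderiv_le_of_lipschitz ℝ hv (x₀ := x)

lemma ofReal_integral_mul_vecDiv_le {v : Plane → ℝ} {K : NNReal} (hv : LipschitzWith K v)
    (hvc : HasCompactSupport v) {φ : Plane → Plane} (hφ : ContDiff ℝ 1 φ)
    (hc : HasCompactSupport φ) (h1 : ∀ x, ‖φ x‖ ≤ 1) :
    ENNReal.ofReal (∫ x, v x * vecDiv φ x) ≤ ∫⁻ x, ‖fderiv ℝ v x‖ₑ := by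
  rw [integral_mul_vecDiv hv hvc hφ hc, ← integral_neg]
  refine (ENNReal.ofReal_le_ofReal (le_abs_self _)).trans ?_
  rw [← Real.norm_eq_abs, ofReal_norm]
  refine (enorm_integral_le_lintegral_enorm _).trans (lintegral_mono fun x => ?_)
  change ‖-(fderiv ℝ v x (φ x))‖ₑ ≤ ‖fderiv ℝ v x‖ₑ
  rw [enorm_neg, ← ofReal_norm, ← ofReal_norm]
  apply ENNReal.ofReal_le_ofReal
  refine ((fderiv ℝ v x).le_opNorm _).trans ?_
  exact mul_le_of_le_one_right (norm_nonneg _) (h1 x)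

lemma integral_vecDiv_eq_zero {φ : Plane → Plane} (hφ : ContDiff ℝ 1 φ)
    (hc : HasCompactSupport φ) : ∫ x, vecDiv φ x = 0 := by
  have hdc : Continuous fun x => fderiv ℝ φ x := hφ.continuous_fderiv one_ne_zero
  simp only [vecDiv]
  rw [integral_finsetSum]
  · apply Finset.sum_eq_zero
    intro i _
    have hφi : ContDiff ℝ 1 fun x => φ x i := by fun_prop
    have hci : HasCompactSupport fun x => φ x i := by
      refine hc.mono fun x hx h => hx ?_
      simp [h]
    obtain ⟨C, hC⟩ := hφi.lipschitzWith_of_hasCompactSupport hci one_ne_zero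
    have h := (LipschitzWith.const (1 : ℝ) (α := Plane)).integral_lineDeriv_mul_eq hC hci
      (μ := volume) (EuclideanSpace.single i 1)
    have h1 : ∀ x, lineDeriv ℝ (fun x => φ x i) x (-EuclideanSpace.single i 1) =
        -fderiv ℝ φ x (EuclideanSpace.single i 1) i := by
      intro x
      have hd : DifferentiableAt ℝ φ x := hφ.differentiable one_ne_zero x
      have hd' : HasFDerivAt (fun x => φ x i)
          ((EuclideanSpace.proj i : Plane →L[ℝ] ℝ).comp (fderiv ℝ φ x)) x :=
        (EuclideanSpace.proj i : Plane →L[ℝ] ℝ).hasFDerivAt.comp x hd.hasFDerivAt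
      rw [hd'.differentiableAt.lineDeriv_eq_fderiv, hd'.fderiv]
      simp
    simp only [h1, mul_one, integral_neg] at h
    simpa [lineDeriv] using h
  · intro i _
    apply Continuous.integrable_of_hasCompactSupport
    · fun_prop
    · refine (hc.fderiv (𝕜 := ℝ)).mono fun x hx h => hx ?_
      simp [h]

lemma vecDiv_smul {u : Plane → ℝ} (hu : ContDiff ℝ 1 u) {φ : Plane → Plane}
    (hφ : ContDiff ℝ 1 φ) (x : Plane) :
    vecDiv (fun x => u x • φ x) x = u x * vecDiv φ x + fderiv ℝ u x (φ x) := by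
  rw [vecDiv, vecDiv, fderiv_apply_eq_sum, Finset.mul_sum, ← Finset.sum_add_distrib]
  refine Finset.sum_congr rfl fun i _ => ?_
  rw [fderiv_fun_smul (hu.differentiable one_ne_zero x) (hφ.differentiable one_ne_zero x)]
  simp

/-- Integration by parts of the divergence against a `C¹` function. -/
lemma integral_mul_vecDiv_of_contDiff {u : Plane → ℝ} (hu : ContDiff ℝ 1 u) {φ : Plane → Plane}
    (hφ : ContDiff ℝ 1 φ) (hc : HasCompactSupport φ) :
    ∫ x, u x * vecDiv φ x = - ∫ x, fderiv ℝ u x (φ x) := by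
  have h := integral_vecDiv_eq_zero (hu.smul hφ) (hc.smul_left (f := u))
  have huc := hu.continuous
  have hdu : Continuous fun x => fderiv ℝ u x := hu.continuous_fderiv one_ne_zero
  have hφc := hφ.continuous
  have hdiv := continuous_vecDiv hφ
  change ∫ x, vecDiv (fun x => u x • φ x) x = 0 at h
  simp only [vecDiv_smul hu hφ] at h
  rw [integral_add] at h
  · linarith
  · exact Continuous.integrable_of_hasCompactSupport (by fun_prop)
      (hasCompactSupport_vecDiv hc).mul_left
  · refine Continuous.integrable_of_hasCompactSupport (by fun_prop) ?_
    refine hc.mono fun x hx h => hx ?_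
    change fderiv ℝ u x (φ x) = 0
    rw [h, map_zero]

lemma per_le_cauchyPer {D : Set Plane} (hD : IsCompact D) (hDc : Convex ℝ D) :
    per D ≤ cauchyPer D := by
  rcases D.eq_empty_or_nonempty with rfl | hne
  · simp [per, perIn]
  refine iSup_le fun ⟨φ, hφ, hc, _, h1⟩ => ?_
  have h_int := integrable_vecDiv hφ hc
  have hbound : ∀ h : ℝ, 0 < h → ENNReal.ofReal (∫ x, (h⁻¹ * tent h D x) * vecDiv φ x) ≤
      cauchyPer D + ENNReal.ofReal (2 * Real.pi * h) := by
    intro h hh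
    have e : ∫ x, (h⁻¹ * tent h D x) * vecDiv φ x = h⁻¹ * ∫ x, tent h D x * vecDiv φ x := by
      rw [← integral_const_mul]; simp only [mul_assoc]
    rw [e, ENNReal.ofReal_mul (by positivity)]
    have h2 : ∫⁻ t in Ioi (0 : ℝ), cauchyPer {x | t < tent h D x} ≤
        ENNReal.ofReal h * (cauchyPer D + ENNReal.ofReal (2 * Real.pi * h)) := by
      have : ∀ t ∈ Ioi (0 : ℝ), cauchyPer {x | t < tent h D x} ≤
          (Ioo 0 h).indicator (fun _ => cauchyPer D + ENNReal.ofReal (2 * Real.pi * h)) t := by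
        intro t ht
        rw [superlevel_tent hne h (le_of_lt ht)]
        by_cases hth : t < h
        · rw [indicator_of_mem (show t ∈ Ioo 0 h from ⟨ht, hth⟩)]
          refine cauchyPer_le_add hDc.isPreconnected hne hD.isBounded hh.le fun x hx => ?_
          obtain ⟨y, hy, hxy⟩ := mem_thickening_iff.1 hx
          exact ⟨y, hy, by have : 0 < t := ht; linarith⟩
        · rw [thickening_of_nonpos (by linarith), cauchyPer_empty]; exact zero_le
      refine (setLIntegral_mono' measurableSet_Ioi this).trans ?_
      refine (setLIntegral_le_lintegral _ _).trans ?_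
      rw [lintegral_indicator measurableSet_Ioo, setLIntegral_const, Real.volume_Ioo, sub_zero,
        mul_comm]
    calc _ ≤ ENNReal.ofReal h⁻¹ *
          (ENNReal.ofReal h * (cauchyPer D + ENNReal.ofReal (2 * Real.pi * h))) := by
          gcongr
          exact ((ofReal_integral_mul_vecDiv_le (lipschitzWith_tent h D)
            (hasCompactSupport_tent hD hne h) hφ hc h1).trans
            (lintegral_enorm_fderiv_tent hD hDc hne h).le).trans h2
      _ = _ := by
          rw [← mul_assoc, ← ENNReal.ofReal_mul (by positivity), inv_mul_cancel₀ hh.ne',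
            ENNReal.ofReal_one, one_mul]
  set h : ℕ → ℝ := fun n => 1 / ((n : ℝ) + 1) with hh
  have hpos : ∀ n, 0 < h n := fun n => by positivity
  have hlim : Tendsto h atTop (𝓝 0) := tendsto_one_div_add_atTop_nhds_zero_nat
  have hL : Tendsto (fun n => ∫ x, ((h n)⁻¹ * tent (h n) D x) * vecDiv φ x) atTop
      (𝓝 (∫ x in D, vecDiv φ x)) := by
    rw [← integral_indicator hD.measurableSet]
    refine tendsto_integral_of_dominated_convergence (fun x => ‖vecDiv φ x‖) ?_ h_int.norm ?_ ?_
    · intro n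
      have := (lipschitzWith_tent (h n) D).continuous
      have := continuous_vecDiv hφ
      exact Continuous.aestronglyMeasurable (by fun_prop)
    · intro n
      refine Eventually.of_forall fun x => ?_
      rw [norm_mul]
      refine mul_le_of_le_one_left (norm_nonneg _) ?_
      rw [Real.norm_eq_abs, abs_of_nonneg (mul_nonneg (inv_nonneg.2 (hpos n).le)
        (tent_nonneg _ _ _)), inv_mul_le_one₀ (hpos n)]
      exact max_le (by linarith [infDist_nonneg (x := x) (s := D)]) (hpos n).le
    · refine Eventually.of_forall fun x => ?_
      by_cases hx : x ∈ D
      · rw [indicator_of_mem hx]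
        refine tendsto_const_nhds.congr fun n => ?_
        rw [tent, infDist_zero_of_mem hx, sub_zero, max_eq_left (hpos n).le,
          inv_mul_cancel₀ (hpos n).ne', one_mul]
      · rw [indicator_of_notMem hx]
        have hd : 0 < infDist x D := (hD.isClosed.notMem_iff_infDist_pos hne).1 hx
        refine tendsto_const_nhds.congr' ?_
        filter_upwards [hlim.eventually (gt_mem_nhds hd)] with n hn
        rw [tent, max_eq_right (by linarith), mul_zero, zero_mul]
  have hR : Tendsto (fun n => cauchyPer D + ENNReal.ofReal (2 * Real.pi * h n)) atTop
      (𝓝 (cauchyPer D + ENNReal.ofReal (2 * Real.pi * 0))) :=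
    (ENNReal.tendsto_ofReal (hlim.const_mul _)).const_add _
  rw [mul_zero, ENNReal.ofReal_zero, add_zero] at hR
  exact le_of_tendsto_of_tendsto' (ENNReal.tendsto_ofReal hL) hR fun n => hbound _ (hpos n)

/-! ### Mollified indicator functions -/

/-- The gradient of a function on the plane. -/
noncomputable def grad (u : Plane → ℝ) (x : Plane) : Plane :=
  (InnerProductSpace.toDual ℝ Plane).symm (fderiv ℝ u x)

lemma norm_grad (u : Plane → ℝ) (x : Plane) : ‖grad u x‖ = ‖fderiv ℝ u x‖ := by
  simp [grad]

lemma fderiv_apply_grad (u : Plane → ℝ) (x : Plane) :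
    fderiv ℝ u x (grad u x) = ‖fderiv ℝ u x‖ ^ 2 := by
  have h : fderiv ℝ u x = InnerProductSpace.toDual ℝ Plane (grad u x) := by simp [grad]
  rw [h, InnerProductSpace.toDual_apply_apply, real_inner_self_eq_norm_sq,
    LinearIsometryEquiv.norm_map]

lemma contDiff_grad {u : Plane → ℝ} (hu : ContDiff ℝ 2 u) : ContDiff ℝ 1 (grad u) := by
  have h : ContDiff ℝ 1 (fderiv ℝ u) := hu.fderiv_right (by norm_num)
  exact (InnerProductSpace.toDual ℝ Plane).symm.contDiff.comp h

lemma lintegral_enorm_fderiv_le {u : Plane → ℝ} (hu : ContDiff ℝ 2 u) {P : ℝ≥0∞}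
    (h : ∀ φ : Plane → Plane, ContDiff ℝ 1 φ → HasCompactSupport φ → (∀ x, ‖φ x‖ ≤ 1) →
      ENNReal.ofReal (∫ x, u x * vecDiv φ x) ≤ P) :
    ∫⁻ x, ‖fderiv ℝ u x‖ₑ ≤ P := by
  have hu1 : ContDiff ℝ 1 u := hu.of_le (by norm_num)
  let χ : ℕ → ContDiffBump (0 : Plane) := fun k =>
    ⟨(k : ℝ) + 1, (k : ℝ) + 2, by positivity, by linarith⟩
  set δ : ℕ → ℝ := fun k => 1 / ((k : ℝ) + 1) with hδ
  have hδ0 : ∀ k, 0 < δ k := fun k => by positivity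
  have hδl : Tendsto δ atTop (𝓝 0) := tendsto_one_div_add_atTop_nhds_zero_nat
  set N : ℕ → Plane → ℝ := fun k x => Real.sqrt (‖grad u x‖ ^ 2 + δ k ^ 2) with hN
  have hN0 : ∀ k x, 0 < N k x := fun k x => by
    have := hδ0 k; simp only [hN]; positivity
  have hNle : ∀ k x, ‖grad u x‖ ≤ N k x := fun k x => by
    apply Real.le_sqrt_of_sq_le
    have := hδ0 k; nlinarith
  have hNc : ∀ k, ContDiff ℝ 1 (N k) := fun k => by
    have hc : ContDiff ℝ 1 fun x => ‖grad u x‖ ^ 2 + δ k ^ 2 :=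
      ((contDiff_grad hu).norm_sq ℝ).add contDiff_const
    refine hc.sqrt fun x => ?_
    · have := hδ0 k; positivity
  set φ : ℕ → Plane → Plane := fun k x => (-(χ k x * (N k x)⁻¹)) • grad u x with hφ
  have hφc : ∀ k, ContDiff ℝ 1 (φ k) := fun k => by
    have h1 : ContDiff ℝ 1 (χ k) := (χ k).contDiff
    have h2 : ContDiff ℝ 1 fun x => (N k x)⁻¹ := (hNc k).inv fun x => (hN0 k x).ne'
    exact (h1.mul h2).neg.smul (contDiff_grad hu)
  have hφs : ∀ k, HasCompactSupport (φ k) := fun k => by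
    refine (χ k).hasCompactSupport.mono fun x hx h => hx ?_
    simp [hφ, h]
  have hφ1 : ∀ k x, ‖φ k x‖ ≤ 1 := fun k x => by
    have h1 : χ k x ≤ 1 := (χ k).le_one
    have h0 : 0 ≤ χ k x := (χ k).nonneg
    simp only [hφ]
    rw [norm_smul, norm_neg, Real.norm_eq_abs, abs_of_nonneg
      (mul_nonneg h0 (inv_nonneg.2 (hN0 k x).le)), mul_assoc, inv_mul_eq_div]
    have : ‖grad u x‖ / N k x ≤ 1 := (div_le_one (hN0 k x)).2 (hNle k x)
    exact mul_le_one₀ h1 (by have := hN0 k x; positivity) this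
  have hval : ∀ k x, -(fderiv ℝ u x (φ k x)) = χ k x * (‖fderiv ℝ u x‖ ^ 2 / N k x) := by
    intro k x
    simp only [hφ]
    rw [map_smul, fderiv_apply_grad, smul_eq_mul]; ring
  have hle : ∀ k, ∫⁻ x, ENNReal.ofReal (χ k x * (‖fderiv ℝ u x‖ ^ 2 / N k x)) ≤ P := by
    intro k
    refine le_trans (le_of_eq ?_) (h (φ k) (hφc k) (hφs k) (hφ1 k))
    rw [integral_mul_vecDiv_of_contDiff hu1 (hφc k) (hφs k), ← integral_neg]
    simp only [hval]
    rw [ofReal_integral_eq_lintegral_ofReal]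
    · apply Continuous.integrable_of_hasCompactSupport
      · have h1 := hu1.continuous_fderiv one_ne_zero
        have h2 := (hNc k).continuous
        exact (χ k).continuous.mul (Continuous.div (by fun_prop) h2 fun x => (hN0 k x).ne')
      · exact (χ k).hasCompactSupport.mul_right
    · refine Eventually.of_forall fun x => ?_
      have := (hN0 k x).le
      have := (χ k).nonneg (x := x)
      change 0 ≤ _
      positivity
  have hmeas : ∀ k, Measurable fun x =>
      ENNReal.ofReal (χ k x * (‖fderiv ℝ u x‖ ^ 2 / N k x)) := by
    intro k
    have h1 := hu1.continuous_fderiv one_ne_zero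
    have h2 := (hNc k).continuous
    exact ((χ k).continuous.mul
      (Continuous.div (by fun_prop) h2 fun x => (hN0 k x).ne')).measurable.ennreal_ofReal
  have hlim : ∀ x, Tendsto (fun k => ENNReal.ofReal (χ k x * (‖fderiv ℝ u x‖ ^ 2 / N k x))) atTop
      (𝓝 ‖fderiv ℝ u x‖ₑ) := by
    intro x
    rw [← ofReal_norm]
    apply ENNReal.tendsto_ofReal
    have h1 : Tendsto (fun k => χ k x) atTop (𝓝 1) := by
      refine tendsto_const_nhds.congr' ?_
      filter_upwards [eventually_ge_atTop ⌈‖x‖⌉₊] with k hk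
      refine ((χ k).one_of_mem_closedBall ?_).symm
      rw [mem_closedBall_zero_iff]
      change _ ≤ (k : ℝ) + 1
      have := Nat.ceil_le.1 hk; linarith
    have h2 : Tendsto (fun k => ‖fderiv ℝ u x‖ ^ 2 / N k x) atTop (𝓝 ‖fderiv ℝ u x‖) := by
      rcases eq_or_ne ‖fderiv ℝ u x‖ 0 with h0 | h0
      · simp [h0]
      · have : Tendsto (fun k => N k x) atTop (𝓝 ‖fderiv ℝ u x‖) := by
          have h3 : Tendsto (fun k => Real.sqrt (‖grad u x‖ ^ 2 + δ k ^ 2)) atTop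
              (𝓝 (Real.sqrt (‖grad u x‖ ^ 2 + 0 ^ 2))) :=
            (Real.continuous_sqrt.tendsto _).comp ((hδl.pow 2).const_add _)
          rw [zero_pow two_ne_zero, add_zero, Real.sqrt_sq (norm_nonneg _)] at h3
          rw [← norm_grad]
          exact h3
        have h4 := (tendsto_const_nhds (x := ‖fderiv ℝ u x‖ ^ 2)).div this h0
        have h5 : ‖fderiv ℝ u x‖ ^ 2 / ‖fderiv ℝ u x‖ = ‖fderiv ℝ u x‖ := by
          rw [pow_two, mul_div_cancel_right₀ _ h0]
        rwa [h5] at h4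
    simpa using h1.mul h2
  calc ∫⁻ x, ‖fderiv ℝ u x‖ₑ
      = ∫⁻ x, liminf (fun k => ENNReal.ofReal (χ k x * (‖fderiv ℝ u x‖ ^ 2 / N k x))) atTop := by
        simp only [fun x => (hlim x).liminf_eq]
    _ ≤ liminf (fun k => ∫⁻ x, ENNReal.ofReal (χ k x * (‖fderiv ℝ u x‖ ^ 2 / N k x))) atTop :=
        lintegral_liminf_le hmeas
    _ ≤ P := by
        refine (liminf_le_liminf (Eventually.of_forall hle)).trans ?_
        simp

/-- The standard mollifier of radius `ε`. -/
noncomputable def mollifier (ε : ℝ) (hε : 0 < ε) : ContDiffBump (0 : Plane) :=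
  ⟨ε / 2, ε, by positivity, by linarith⟩

/-- The mollified indicator function of a set. -/
noncomputable def mollify (E : Set Plane) (ε : ℝ) (hε : 0 < ε) : Plane → ℝ :=
  convolution ((mollifier ε hε).normed volume) (E.indicator 1) (ContinuousLinearMap.lsmul ℝ ℝ)
    volume

lemma mollify_apply (E : Set Plane) {ε : ℝ} (hε : 0 < ε) (x : Plane) :
    mollify E ε hε x =
      ∫ y, (mollifier ε hε).normed volume y * E.indicator (1 : Plane → ℝ) (x - y) :=
  rfl

lemma locallyIntegrable_indicator {E : Set Plane} (hE : MeasurableSet E) :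
    LocallyIntegrable (E.indicator (1 : Plane → ℝ)) :=
  (locallyIntegrable_const (1 : ℝ)).indicator hE

lemma contDiff_mollify {E : Set Plane} (hE : MeasurableSet E) {ε : ℝ} (hε : 0 < ε) :
    ContDiff ℝ 2 (mollify E ε hε) :=
  (mollifier ε hε).hasCompactSupport_normed.contDiff_convolution_left _
    ((mollifier ε hε).contDiff_normed (n := 2)) (locallyIntegrable_indicator hE)

lemma norm_indicator_one_le (E : Set Plane) (x : Plane) :
    ‖E.indicator (1 : Plane → ℝ) x‖ ≤ 1 := by
  by_cases hx : x ∈ E <;> simp [hx]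

lemma integrable_normed_mul_indicator {E : Set Plane} (hE : MeasurableSet E) {ε : ℝ} (hε : 0 < ε)
    (x : Plane) :
    Integrable fun y => (mollifier ε hε).normed volume y *
      E.indicator (1 : Plane → ℝ) (x - y) := by
  refine (mollifier ε hε).integrable_normed.mul_bdd (c := 1) ?_ (Eventually.of_forall fun y => ?_)
  · exact ((measurable_one.indicator hE).comp
      (measurable_const.sub measurable_id)).aestronglyMeasurable
  · exact norm_indicator_one_le E _

lemma mollify_eq_one {E : Set Plane} {ε : ℝ} (hε : 0 < ε) {x : Plane} (h : ball x ε ⊆ E) :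
    mollify E ε hε x = 1 := by
  have hx : x ∈ E := h (mem_ball_self hε)
  have := (mollifier ε hε).normed_convolution_eq_right (μ := volume) (x₀ := x)
    (g := E.indicator (1 : Plane → ℝ)) fun y hy => by
      rw [indicator_of_mem (h hy), indicator_of_mem hx]; rfl
  rw [indicator_of_mem hx] at this
  exact this

lemma mollify_eq_zero {E : Set Plane} {ε : ℝ} (hε : 0 < ε) {x : Plane}
    (h : ∀ y ∈ E, ε ≤ dist y x) : mollify E ε hε x = 0 := by
  have hx : ∀ y ∈ ball x ε, y ∉ E := fun y hy hyE => not_lt.2 (h y hyE) hy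
  have := (mollifier ε hε).normed_convolution_eq_right (μ := volume) (x₀ := x)
    (g := E.indicator (1 : Plane → ℝ)) fun y hy => by
      rw [indicator_of_notMem (hx y hy), indicator_of_notMem (hx x (mem_ball_self hε))]
  rw [indicator_of_notMem (hx x (mem_ball_self hε))] at this
  exact this

lemma exists_mem_of_mollify_pos {E : Set Plane} {ε : ℝ} (hε : 0 < ε) {x : Plane}
    (h : 0 < mollify E ε hε x) : ∃ y ∈ E, dist y x < ε := by
  by_contra! hc
  exact h.ne' (mollify_eq_zero hε hc)

lemma ae_tendsto_mollify {E : Set Plane} (hE : MeasurableSet E) {ε : ℕ → ℝ} (hε : ∀ n, 0 < ε n)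
    (hlim : Tendsto ε atTop (𝓝 0)) :
    ∀ᵐ x, Tendsto (fun n => mollify E (ε n) (hε n) x) atTop
      (𝓝 (E.indicator (1 : Plane → ℝ) x)) :=
  ContDiffBump.ae_convolution_tendsto_right_of_locallyIntegrable
    (φ := fun n => mollifier (ε n) (hε n)) (K := 2) hlim
    (Eventually.of_forall fun n => by simp only [mollifier]; linarith)
    (locallyIntegrable_indicator hE)

lemma ofReal_integral_mollify_le {E : Set Plane} (hE : MeasurableSet E) {ε : ℝ} (hε : 0 < ε)
    {φ : Plane → Plane} (hφ : ContDiff ℝ 1 φ) (hc : HasCompactSupport φ) (h1 : ∀ x, ‖φ x‖ ≤ 1) :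
    ENNReal.ofReal (∫ x, mollify E ε hε x * vecDiv φ x) ≤ per E := by
  rcases eq_or_ne (per E) ∞ with htop | htop
  · rw [htop]; exact le_top
  set η := (mollifier ε hε).normed volume with hη
  have hηi : Integrable η := (mollifier ε hε).integrable_normed
  have hdi := integrable_vecDiv hφ hc
  have hE1 : Measurable (E.indicator (1 : Plane → ℝ)) := measurable_one.indicator hE
  have htrans : ∀ y, ∫ x, E.indicator (1 : Plane → ℝ) (x - y) * vecDiv φ x ≤ (per E).toReal := by
    intro y
    have e1 : ∫ x, E.indicator (1 : Plane → ℝ) (x - y) * vecDiv φ x =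
        ∫ x in E, vecDiv (fun z => φ (z + y)) x := by
      rw [← integral_indicator hE, ← integral_add_right_eq_self _ y]
      congr 1; funext x
      rw [add_sub_cancel_right]
      have : vecDiv (fun z => φ (z + y)) x = vecDiv φ (x + y) := by
        simp only [vecDiv, fderiv_comp_add_right]
      by_cases hx : x ∈ E
      · rw [indicator_of_mem hx, indicator_of_mem hx, this, Pi.one_apply, one_mul]
      · rw [indicator_of_notMem hx, indicator_of_notMem hx, zero_mul]
    rw [e1]
    have h2 : ENNReal.ofReal (∫ x in E, vecDiv (fun z => φ (z + y)) x) ≤ per E :=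
      le_iSup (fun ψ : {φ : Plane → Plane // ContDiff ℝ 1 φ ∧ HasCompactSupport φ ∧
          tsupport φ ⊆ univ ∧ ∀ x, ‖φ x‖ ≤ 1} => ENNReal.ofReal (∫ x in E, vecDiv ψ.1 x))
        ⟨fun z => φ (z + y), hφ.comp (by fun_prop), hc.comp_homeomorph (Homeomorph.addRight y),
          subset_univ _, fun x => h1 _⟩
    exact (ENNReal.ofReal_le_iff_le_toReal htop).1 h2
  have h_int : Integrable (fun q : Plane × Plane =>
      (η q.2 * E.indicator (1 : Plane → ℝ) (q.1 - q.2)) * vecDiv φ q.1)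
      (volume.prod volume) := by
    have h0 : Integrable (fun q : Plane × Plane => vecDiv φ q.1 * η q.2) (volume.prod volume) :=
      hdi.mul_prod hηi
    have h2 := h0.mul_bdd (c := 1) (g := fun q : Plane × Plane =>
      E.indicator (1 : Plane → ℝ) (q.1 - q.2))
      (hE1.comp (measurable_fst.sub measurable_snd)).aestronglyMeasurable
      (Eventually.of_forall fun q => norm_indicator_one_le E _)
    refine h2.congr (Eventually.of_forall fun q => ?_)
    simp only; ring
  have e : ∫ x, mollify E ε hε x * vecDiv φ x =
      ∫ y, η y * ∫ x, E.indicator (1 : Plane → ℝ) (x - y) * vecDiv φ x := by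
    simp only [mollify_apply, ← integral_mul_const, ← integral_const_mul]
    rw [integral_integral_swap h_int]
    simp only [mul_assoc]
    rfl
  rw [e]
  apply ENNReal.ofReal_le_of_le_toReal
  calc ∫ y, η y * ∫ x, E.indicator (1 : Plane → ℝ) (x - y) * vecDiv φ x
      ≤ ∫ y, η y * (per E).toReal := by
        refine integral_mono ?_ (hηi.mul_const _) fun y => ?_
        · have := h_int.integral_prod_right
          refine this.congr (Eventually.of_forall fun y => ?_)
          simp only [← integral_const_mul, mul_assoc]
        · exact mul_le_mul_of_nonneg_left (htrans y) ((mollifier ε hε).nonneg_normed _)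
    _ = (per E).toReal := by
        rw [integral_mul_const, (mollifier ε hε).integral_normed, one_mul]

lemma lintegral_enorm_fderiv_mollify_le {E : Set Plane} (hE : MeasurableSet E) {ε : ℝ}
    (hε : 0 < ε) : ∫⁻ x, ‖fderiv ℝ (mollify E ε hε) x‖ₑ ≤ per E :=
  lintegral_enorm_fderiv_le (contDiff_mollify hE hε) fun _ hφ hc h1 =>
    ofReal_integral_mollify_le hE hε hφ hc h1

/-- The superlevel sets of the mollified indicator of a set of finite area are bounded. -/
lemma isBounded_superlevel_mollify {E : Set Plane} (hE : MeasurableSet E) (hfin : volume E ≠ ∞)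
    {ε : ℝ} (hε : 0 < ε) {t : ℝ} (ht : 0 < t) :
    Bornology.IsBounded {x | t ≤ mollify E ε hε x} := by
  obtain ⟨C, hC0, hC⟩ : ∃ C : ℝ, 0 < C ∧ ∀ y, (mollifier ε hε).normed volume y ≤ C :=
    ⟨_, by
      have := ENNReal.toReal_pos (measure_closedBall_pos volume (0 : Plane)
        (mollifier ε hε).rIn_pos).ne' measure_closedBall_lt_top.ne
      exact one_div_pos.2 this, (mollifier ε hε).normed_le_div_measure_closedBall_rIn volume⟩
  have hlim : Tendsto (fun n : ℕ => volume (E \ ball 0 (n : ℝ))) atTop (𝓝 0) := by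
    have h := tendsto_measure_iInter_atTop (μ := volume)
      (s := fun n : ℕ => E \ ball 0 (n : ℝ))
      (fun n => (hE.diff measurableSet_ball).nullMeasurableSet)
      (fun m n hmn => sdiff_subset_sdiff_right (ball_subset_ball (by exact_mod_cast hmn)))
      ⟨0, measure_ne_top_of_subset sdiff_subset hfin⟩
    have he : ⋂ n : ℕ, E \ ball (0 : Plane) (n : ℝ) = ∅ := by
      rw [eq_empty_iff_forall_notMem]
      intro x hx
      obtain ⟨n, hn⟩ := exists_nat_gt ‖x‖
      exact (mem_iInter.1 hx n).2 (by simpa using hn)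
    rwa [he, measure_empty] at h
  obtain ⟨n, hn⟩ := (hlim.eventually (gt_mem_nhds (show (0 : ℝ≥0∞) < ENNReal.ofReal (t / C) by
    simpa using div_pos ht hC0))).exists
  refine (isBounded_closedBall (x := (0 : Plane)) (r := n + ε)).subset fun x hx => ?_
  by_contra hxn
  rw [mem_closedBall_zero_iff, not_le] at hxn
  rw [mem_ofPred_eq, mollify_apply] at hx
  set S := E \ ball (0 : Plane) (n : ℝ) with hS
  have hSm : MeasurableSet S := hE.diff measurableSet_ball
  have hSfin : volume S ≠ ∞ := measure_ne_top_of_subset sdiff_subset hfin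
  have hSi : Integrable (S.indicator (1 : Plane → ℝ)) :=
    (integrable_indicator_iff hSm).2 (integrableOn_const hSfin)
  have hle : ∫ y, (mollifier ε hε).normed volume y * E.indicator (1 : Plane → ℝ) (x - y) ≤
      ∫ y, C * S.indicator (1 : Plane → ℝ) (x - y) := by
    refine integral_mono (integrable_normed_mul_indicator hE hε x)
      ((hSi.comp_sub_left x).const_mul C) fun y => ?_
    by_cases hy : y ∈ ball (0 : Plane) ε
    · by_cases hyE : x - y ∈ E
      · have : x - y ∈ S := by
          refine ⟨hyE, fun hb => ?_⟩
          rw [mem_ball_zero_iff] at hb hy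
          have := norm_sub_norm_le x y
          linarith
        simp only [indicator_of_mem hyE, indicator_of_mem this, Pi.one_apply, mul_one]
        exact hC y
      · simp only [indicator_of_notMem hyE, mul_zero]
        exact mul_nonneg hC0.le (indicator_nonneg (fun _ _ => zero_le_one) _)
    · have : (mollifier ε hε).normed volume y = 0 := by
        rw [← Function.notMem_support, (mollifier ε hε).support_normed_eq]; exact hy
      simp only [this, zero_mul]
      exact mul_nonneg hC0.le (indicator_nonneg (fun _ _ => zero_le_one) _)
  rw [integral_const_mul, integral_sub_left_eq_self, integral_indicator_one hSm] at hle
  have h3 : t / C ≤ volume.real S := by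
    rw [div_le_iff₀ hC0, mul_comm]; exact hx.trans hle
  exact not_le.2 hn ((ENNReal.ofReal_le_ofReal h3).trans_eq (ofReal_measureReal hSfin))

/-! ### Total variation along lines meeting a component of a superlevel set -/

lemma ofReal_le_lintegral_deriv {φ : ℝ → ℝ} (hφ : ContDiff ℝ 1 φ) {α β : ℝ} (hαβ : α ≤ β) {h : ℝ}
    (hh : h ≤ |φ β - φ α|) : ENNReal.ofReal h ≤ ∫⁻ τ in Ioo α β, ‖deriv φ τ‖ₑ := by
  have h1 : ∫ τ in α..β, deriv φ τ = φ β - φ α :=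
    intervalIntegral.integral_deriv_eq_sub' φ rfl
      (fun x _ => (hφ.differentiable one_ne_zero).differentiableAt)
      (hφ.continuous_deriv le_rfl).continuousOn
  rw [intervalIntegral.integral_of_le hαβ] at h1
  calc ENNReal.ofReal h ≤ ENNReal.ofReal |φ β - φ α| := ENNReal.ofReal_le_ofReal hh
    _ = ‖∫ τ in Ioc α β, deriv φ τ‖ₑ := by rw [h1, Real.enorm_eq_ofReal_abs]
    _ ≤ ∫⁻ τ in Ioc α β, ‖deriv φ τ‖ₑ := enorm_integral_le_lintegral_enorm _
    _ = ∫⁻ τ in Ioo α β, ‖deriv φ τ‖ₑ := by rw [restrict_Ioo_eq_restrict_Ioc]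

lemma exists_crossing_left {φ : ℝ → ℝ} (hφ : ContDiff ℝ 1 φ) {t h l τ₀ : ℝ} (hl : l ≤ τ₀)
    (hlt : φ l ≤ t) (hτ : t + h ≤ φ τ₀) :
    ∃ α β, α ≤ β ∧ β ≤ τ₀ ∧ (∀ τ ∈ Ioo α β, φ τ < t + h) ∧ (∀ τ ∈ Ioc α τ₀, t < φ τ) ∧
      ENNReal.ofReal h ≤ ∫⁻ τ in Ioo α β, ‖deriv φ τ‖ₑ := by
  have hc := hφ.continuous
  obtain ⟨α, ⟨hα, hαt⟩, hαm⟩ := (isCompact_Icc.inter_right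
    (isClosed_le hc continuous_const)).exists_isGreatest ⟨l, left_mem_Icc.2 hl, hlt⟩
  obtain ⟨β, ⟨hβ, hβt⟩, hβm⟩ := (isCompact_Icc.inter_right
    (isClosed_le continuous_const hc)).exists_isLeast ⟨τ₀, right_mem_Icc.2 hα.2, hτ⟩
  change φ α ≤ t at hαt
  change t + h ≤ φ β at hβt
  refine ⟨α, β, hβ.1, hβ.2, fun τ hτ => ?_, fun τ hτ => ?_,
    ofReal_le_lintegral_deriv hφ hβ.1 (le_abs.2 (Or.inl (by linarith)))⟩
  · by_contra! hn
    exact not_le.2 hτ.2 (hβm ⟨⟨hτ.1.le, hτ.2.le.trans hβ.2⟩, hn⟩)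
  · by_contra! hn
    exact not_le.2 hτ.1 (hαm ⟨⟨hα.1.trans hτ.1.le, hτ.2⟩, hn⟩)

lemma exists_crossing_right {φ : ℝ → ℝ} (hφ : ContDiff ℝ 1 φ) {t h r τ₀ : ℝ} (hr : τ₀ ≤ r)
    (hrt : φ r ≤ t) (hτ : t + h ≤ φ τ₀) :
    ∃ α β, α ≤ β ∧ τ₀ ≤ α ∧ (∀ τ ∈ Ioo α β, φ τ < t + h) ∧ (∀ τ ∈ Ico τ₀ β, t < φ τ) ∧
      ENNReal.ofReal h ≤ ∫⁻ τ in Ioo α β, ‖deriv φ τ‖ₑ := by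
  have hc := hφ.continuous
  obtain ⟨β, ⟨hβ, hβt⟩, hβm⟩ := (isCompact_Icc.inter_right
    (isClosed_le hc continuous_const)).exists_isLeast ⟨r, right_mem_Icc.2 hr, hrt⟩
  obtain ⟨α, ⟨hα, hαt⟩, hαm⟩ := (isCompact_Icc.inter_right
    (isClosed_le continuous_const hc)).exists_isGreatest ⟨τ₀, left_mem_Icc.2 hβ.1, hτ⟩
  change φ β ≤ t at hβt
  change t + h ≤ φ α at hαt
  refine ⟨α, β, hα.2, hα.1, fun τ hτ => ?_, fun τ hτ => ?_,
    ofReal_le_lintegral_deriv hφ hα.2 (le_abs.2 (Or.inr (by linarith)))⟩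
  · by_contra! hn
    exact not_le.2 hτ.1 (hαm ⟨⟨hα.1.trans hτ.1.le, hτ.2.le⟩, hn⟩)
  · by_contra! hn
    exact not_le.2 hτ.2 (hβm ⟨⟨hτ.1, hτ.2.le.trans hβ.2⟩, hn⟩)

lemma exists_lt_notMem_of_isBounded {S : Set Plane} (hS : Bornology.IsBounded S) (θ s τ₀ : ℝ) :
    (∃ l ≤ τ₀, frame θ (s, l) ∉ S) ∧ ∃ r ≥ τ₀, frame θ (s, r) ∉ S := by
  have hb : Bornology.IsBounded {τ | frame θ (s, τ) ∈ S} :=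
    (isometry_frame θ s).antilipschitz.isBounded_preimage hS
  obtain ⟨R, hR⟩ := hb.subset_closedBall 0
  constructor
  · refine ⟨min τ₀ (-|R| - 1), min_le_left _ _, fun h => ?_⟩
    have := hR h
    rw [mem_closedBall_zero_iff, Real.norm_eq_abs, abs_le] at this
    have h2 := min_le_right τ₀ (-|R| - 1)
    have := le_abs_self R
    linarith
  · refine ⟨max τ₀ (|R| + 1), le_max_left _ _, fun h => ?_⟩
    have := hR h
    rw [mem_closedBall_zero_iff, Real.norm_eq_abs, abs_le] at this
    have h2 := le_max_right τ₀ (|R| + 1)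
    have := le_abs_self R
    linarith

lemma two_mul_le_lintegral_line {u : Plane → ℝ} (hu : ContDiff ℝ 1 u) {t h : ℝ}
    (hb : Bornology.IsBounded {x | t < u x}) {U : Set Plane}
    (hU : ∀ S : Set Plane, IsPreconnected S → S ⊆ {x | t < u x} → (S ∩ U).Nonempty → S ⊆ U)
    {θ s τ₀ : ℝ} (hmem : frame θ (s, τ₀) ∈ U) (hval : t + h ≤ u (frame θ (s, τ₀))) :
    2 * ENNReal.ofReal h ≤ ∫⁻ τ : ℝ,
      ‖(U ∩ {x | u x < t + h}).indicator (fderiv ℝ u) (frame θ (s, τ)) (nor θ)‖ₑ := by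
  set φ : ℝ → ℝ := fun τ => u (frame θ (s, τ)) with hφ
  have hfr : ContDiff ℝ 1 fun τ => frame θ (s, τ) := by unfold frame; fun_prop
  have hφc : ContDiff ℝ 1 φ := hu.comp hfr
  obtain ⟨⟨l, hl, hlS⟩, r, hr, hrS⟩ := exists_lt_notMem_of_isBounded hb θ s τ₀
  obtain ⟨α, β, hαβ, hβ, h1, h2, h3⟩ :=
    exists_crossing_left hφc hl (not_lt.1 hlS) hval
  obtain ⟨α', β', hαβ', hα', h1', h2', h3'⟩ :=
    exists_crossing_right hφc hr (not_lt.1 hrS) hval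
  have key : ∀ J : Set ℝ, J.OrdConnected → τ₀ ∈ J → (∀ τ ∈ J, t < φ τ) →
      ∀ τ ∈ J, frame θ (s, τ) ∈ U := by
    intro J hJ h0 hJt τ hτ
    refine hU ((fun τ => frame θ (s, τ)) '' J)
      (hJ.isPreconnected.image _ hfr.continuous.continuousOn) ?_
      ⟨_, mem_image_of_mem _ h0, hmem⟩ (mem_image_of_mem _ hτ)
    rintro _ ⟨σ, hσ, rfl⟩
    exact hJt σ hσ
  have hval' : ∀ τ, frame θ (s, τ) ∈ U → φ τ < t + h →
      ‖(U ∩ {x | u x < t + h}).indicator (fderiv ℝ u) (frame θ (s, τ)) (nor θ)‖ₑ =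
        ‖deriv φ τ‖ₑ := by
    intro τ hτ hτ'
    have hm : frame θ (s, τ) ∈ U ∩ {x | u x < t + h} := ⟨hτ, hτ'⟩
    rw [indicator_of_mem hm,
      fderiv_apply_nor (hu.differentiable one_ne_zero).differentiableAt]
  calc 2 * ENNReal.ofReal h
      ≤ (∫⁻ τ in Ioo α β, ‖deriv φ τ‖ₑ) + ∫⁻ τ in Ioo α' β', ‖deriv φ τ‖ₑ := by
        rw [two_mul]; exact add_le_add h3 h3'
    _ = (∫⁻ τ in Ioo α β,
          ‖(U ∩ {x | u x < t + h}).indicator (fderiv ℝ u) (frame θ (s, τ)) (nor θ)‖ₑ) +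
        ∫⁻ τ in Ioo α' β',
          ‖(U ∩ {x | u x < t + h}).indicator (fderiv ℝ u) (frame θ (s, τ)) (nor θ)‖ₑ := by
        congr 1
        · refine setLIntegral_congr_fun measurableSet_Ioo fun τ hτ => ?_
          have hατ : α < τ₀ := hτ.1.trans (hτ.2.trans_le hβ)
          exact (hval' τ (key _ ordConnected_Ioc ⟨hατ, le_rfl⟩ h2 τ
            ⟨hτ.1, hτ.2.le.trans hβ⟩) (h1 τ hτ)).symm
        · refine setLIntegral_congr_fun measurableSet_Ioo fun τ hτ => ?_
          have hατ : τ₀ < β' := hα'.trans_lt (hτ.1.trans hτ.2)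
          exact (hval' τ (key _ ordConnected_Ico ⟨le_rfl, hατ⟩ h2' τ
            ⟨hα'.trans hτ.1.le, hτ.2⟩) (h1' τ hτ)).symm
    _ = ∫⁻ τ in Ioo α β ∪ Ioo α' β',
          ‖(U ∩ {x | u x < t + h}).indicator (fderiv ℝ u) (frame θ (s, τ)) (nor θ)‖ₑ := by
        rw [lintegral_union measurableSet_Ioo]
        rw [Set.disjoint_left]
        intro τ hτ hτ'
        exact lt_irrefl _ ((hτ.2.trans_le (hβ.trans hα')).trans hτ'.1)
    _ ≤ _ := setLIntegral_le_lintegral _ _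

lemma mul_cauchyPer_le {u : Plane → ℝ} (hu : ContDiff ℝ 1 u) {t h : ℝ}
    (hb : Bornology.IsBounded {x | t < u x}) {U : Set Plane} (hUo : IsOpen U)
    (hU : ∀ S : Set Plane, IsPreconnected S → S ⊆ {x | t < u x} → (S ∩ U).Nonempty → S ⊆ U)
    {H : Set Plane} (hH : IsOpen H) (hHU : H ⊆ U) (hHu : ∀ x ∈ H, t + h ≤ u x) :
    ENNReal.ofReal h * cauchyPer H ≤ ∫⁻ x in U ∩ {x | u x < t + h}, ‖fderiv ℝ u x‖ₑ := by
  have hm : MeasurableSet (U ∩ {x | u x < t + h}) :=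
    hUo.measurableSet.inter (isOpen_lt hu.continuous continuous_const).measurableSet
  have h2 : 2 * (ENNReal.ofReal h * cauchyPer H) ≤
      2 * ∫⁻ x in U ∩ {x | u x < t + h}, ‖fderiv ℝ u x‖ₑ := by
    rw [← lintegral_indicator hm]
    have e : ∀ x, (U ∩ {x | u x < t + h}).indicator (fun x => ‖fderiv ℝ u x‖ₑ) x =
        ‖(U ∩ {x | u x < t + h}).indicator (fderiv ℝ u) x‖ₑ := fun x => by
      by_cases hx : x ∈ U ∩ {x | u x < t + h}
      · rw [indicator_of_mem hx, indicator_of_mem hx]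
      · rw [indicator_of_notMem hx, indicator_of_notMem hx, ← ofReal_norm, norm_zero,
          ENNReal.ofReal_zero]
    simp only [e]
    rw [two_mul_lintegral_enorm ((measurable_fderiv ℝ u).indicator hm), cauchyPer,
      ← lintegral_const_mul _ (measurable_volume_proj hH),
      ← lintegral_const_mul _ ((measurable_volume_proj hH).const_mul _)]
    refine lintegral_mono fun θ => ?_
    have hms : MeasurableSet (coord θ '' H) := by
      have := measurableSet_proj hH
      exact measurable_prodMk_left (x := θ) this
    calc 2 * (ENNReal.ofReal h * volume (coord θ '' H))
        = ∫⁻ s in coord θ '' H, 2 * ENNReal.ofReal h := by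
          rw [setLIntegral_const, mul_assoc]
      _ ≤ ∫⁻ s in coord θ '' H, ∫⁻ τ : ℝ,
          ‖(U ∩ {x | u x < t + h}).indicator (fderiv ℝ u) (frame θ (s, τ)) (nor θ)‖ₑ := by
          refine setLIntegral_mono' hms fun s hs => ?_
          obtain ⟨τ, hτ⟩ := mem_coord_image.1 hs
          exact two_mul_le_lintegral_line hu hb hU (hHU hτ) (hHu _ hτ)
      _ ≤ _ := setLIntegral_le_lintegral _ _
  rwa [ENNReal.mul_le_mul_iff_right (by norm_num) (by norm_num)] at h2

lemma cauchyPer_add_le_per_cthickening {D : Set Plane} (hD : IsCompact D) (hDc : Convex ℝ D)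
    (hne : D.Nonempty) {ρ : ℝ} (hρ : 0 < ρ) :
    cauchyPer D + ENNReal.ofReal (2 * Real.pi * ρ) ≤ per (cthickening ρ D) := by
  set E := cthickening ρ D with hE
  have hEm : MeasurableSet E := isClosed_cthickening.measurableSet
  have hEc : IsCompact E := hD.cthickening
  have step : ∀ ε ∈ Ioo 0 ρ, cauchyPer D + ENNReal.ofReal (2 * Real.pi * (ρ - ε)) ≤ per E := by
    intro ε hε
    have hu := contDiff_mollify hEm hε.1
    have hb : ∀ t : ℝ, 0 < t → Bornology.IsBounded {x | t < mollify E ε hε.1 x} := fun t ht =>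
      (isBounded_superlevel_mollify hEm hEc.measure_lt_top.ne hε.1 ht).subset
        fun x (hx : t < _) => hx.le
    have h1 : cauchyPer D + ENNReal.ofReal (2 * Real.pi * (ρ - ε)) ≤
        cauchyPer (thickening (ρ - ε) D) :=
      cauchyPer_add_le hDc.isPreconnected hne hD.isBounded (by linarith [hε.2])
        fun x hx => ball_subset_thickening hx _
    refine h1.trans ?_
    have h2 : ∀ t ∈ Ioo (0 : ℝ) 1, ENNReal.ofReal (1 - t) * cauchyPer (thickening (ρ - ε) D) ≤
        per E := by
      intro t ht
      refine le_trans (mul_cauchyPer_le (hu.of_le (by norm_num)) (t := t) (h := 1 - t)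
        (hb t ht.1) (U := {x | t < mollify E ε hε.1 x})
        (isOpen_lt continuous_const hu.continuous)
        (fun S _ h _ => h) isOpen_thickening ?_ ?_)
        ((setLIntegral_le_lintegral _ _).trans (lintegral_enorm_fderiv_mollify_le hEm hε.1))
      all_goals
        intro x hx
        have : mollify E ε hε.1 x = 1 := by
          apply mollify_eq_one
          intro y hy
          have hy' : y ∈ thickening ε (thickening (ρ - ε) D) :=
            ball_subset_thickening hx _ hy
          have := thickening_thickening_subset _ _ _ hy'
          rw [add_sub_cancel] at this
          exact thickening_subset_cthickening _ _ this
      · change t < _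
        rw [this]; exact ht.2
      · rw [this]; linarith
    have h3 : Tendsto (fun t : ℝ => ENNReal.ofReal (1 - t) * cauchyPer (thickening (ρ - ε) D))
        (𝓝[>] 0) (𝓝 (ENNReal.ofReal (1 - 0) * cauchyPer (thickening (ρ - ε) D))) := by
      refine ENNReal.Tendsto.mul_const ?_ (Or.inl (by simp))
      exact ENNReal.tendsto_ofReal (((continuous_const.sub continuous_id).tendsto 0).mono_left
        nhdsWithin_le_nhds)
    rw [sub_zero, ENNReal.ofReal_one, one_mul] at h3
    refine le_of_tendsto h3 ?_
    filter_upwards [Ioo_mem_nhdsGT (show (0 : ℝ) < 1 by norm_num)] with t ht using h2 t ht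
  have h4 : Tendsto (fun ε : ℝ => cauchyPer D + ENNReal.ofReal (2 * Real.pi * (ρ - ε)))
      (𝓝[>] 0) (𝓝 (cauchyPer D + ENNReal.ofReal (2 * Real.pi * (ρ - 0)))) := by
    refine Tendsto.const_add _ (ENNReal.tendsto_ofReal ?_)
    exact ((by fun_prop : Continuous fun ε : ℝ => 2 * Real.pi * (ρ - ε)).tendsto 0).mono_left
      nhdsWithin_le_nhds
  rw [sub_zero] at h4
  refine le_of_tendsto h4 ?_
  filter_upwards [Ioo_mem_nhdsGT hρ] with t ht using step t ht

lemma per_cthickening {D : Set Plane} (hD : IsCompact D) (hDc : Convex ℝ D)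
    (hne : D.Nonempty) {ρ : ℝ} (hρ : 0 < ρ) :
    per (cthickening ρ D) = cauchyPer D + ENNReal.ofReal (2 * Real.pi * ρ) := by
  refine le_antisymm ?_ (cauchyPer_add_le_per_cthickening hD hDc hne hρ)
  refine (per_le_cauchyPer hD.cthickening (hDc.cthickening ρ)).trans ?_
  refine cauchyPer_le_add hDc.isPreconnected hne hD.isBounded hρ.le fun x hx => ?_
  rw [hD.cthickening_eq_biUnion_closedBall hρ.le] at hx
  simpa using hx

/-! ### Perimeter of the components of a superlevel set -/

lemma tendsto_cauchyPer_iUnion {S : ℕ → Set Plane} (hS : ∀ n, IsOpen (S n)) (hm : Monotone S) :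
    Tendsto (fun n => cauchyPer (S n)) atTop (𝓝 (cauchyPer (⋃ n, S n))) := by
  unfold cauchyPer
  refine lintegral_tendsto_of_tendsto_of_monotone
    (fun n => (measurable_volume_proj (hS n)).aemeasurable)
    (Eventually.of_forall fun θ m n hmn => measure_mono (image_mono (hm hmn)))
    (Eventually.of_forall fun θ => ?_)
  rw [image_iUnion]
  exact tendsto_measure_iUnion_atTop fun m n hmn => image_mono (hm hmn)

lemma sum_setLIntegral_le {g : Plane → ℝ≥0∞} {T : Finset (Set Plane)} {A : Set Plane}
    (hT : (T : Set (Set Plane)).PairwiseDisjoint id) (hm : ∀ U ∈ T, MeasurableSet (U ∩ A))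
    {B : Set Plane} (hB : ∀ U ∈ T, U ∩ A ⊆ B) :
    ∑ U ∈ T, ∫⁻ x in U ∩ A, g x ≤ ∫⁻ x in B, g x := by
  rw [← lintegral_biUnion_finset (fun U hU V hV hUV => ?_) hm]
  · exact lintegral_mono_set (iUnion₂_subset hB)
  · exact (hT hU hV hUV).mono inter_subset_left inter_subset_left

lemma exists_level_sum_cauchyPer_le {u : Plane → ℝ} (hu : ContDiff ℝ 1 u)
    (hb : ∀ t : ℝ, 0 < t → Bornology.IsBounded {x | t ≤ u x}) {a b : ℝ} (ha : 0 < a) (hab : a < b)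
    (hΛ : ∫⁻ x, ‖fderiv ℝ u x‖ₑ ≠ ∞) :
    ∃ t ∈ Ioo a b, ∀ T : Finset (Set Plane),
      (∀ U ∈ T, ∃ x ∈ {y | t < u y}, U = connectedComponentIn {y | t < u y} x) →
      ∑ U ∈ T, cauchyPer U ≤ (∫⁻ x, ‖fderiv ℝ u x‖ₑ) / ENNReal.ofReal (b - a) := by
  set Λ := ∫⁻ x, ‖fderiv ℝ u x‖ₑ with hΛdef
  set Φ : ℝ → ℝ := fun t => (∫⁻ x in {x | u x ≤ t}, ‖fderiv ℝ u x‖ₑ).toReal with hΦ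
  have hfin : ∀ S : Set Plane, ∫⁻ x in S, ‖fderiv ℝ u x‖ₑ ≠ ∞ := fun S =>
    ((setLIntegral_le_lintegral _ _).trans_lt hΛ.lt_top).ne
  have hmono : Monotone Φ := fun s t hst =>
    ENNReal.toReal_mono (hfin _) (lintegral_mono_set fun x (hx : u x ≤ s) => hx.trans hst)
  have hdiff : ∀ s t : ℝ, s ≤ t →
      ∫⁻ x in {x | s < u x ∧ u x ≤ t}, ‖fderiv ℝ u x‖ₑ = ENNReal.ofReal (Φ t - Φ s) := by
    intro s t hst
    have hms : MeasurableSet {x | s < u x ∧ u x ≤ t} :=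
      (isOpen_lt continuous_const hu.continuous).measurableSet.inter
        (isClosed_le hu.continuous continuous_const).measurableSet
    have he : {x | u x ≤ t} = {x | u x ≤ s} ∪ {x | s < u x ∧ u x ≤ t} := by
      ext x
      change u x ≤ t ↔ u x ≤ s ∨ s < u x ∧ u x ≤ t
      constructor
      · intro h
        rcases le_or_gt (u x) s with h' | h'
        · exact Or.inl h'
        · exact Or.inr ⟨h', h⟩
      · rintro (h | h)
        · exact h.trans hst
        · exact h.2
    have h1 : ∫⁻ x in {x | u x ≤ t}, ‖fderiv ℝ u x‖ₑ = (∫⁻ x in {x | u x ≤ s}, ‖fderiv ℝ u x‖ₑ) +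
        ∫⁻ x in {x | s < u x ∧ u x ≤ t}, ‖fderiv ℝ u x‖ₑ := by
      rw [he, lintegral_union hms]
      rw [Set.disjoint_left]
      exact fun x (hx : u x ≤ s) hx' => not_lt.2 hx hx'.1
    simp only [hΦ]
    rw [h1, ENNReal.toReal_add (hfin _) (hfin _), add_sub_cancel_left,
      ENNReal.ofReal_toReal (hfin _)]
  have h_int := (hmono.monotoneOn (uIcc a b)).intervalIntegral_deriv_mem_uIcc
  have hii := (hmono.monotoneOn (uIcc a b)).intervalIntegrable_deriv
  rw [uIcc_of_le (sub_nonneg.2 (hmono hab.le))] at h_int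
  have hΦle : Φ b - Φ a ≤ Λ.toReal := by
    have h1 : Φ b ≤ Λ.toReal := ENNReal.toReal_mono hΛ (setLIntegral_le_lintegral _ _)
    have h2 : 0 ≤ Φ a := ENNReal.toReal_nonneg
    linarith
  obtain ⟨t, htN, ht⟩ := exists_notMem_null_le_average (μ := volume.restrict (Ioo a b))
    (f := deriv Φ) (N := {x | ¬ DifferentiableAt ℝ Φ x} ∪ (Ioo a b)ᶜ)
    (by
      rw [Ne, Measure.restrict_eq_zero, Real.volume_Ioo]
      simpa using hab)
    (by
      rw [intervalIntegrable_iff_integrableOn_Ioo_of_le hab.le] at hii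
      exact hii)
    (by
      refine measure_union_null ?_ ?_
      · exact Measure.restrict_apply_eq_zero' measurableSet_Ioo |>.2
          (measure_inter_null_of_null_left _ (ae_iff.1 hmono.ae_differentiableAt))
      · rw [Measure.restrict_apply measurableSet_Ioo.compl]; simp)
  have htd : DifferentiableAt ℝ Φ t := by
    by_contra h
    exact htN (Or.inl h)
  have htI : t ∈ Ioo a b := by
    by_contra h
    exact htN (Or.inr h)
  have htΛ : ENNReal.ofReal (deriv Φ t) ≤ Λ / ENNReal.ofReal (b - a) := by
    rw [setAverage_eq, ← integral_Ioc_eq_integral_Ioo, ← intervalIntegral.integral_of_le hab.le,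
      Real.volume_real_Ioo_of_le hab.le, smul_eq_mul] at ht
    rw [ENNReal.le_div_iff_mul_le (Or.inl (by simpa using hab)) (Or.inl (by simp)),
      ← ENNReal.ofReal_mul' (by linarith)]
    apply ENNReal.ofReal_le_of_le_toReal
    have hba : 0 < b - a := by linarith
    calc deriv Φ t * (b - a) ≤ ((b - a)⁻¹ * ∫ x in a..b, deriv Φ x) * (b - a) :=
          mul_le_mul_of_nonneg_right ht hba.le
      _ = ∫ x in a..b, deriv Φ x := by field_simp
      _ ≤ _ := h_int.2.trans hΦle
  refine ⟨t, htI, fun T hT => le_trans ?_ htΛ⟩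
  have ht0 : 0 < t := ha.trans htI.1
  set W := {y | t < u y} with hW
  have hWo : IsOpen W := isOpen_lt continuous_const hu.continuous
  have hWb : Bornology.IsBounded W := (hb t ht0).subset fun x (hx : t < u x) => hx.le
  have hUo : ∀ U ∈ T, IsOpen U := fun U hU => by
    obtain ⟨x, -, rfl⟩ := hT U hU
    exact hWo.connectedComponentIn
  have hUW : ∀ U ∈ T, U ⊆ W := fun U hU => by
    obtain ⟨x, -, rfl⟩ := hT U hU
    exact connectedComponentIn_subset _ _
  have hUp : ∀ U ∈ T, ∀ S : Set Plane, IsPreconnected S → S ⊆ W → (S ∩ U).Nonempty → S ⊆ U := by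
    rintro U hU S hS hSW ⟨y, hyS, hyU⟩
    obtain ⟨x, -, rfl⟩ := hT U hU
    rw [connectedComponentIn_eq hyU]
    exact hS.subset_connectedComponentIn hyS hSW
  have hUc : ∀ U ∈ T, IsPreconnected U := fun U hU => by
    obtain ⟨x, -, rfl⟩ := hT U hU
    exact isPreconnected_connectedComponentIn
  have hdisj : (T : Set (Set Plane)).PairwiseDisjoint id := by
    intro U hU V hV hUV
    rw [Function.onFun, id, id, Set.disjoint_left]
    intro x hxU hxV
    exact hUV (subset_antisymm (hUp V hV U (hUc U hU) (hUW U hU) ⟨x, hxU, hxV⟩)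
      (hUp U hU V (hUc V hV) (hUW V hV) ⟨x, hxV, hxU⟩))
  set h : ℕ → ℝ := fun n => 1 / ((n : ℝ) + 1) with hh
  have hpos : ∀ n, 0 < h n := fun n => by positivity
  have hlim : Tendsto h atTop (𝓝 0) := tendsto_one_div_add_atTop_nhds_zero_nat
  have hSo : ∀ U ∈ T, ∀ n, IsOpen (U ∩ {x | t + h n < u x}) := fun U hU n =>
    (hUo U hU).inter (isOpen_lt continuous_const hu.continuous)
  have key : ∀ n, ∑ U ∈ T, cauchyPer (U ∩ {x | t + h n < u x}) ≤
      ENNReal.ofReal ((h n)⁻¹ • (Φ (t + h n) - Φ t)) := by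
    intro n
    have h1 : ENNReal.ofReal (h n) * ∑ U ∈ T, cauchyPer (U ∩ {x | t + h n < u x}) ≤
        ENNReal.ofReal (Φ (t + h n) - Φ t) := by
      rw [← hdiff t (t + h n) (by have := hpos n; linarith), Finset.mul_sum]
      refine (Finset.sum_le_sum fun U hU => mul_cauchyPer_le hu hWb (hUo U hU) (hUp U hU)
        (hSo U hU n) inter_subset_left fun x hx => le_of_lt hx.2).trans ?_
      refine sum_setLIntegral_le hdisj (fun U hU => ((hUo U hU).inter
        (isOpen_lt hu.continuous continuous_const)).measurableSet) fun U hU x hx => ?_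
      exact ⟨hUW U hU hx.1, le_of_lt hx.2⟩
    rw [smul_eq_mul, ENNReal.ofReal_mul (inv_nonneg.2 (hpos n).le),
      ENNReal.ofReal_inv_of_pos (hpos n), mul_comm, ← div_eq_mul_inv]
    rw [ENNReal.le_div_iff_mul_le (Or.inl (by simpa using hpos n)) (Or.inl (by simp)), mul_comm]
    exact h1
  refine le_of_tendsto_of_tendsto' (f := fun n => ∑ U ∈ T, cauchyPer (U ∩ {x | t + h n < u x}))
    (tendsto_finsetSum _ fun U hU => ?_) (ENNReal.tendsto_ofReal
      ((htd.hasDerivAt.tendsto_slope_zero_right).comp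
        (tendsto_nhdsWithin_iff.2 ⟨hlim, Eventually.of_forall hpos⟩))) key
  have h2 := tendsto_cauchyPer_iUnion (hSo U hU) fun m n hmn x hx =>
    ⟨hx.1, lt_of_le_of_lt (add_le_add_right (one_div_le_one_div_of_le (by positivity)
      (by exact_mod_cast Nat.succ_le_succ hmn)) t) hx.2⟩
  have h3 : ⋃ n, U ∩ {x | t + h n < u x} = U := by
    refine subset_antisymm (iUnion_subset fun n => inter_subset_left) fun x hx => ?_
    have hx' : t < u x := hUW U hU hx
    obtain ⟨n, hn⟩ := (hlim.eventually (gt_mem_nhds (sub_pos.2 hx'))).exists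
    refine mem_iUnion.2 ⟨n, hx, ?_⟩
    change t + h n < u x
    linarith
  rwa [h3] at h2

/-! ### Merging convex sets -/

lemma coord_smul_add_smul (θ c d : ℝ) (x y : Plane) :
    coord θ (c • x + d • y) = c • coord θ x + d • coord θ y := by
  rw [coord_add, coord_smul, coord_smul]; rfl

lemma cauchyPer_convexHull {S : Set Plane} (hS : IsPreconnected S) :
    cauchyPer (convexHull ℝ S) = cauchyPer S := by
  refine le_antisymm ?_ (cauchyPer_mono (subset_convexHull ℝ S))
  refine lintegral_mono fun θ => measure_mono ?_
  rw [image_subset_iff]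
  refine convexHull_min (fun x hx => mem_image_of_mem _ hx) ?_
  have hc := (ordConnected_proj hS θ).convex (𝕜 := ℝ)
  intro x hx y hy p q hp hq hpq
  change coord θ (p • x + q • y) ∈ coord θ '' S
  rw [coord_smul_add_smul]
  exact hc hx hy hp hq hpq

lemma cauchyPer_union_le {S T : Set Plane} (hS : IsOpen S) :
    cauchyPer (S ∪ T) ≤ cauchyPer S + cauchyPer T := by
  unfold cauchyPer
  rw [← lintegral_add_left (measurable_volume_proj hS)]
  refine lintegral_mono fun θ => ?_
  rw [image_union]
  exact measure_union_le _ _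

/-- Two intersecting convex sets can be replaced by their convex hull without increasing the total
perimeter; iterating makes a finite family disjoint. -/
lemma exists_disjoint_family {K : Set Plane} (hK : Convex ℝ K) (T : Finset (Set Plane))
    (hT : ∀ H ∈ T, IsOpen H ∧ Convex ℝ H ∧ Bornology.IsBounded H ∧ H ⊆ K) :
    ∃ T' : Finset (Set Plane),
      (∀ H ∈ T', IsOpen H ∧ Convex ℝ H ∧ Bornology.IsBounded H ∧ H ⊆ K) ∧
      (T' : Set (Set Plane)).PairwiseDisjoint id ∧ (∀ H ∈ T, ∃ H' ∈ T', H ⊆ H') ∧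
      ∑ H ∈ T', cauchyPer H ≤ ∑ H ∈ T, cauchyPer H := by
  classical
  induction hn : T.card using Nat.strong_induction_on generalizing T with
  | _ n ih =>
  by_cases hd : (T : Set (Set Plane)).PairwiseDisjoint id
  · exact ⟨T, hT, hd, fun H hH => ⟨H, hH, Subset.rfl⟩, le_rfl⟩
  · simp only [Set.PairwiseDisjoint, Set.Pairwise, not_forall] at hd
    obtain ⟨A, hA, B, hB, hAB, hd⟩ := hd
    rw [Function.onFun, id, id, Set.not_disjoint_iff_nonempty_inter] at hd
    rw [Finset.mem_coe] at hA hB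
    obtain ⟨hAo, hAc, hAb, hAK⟩ := hT A hA
    obtain ⟨hBo, hBc, hBb, hBK⟩ := hT B hB
    have hBA : B ∈ T.erase A := Finset.mem_erase.2 ⟨hAB.symm, hB⟩
    set R := (T.erase A).erase B with hR
    set C := convexHull ℝ (A ∪ B) with hC
    have hconn : IsPreconnected (A ∪ B) :=
      hd.elim fun x hx => hAc.isPreconnected.union x hx.1 hx.2 hBc.isPreconnected
    have hPC : cauchyPer C ≤ cauchyPer A + cauchyPer B := by
      rw [hC, cauchyPer_convexHull hconn]
      exact cauchyPer_union_le hAo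
    have hsumT : ∑ H ∈ T, cauchyPer H = cauchyPer A + (cauchyPer B + ∑ H ∈ R, cauchyPer H) := by
      rw [hR, Finset.add_sum_erase _ _ hBA, Finset.add_sum_erase _ _ hA]
    have hcard : (insert C R).card < n := by
      have h1 := Finset.card_insert_le C R
      have h2 := Finset.card_erase_lt_of_mem hA
      have h3 : R.card < (T.erase A).card := Finset.card_erase_lt_of_mem hBA
      omega
    obtain ⟨T', h1, h2, h3, h4⟩ := ih _ hcard (insert C R) (fun H hH => by
      rcases Finset.mem_insert.1 hH with rfl | hH
      · exact ⟨(hAo.union hBo).convexHull, convex_convexHull ℝ _,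
          isBounded_convexHull.2 (hAb.union hBb), convexHull_min (union_subset hAK hBK) hK⟩
      · exact hT H (Finset.mem_of_mem_erase (Finset.mem_of_mem_erase hH))) rfl
    refine ⟨T', h1, h2, fun H hH => ?_, h4.trans ?_⟩
    · by_cases hHR : H ∈ R
      · exact h3 H (Finset.mem_insert_of_mem hHR)
      · obtain ⟨H', hH', hCH'⟩ := h3 C (Finset.mem_insert_self _ _)
        refine ⟨H', hH', Subset.trans ?_ hCH'⟩
        rw [hR, Finset.mem_erase, Finset.mem_erase] at hHR
        have : H = A ∨ H = B := by tauto
        rcases this with rfl | rfl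
        · exact subset_union_left.trans (subset_convexHull ℝ _)
        · exact subset_union_right.trans (subset_convexHull ℝ _)
    · rw [hsumT, ← add_assoc]
      by_cases hCR : C ∈ R
      · rw [Finset.insert_eq_of_mem hCR]; exact le_add_self
      · rw [Finset.sum_insert hCR]; gcongr

lemma sweep_mono (ρ : ℝ) {P Q : ℝ≥0∞} (h : P ≤ Q) : sweep ρ P ≤ sweep ρ Q :=
  lintegral_mono fun _ => tsub_le_tsub_right h _

lemma sweep_add_le (ρ : ℝ) (P Q : ℝ≥0∞) : sweep ρ P + sweep ρ Q ≤ sweep ρ (P + Q) := by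
  unfold sweep
  rw [← lintegral_add_left (by fun_prop)]
  refine lintegral_mono fun t => ?_
  set c := ENNReal.ofReal (2 * Real.pi * t)
  change (P - c) + (Q - c) ≤ P + Q - c
  rcases le_total c P with h | h
  · rw [ENNReal.sub_add_eq_add_sub h ENNReal.ofReal_ne_top]
    gcongr
    exact tsub_le_self
  · rw [tsub_eq_zero_of_le h, zero_add]
    gcongr
    exact le_add_self

lemma sum_sweep_le (ρ : ℝ) (T : Finset (Set Plane)) :
    ∑ H ∈ T, sweep ρ (cauchyPer H) ≤ sweep ρ (∑ H ∈ T, cauchyPer H) := by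
  classical
  induction T using Finset.induction_on with
  | empty => simp
  | insert H T hH ih =>
    rw [Finset.sum_insert hH, Finset.sum_insert hH]
    exact (add_le_add_right ih _).trans (sweep_add_le ρ _ _)

lemma volume_superlevel_le {u : Plane → ℝ} (hu : ContDiff ℝ 1 u)
    (hb : ∀ t : ℝ, 0 < t → Bornology.IsBounded {x | t ≤ u x}) {a b : ℝ} (ha : 0 < a) (hab : a < b)
    (hΛ : ∫⁻ x, ‖fderiv ℝ u x‖ₑ ≠ ∞) {K : Set Plane} (hK : Convex ℝ K) (hKc : IsClosed K)
    (hKu : ∀ x, a < u x → x ∈ K) {ρ : ℝ} (hρ : 0 < ρ) :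
    volume {x | b ≤ u x} ≤ volume {x | closedBall x ρ ⊆ K} +
      sweep ρ ((∫⁻ x, ‖fderiv ℝ u x‖ₑ) / ENNReal.ofReal (b - a)) := by
  classical
  obtain ⟨t, ht, hT⟩ := exists_level_sum_cauchyPer_le hu hb ha hab hΛ
  have hcpt : IsCompact {x | b ≤ u x} :=
    isCompact_of_isClosed_isBounded (isClosed_le continuous_const hu.continuous)
      (hb b (ha.trans hab))
  have hWo : IsOpen {y | t < u y} := isOpen_lt continuous_const hu.continuous
  have hsub : ∀ x ∈ {x | b ≤ u x}, x ∈ {y | t < u y} := fun x (hx : b ≤ u x) => ht.2.trans_le hx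
  obtain ⟨s, hs, hcov⟩ := hcpt.elim_nhds_subcover (fun x => connectedComponentIn {y | t < u y} x)
    fun x hx => hWo.connectedComponentIn.mem_nhds (mem_connectedComponentIn (hsub x hx))
  set T₀ := s.image fun x => connectedComponentIn {y | t < u y} x with hT₀
  have hT₀m : ∀ U ∈ T₀, ∃ x ∈ {y | t < u y}, U = connectedComponentIn {y | t < u y} x := by
    intro U hU
    obtain ⟨x, hx, rfl⟩ := Finset.mem_image.1 hU
    exact ⟨x, hsub x (hs x hx), rfl⟩
  have hWb : Bornology.IsBounded {y | t < u y} :=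
    (hb t (ha.trans ht.1)).subset fun x (hx : t < u x) => hx.le
  set T₁ := T₀.image (convexHull ℝ) with hT₁
  have hsum₁ : ∑ H ∈ T₁, cauchyPer H ≤ ∑ U ∈ T₀, cauchyPer U := by
    calc ∑ H ∈ T₁, cauchyPer H ≤ ∑ U ∈ T₀, cauchyPer (convexHull ℝ U) :=
          Finset.sum_image_le_of_nonneg fun _ _ => zero_le
      _ = ∑ U ∈ T₀, cauchyPer U := Finset.sum_congr rfl fun U hU => by
          obtain ⟨x, -, rfl⟩ := hT₀m U hU
          exact cauchyPer_convexHull isPreconnected_connectedComponentIn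
  obtain ⟨T, hTp, hTd, hTc, hTs⟩ := exists_disjoint_family hK T₁ fun H hH => by
    obtain ⟨U, hU, rfl⟩ := Finset.mem_image.1 hH
    obtain ⟨x, -, rfl⟩ := hT₀m U hU
    have hsubW := connectedComponentIn_subset {y | t < u y} x
    refine ⟨hWo.connectedComponentIn.convexHull, convex_convexHull ℝ _,
      isBounded_convexHull.2 (hWb.subset hsubW), convexHull_min (fun y hy => ?_) hK⟩
    exact hKu y (ht.1.trans (hsubW hy))
  have hmeas : ∀ H : Set Plane, IsClosed {x | ρ ≤ infDist x Hᶜ} := fun H =>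
    isClosed_le continuous_const (continuous_infDist_pt _)
  have hcompl : ∀ H ∈ T, Hᶜ.Nonempty := fun H hH => by
    rw [nonempty_iff_ne_empty]
    intro h
    rw [compl_empty_iff] at h
    exact NormedSpace.unbounded_univ ℝ Plane (h ▸ (hTp H hH).2.2.1)
  have hballs : ∀ H ∈ T, ∀ x, ρ ≤ infDist x Hᶜ → ball x ρ ⊆ H := fun H hH x hx =>
    (le_infDist_compl_iff (hcompl H hH)).1 hx
  calc volume {x | b ≤ u x} ≤ volume (⋃ H ∈ T, H) := by
        refine measure_mono fun x hx => ?_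
        obtain ⟨y, hy, hxy⟩ := mem_iUnion₂.1 (hcov hx)
        obtain ⟨H, hH, hsubH⟩ := hTc _ (Finset.mem_image_of_mem _ (Finset.mem_image_of_mem _ hy))
        exact mem_iUnion₂.2 ⟨H, hH, hsubH (subset_convexHull ℝ _ hxy)⟩
    _ ≤ ∑ H ∈ T, volume H := measure_biUnion_finset_le _ _
    _ ≤ ∑ H ∈ T, (volume {x | ρ ≤ infDist x Hᶜ} + sweep ρ (cauchyPer H)) :=
        Finset.sum_le_sum fun H hH =>
          volume_le_sweep (hTp H hH).1 (hTp H hH).2.1 (hTp H hH).2.2.1 hρ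
    _ = volume (⋃ H ∈ T, {x | ρ ≤ infDist x Hᶜ}) + ∑ H ∈ T, sweep ρ (cauchyPer H) := by
        rw [Finset.sum_add_distrib, measure_biUnion_finset (fun H hH H' hH' hne => ?_)
          fun H _ => (hmeas H).measurableSet]
        refine (hTd hH hH' hne).mono ?_ ?_
        · exact fun x hx => hballs H hH x hx (mem_ball_self hρ)
        · exact fun x hx => hballs H' hH' x hx (mem_ball_self hρ)
    _ ≤ _ := by
        refine add_le_add (measure_mono ?_) ((sum_sweep_le ρ T).trans (sweep_mono ρ
          (hTs.trans (hsum₁.trans (hT T₀ hT₀m)))))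
        refine iUnion₂_subset fun H hH x hx => ?_
        change closedBall x ρ ⊆ K
        rw [← closure_ball x hρ.ne']
        exact closure_minimal ((hballs H hH x hx).trans (hTp H hH).2.2.2) hKc

/-! ### Finiteness of the area of sets of finite perimeter in a half-plane -/

lemma inner_dir (θ : ℝ) (x : Plane) : inner ℝ (dir θ) x = coord θ x := by
  simp only [PiLp.inner_apply, Fin.sum_univ_two, coord, dir_zero_apply, dir_one_apply]
  simp [mul_comm]

lemma exists_coord_le {K : Set Plane} (hK : Convex ℝ K) (hKc : IsClosed K) (hne : K ≠ univ) :
    ∃ θ c, ∀ x ∈ K, coord θ x ≤ c := by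
  obtain ⟨p, hp⟩ := (ne_univ_iff_exists_notMem K).1 hne
  obtain ⟨f, c, hf, hfp⟩ := geometric_hahn_banach_closed_point hK hKc hp
  set w := (InnerProductSpace.toDual ℝ Plane).symm f with hw
  have hfw : ∀ x, f x = inner ℝ w x := fun x => by
    rw [hw, InnerProductSpace.toDual_symm_apply]
  obtain ⟨α, hα⟩ := exists_eq_norm_smul_dir w
  have hfc : ∀ x, f x = ‖w‖ * coord α x := fun x => by
    rw [hfw, ← inner_dir, ← real_inner_smul_left, ← hα]
  refine ⟨α, c / ‖w‖, fun x hx => ?_⟩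
  have h1 := hf x hx
  rw [hfc] at h1 hfp
  rcases (norm_nonneg w).eq_or_lt with h0 | h0
  · rw [← h0] at h1 hfp; linarith
  · rw [le_div_iff₀ h0]; linarith

lemma ofReal_sub_le_lintegral_line {u : Plane → ℝ} (hu : ContDiff ℝ 1 u) (p v : Plane)
    (hv : ‖v‖ = 1) (α β : ℝ) :
    ENNReal.ofReal (u (p + α • v) - u (p + β • v)) ≤ ∫⁻ τ : ℝ, ‖fderiv ℝ u (p + τ • v)‖ₑ := by
  set φ : ℝ → ℝ := fun τ => u (p + τ • v) with hφ
  have hl : ContDiff ℝ 1 fun τ : ℝ => p + τ • v := by fun_prop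
  have hφc : ContDiff ℝ 1 φ := hu.comp hl
  have hd : ∀ τ, ‖deriv φ τ‖ₑ ≤ ‖fderiv ℝ u (p + τ • v)‖ₑ := by
    intro τ
    have h1 : HasDerivAt (fun τ : ℝ => p + τ • v) v τ := by
      simpa using ((hasDerivAt_id τ).smul_const v).const_add p
    have h2 := ((hu.differentiable one_ne_zero _).hasFDerivAt.comp_hasDerivAt τ h1).deriv
    change deriv φ τ = _ at h2
    rw [h2, ← ofReal_norm, ← ofReal_norm]
    apply ENNReal.ofReal_le_ofReal
    simpa [hv] using (fderiv ℝ u (p + τ • v)).le_opNorm v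
  have key : ∀ α β : ℝ, α ≤ β → ENNReal.ofReal |φ β - φ α| ≤
      ∫⁻ τ : ℝ, ‖fderiv ℝ u (p + τ • v)‖ₑ := fun α β h =>
    (ofReal_le_lintegral_deriv hφc h le_rfl).trans
      ((setLIntegral_le_lintegral _ _).trans (lintegral_mono hd))
  change ENNReal.ofReal (φ α - φ β) ≤ _
  rcases le_total α β with h | h
  · refine le_trans (ENNReal.ofReal_le_ofReal ?_) (key α β h)
    rw [abs_sub_comm]; exact le_abs_self _
  · exact le_trans (ENNReal.ofReal_le_ofReal (le_abs_self _)) (key β α h)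

lemma lintegral_sq_le {u : Plane → ℝ} (hu : ContDiff ℝ 1 u) {θ c : ℝ}
    (hc : ∀ x, c < coord θ x → u x = 0) :
    ∫⁻ x, ENNReal.ofReal (u x) ^ 2 ≤ (∫⁻ x, ‖fderiv ℝ u x‖ₑ) ^ 2 := by
  have hfr := continuous_frame θ
  have hm : Measurable fun q : ℝ × ℝ => ‖fderiv ℝ u (frame θ q)‖ₑ :=
    ((measurable_fderiv ℝ u).comp hfr.measurable).enorm
  set F : ℝ → ℝ≥0∞ := fun s => ∫⁻ τ : ℝ, ‖fderiv ℝ u (frame θ (s, τ))‖ₑ with hF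
  set V : ℝ → ℝ≥0∞ := fun τ => ∫⁻ s : ℝ, ‖fderiv ℝ u (frame θ (s, τ))‖ₑ with hV
  have hFm : Measurable F := hm.lintegral_prod_right'
  have hVm : Measurable V := hm.lintegral_prod_left'
  have htot : ∫⁻ x, ‖fderiv ℝ u x‖ₑ = ∫⁻ q : ℝ × ℝ, ‖fderiv ℝ u (frame θ q)‖ₑ :=
    ((measurePreserving_frame θ).lintegral_comp (measurable_fderiv ℝ u).enorm).symm
  have hFi : ∫⁻ s, F s = ∫⁻ x, ‖fderiv ℝ u x‖ₑ := by
    rw [htot, Measure.volume_eq_prod, lintegral_prod _ hm.aemeasurable]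
  have hVi : ∫⁻ τ, V τ = ∫⁻ x, ‖fderiv ℝ u x‖ₑ := by
    rw [htot, Measure.volume_eq_prod, lintegral_prod_symm _ hm.aemeasurable]
  rcases eq_or_ne (∫⁻ x, ‖fderiv ℝ u x‖ₑ) ∞ with htop | htop
  · rw [htop]; simp
  have huV : ∀ s τ, ENNReal.ofReal (u (frame θ (s, τ))) ≤ V τ := by
    intro s τ
    have h1 := ofReal_sub_le_lintegral_line hu (τ • nor θ) (dir θ) (norm_dir θ) s (c + 1)
    have h2 : ∀ s : ℝ, τ • nor θ + s • dir θ = frame θ (s, τ) := fun s => add_comm _ _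
    simp only [h2] at h1
    rwa [hc (frame θ (c + 1, τ)) (by rw [coord_frame]; linarith), sub_zero] at h1
  have huF : ∀ s τ, ENNReal.ofReal (u (frame θ (s, τ))) ≤ F s := by
    intro s τ
    have h1 : ∀ τ', ENNReal.ofReal (u (frame θ (s, τ))) ≤ F s + V τ' := by
      intro τ'
      have h1 := ofReal_sub_le_lintegral_line hu (s • dir θ) (nor θ) (norm_nor θ) τ τ'
      change ENNReal.ofReal (u (frame θ (s, τ)) - u (frame θ (s, τ'))) ≤ F s at h1
      calc ENNReal.ofReal (u (frame θ (s, τ)))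
          = ENNReal.ofReal ((u (frame θ (s, τ)) - u (frame θ (s, τ'))) +
              u (frame θ (s, τ'))) := by rw [sub_add_cancel]
        _ ≤ _ := ENNReal.ofReal_add_le.trans (add_le_add h1 (huV s τ'))
    refine ENNReal.le_of_forall_pos_le_add fun ε hε _ => ?_
    obtain ⟨τ', hτ'⟩ : ∃ τ', V τ' ≤ ε := by
      by_contra! hcon
      refine htop ?_
      rw [← hVi, eq_top_iff]
      calc ∞ = ∫⁻ _ : ℝ, (ε : ℝ≥0∞) := by
            rw [lintegral_const, Real.volume_univ, ENNReal.mul_top]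
            exact_mod_cast hε.ne'
        _ ≤ _ := lintegral_mono fun τ => (hcon τ).le
    exact (h1 τ').trans (add_le_add_right hτ' _)
  have hum : Measurable fun x => ENNReal.ofReal (u x) ^ 2 :=
    hu.continuous.measurable.ennreal_ofReal.pow_const 2
  calc ∫⁻ x, ENNReal.ofReal (u x) ^ 2
      = ∫⁻ q : ℝ × ℝ, ENNReal.ofReal (u (frame θ q)) ^ 2 :=
        ((measurePreserving_frame θ).lintegral_comp hum).symm
    _ ≤ ∫⁻ q : ℝ × ℝ, F q.1 * V q.2 := by
        refine lintegral_mono fun q => ?_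
        rw [pow_two]
        exact mul_le_mul' (huF q.1 q.2) (huV q.1 q.2)
    _ = (∫⁻ s, F s) * ∫⁻ τ, V τ := by
        rw [Measure.volume_eq_prod, lintegral_prod_mul hFm.aemeasurable hVm.aemeasurable]
    _ = _ := by rw [hFi, hVi, pow_two]

lemma volume_le_per_sq {E : Set Plane} (hE : MeasurableSet E) {θ c : ℝ}
    (hc : ∀ x ∈ E, coord θ x ≤ c) : volume E ≤ per E ^ 2 := by
  set ε : ℕ → ℝ := fun n => 1 / ((n : ℝ) + 1) with hh
  have hpos : ∀ n, 0 < ε n := fun n => by positivity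
  have hlim : Tendsto ε atTop (𝓝 0) := tendsto_one_div_add_atTop_nhds_zero_nat
  have hstep : ∀ n, ∫⁻ x, ENNReal.ofReal (mollify E (ε n) (hpos n) x) ^ 2 ≤ per E ^ 2 := by
    intro n
    refine (lintegral_sq_le ((contDiff_mollify hE (hpos n)).of_le (by norm_num)) (θ := θ)
      (c := c + ε n) fun x hx => mollify_eq_zero _ fun y hy => ?_).trans ?_
    · have h1 := abs_coord_le θ (x - y)
      have h2 := hc y hy
      rw [coord_sub] at h1
      rw [dist_comm, dist_eq_norm]
      linarith [le_abs_self (coord θ x - coord θ y)]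
    · gcongr
      exact lintegral_enorm_fderiv_mollify_le hE (hpos n)
  calc volume E = ∫⁻ x, E.indicator 1 x := (lintegral_indicator_one hE).symm
    _ ≤ ∫⁻ x, liminf (fun n => ENNReal.ofReal (mollify E (ε n) (hpos n) x) ^ 2) atTop := by
        refine lintegral_mono_ae ?_
        filter_upwards [ae_tendsto_mollify hE hpos hlim] with x hx
        have h1 := ((ENNReal.continuous_pow 2).tendsto _).comp (ENNReal.tendsto_ofReal hx)
        have h2 := h1.liminf_eq
        change liminf (fun n => ENNReal.ofReal (mollify E (ε n) (hpos n) x) ^ 2) atTop = _ at h2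
        rw [h2]
        by_cases hxE : x ∈ E <;> simp [hxE]
    _ ≤ liminf (fun n => ∫⁻ x, ENNReal.ofReal (mollify E (ε n) (hpos n) x) ^ 2) atTop :=
        lintegral_liminf_le fun n =>
          ((contDiff_mollify hE (hpos n)).continuous.measurable.ennreal_ofReal).pow_const 2
    _ ≤ per E ^ 2 := by
        refine (liminf_le_liminf (Eventually.of_forall hstep)).trans ?_
        simp

lemma volume_le_of_mollify {E : Set Plane} (hE : MeasurableSet E) {b : ℝ} (hb : b < 1)
    {c : ℝ → ℝ≥0∞} {X : ℝ≥0∞} (hc : Tendsto c (𝓝[>] 0) (𝓝 X))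
    (h : ∀ (ε : ℝ) (hε : 0 < ε), volume {x | b ≤ mollify E ε hε x} ≤ c ε) : volume E ≤ X := by
  set ε : ℕ → ℝ := fun n => 1 / ((n : ℝ) + 1) with hh
  have hpos : ∀ n, 0 < ε n := fun n => by positivity
  have hlim : Tendsto ε atTop (𝓝 0) := tendsto_one_div_add_atTop_nhds_zero_nat
  have hms : ∀ n, MeasurableSet {x | b ≤ mollify E (ε n) (hpos n) x} := fun n =>
    (isClosed_le continuous_const (contDiff_mollify hE (hpos n)).continuous).measurableSet
  have hcε := (hc.comp (tendsto_nhdsWithin_iff.2 ⟨hlim, Eventually.of_forall hpos⟩)).liminf_eq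
  calc volume E = ∫⁻ x, E.indicator 1 x := (lintegral_indicator_one hE).symm
    _ ≤ ∫⁻ x, liminf (fun n => {x | b ≤ mollify E (ε n) (hpos n) x}.indicator
          (1 : Plane → ℝ≥0∞) x) atTop := by
        refine lintegral_mono_ae ?_
        filter_upwards [ae_tendsto_mollify hE hpos hlim] with x hx
        by_cases hxE : x ∈ E
        · rw [indicator_of_mem hxE] at hx ⊢
          refine le_liminf_of_le (by isBoundedDefault) ?_
          filter_upwards [hx.eventually (lt_mem_nhds hb)] with n hn
          have : x ∈ {x | b ≤ mollify E (ε n) (hpos n) x} := le_of_lt hn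
          rw [indicator_of_mem this]
        · rw [indicator_of_notMem hxE]; exact zero_le
    _ ≤ liminf (fun n => ∫⁻ x, {x | b ≤ mollify E (ε n) (hpos n) x}.indicator
          (1 : Plane → ℝ≥0∞) x) atTop :=
        lintegral_liminf_le fun n => measurable_one.indicator (hms n)
    _ ≤ liminf (c ∘ ε) atTop := by
        refine liminf_le_liminf (Eventually.of_forall fun n => ?_)
        rw [lintegral_indicator_one (hms n)]
        exact h _ _
    _ = X := hcε

/-! ### Area of sets of given perimeter -/

lemma volume_preimage_smul_add {m : ℝ} (hm : 0 < m) (c : Plane) (S : Set Plane) :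
    volume ((fun x : Plane => m • x + c) ⁻¹' S) = ENNReal.ofReal (m ^ 2)⁻¹ * volume S := by
  have h1 : (fun x : Plane => m • x + c) ⁻¹' S = (m • ·) ⁻¹' ((· + c) ⁻¹' S) := rfl
  rw [h1, Measure.addHaar_preimage_smul _ hm.ne', measure_preimage_add_right,
    finrank_euclideanSpace_fin, abs_of_pos (by positivity)]

lemma lintegral_comp_smul_add {m : ℝ} (hm : 0 < m) (c : Plane) {f : Plane → ℝ≥0∞}
    (hf : Measurable f) :
    ∫⁻ x, f (m • x + c) = ENNReal.ofReal (m ^ 2)⁻¹ * ∫⁻ x, f x := by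
  have h1 : Measure.map (fun x : Plane => m • x + c) volume =
      ENNReal.ofReal (m ^ 2)⁻¹ • volume := by
    ext S hS
    rw [Measure.map_apply (by fun_prop) hS, volume_preimage_smul_add hm]
    rfl
  rw [← lintegral_map hf (by fun_prop), h1, lintegral_smul_measure]
  rfl

lemma sweep_add_le_add (ρ : ℝ) (P e : ℝ≥0∞) :
    sweep ρ (P + e) ≤ sweep ρ P + e * ENNReal.ofReal ρ := by
  calc sweep ρ (P + e) ≤ ∫⁻ t in Ioo 0 ρ, ((P - ENNReal.ofReal (2 * Real.pi * t)) + e) := by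
        refine lintegral_mono fun t => ?_
        change P + e - ENNReal.ofReal (2 * Real.pi * t) ≤ _
        rw [tsub_le_iff_right, add_right_comm]
        gcongr
        exact le_tsub_add
    _ = sweep ρ P + e * ENNReal.ofReal ρ := by
        rw [lintegral_add_right _ measurable_const, setLIntegral_const, Real.volume_Ioo, sub_zero]
        rfl

lemma div_ofReal_inv_one_add (L : ℝ≥0∞) {s : ℝ} (hs : 0 < s) :
    L / ENNReal.ofReal (1 + s)⁻¹ = L + L * ENNReal.ofReal s := by
  rw [div_eq_mul_inv, ← ENNReal.ofReal_inv_of_pos (by positivity), inv_inv,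
    ENNReal.ofReal_add zero_le_one hs.le, ENNReal.ofReal_one, mul_add, mul_one]

/-- A measurable subset of a closed convex set `K` has at most the area of the `ρ`-inner parallel
set of `K` plus the area swept by parallel curves of initial length `Per E`. -/
lemma volume_le_add_sweep {K : Set Plane} (hK : Convex ℝ K) (hKc : IsClosed K) (hKne : K ≠ univ)
    {o : Plane} {δ : ℝ} (hδ : 0 < δ) (ho : ball o δ ⊆ K) {E : Set Plane} (hE : MeasurableSet E)
    (hEK : E ⊆ K) (hP : per E ≠ ∞) {ρ : ℝ} (hρ : 0 < ρ) :
    volume E ≤ volume {x | closedBall x ρ ⊆ K} + sweep ρ (per E) := by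
  obtain ⟨θ, c₀, hc₀⟩ := exists_coord_le hK hKc hKne
  have hfin : volume E ≠ ∞ :=
    ((volume_le_per_sq hE fun x hx => hc₀ x (hEK hx)).trans_lt
      (ENNReal.pow_lt_top hP.lt_top)).ne
  have key : ∀ a b : ℝ, 0 < a → a < b → b < 1 →
      volume E ≤ volume {x | closedBall x ρ ⊆ K} + sweep ρ (per E / ENNReal.ofReal (b - a)) := by
    intro a b ha hab hb
    set X := volume {x | closedBall x ρ ⊆ K} + sweep ρ (per E / ENNReal.ofReal (b - a)) with hX
    refine volume_le_of_mollify hE hb (c := fun ε => ENNReal.ofReal ((1 + ε / δ) ^ 2) * X) ?_ ?_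
    · have h1 : Tendsto (fun ε : ℝ => ENNReal.ofReal ((1 + ε / δ) ^ 2)) (𝓝[>] 0)
          (𝓝 (ENNReal.ofReal ((1 + 0 / δ) ^ 2))) :=
        (ENNReal.tendsto_ofReal (Continuous.tendsto (by fun_prop) 0)).mono_left inf_le_left
      have h2 := ENNReal.Tendsto.mul_const (b := X) h1 (Or.inl (by simp))
      simpa using h2
    · intro ε hε
      set m : ℝ := 1 + ε / δ with hm
      have hm1 : 1 < m := by have := div_pos hε hδ; linarith
      have hm0 : 0 < m := by linarith
      set u := mollify E ε hε with hu
      have huC : ContDiff ℝ 2 u := contDiff_mollify hE hε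
      set c : Plane := o - m • o with hc
      set v : Plane → ℝ := fun x => u (m • x + c) with hv
      have hvC : ContDiff ℝ 1 v :=
        (huC.of_le (by norm_num)).comp (by fun_prop)
      have hfd : ∀ x, fderiv ℝ v x = m • fderiv ℝ u (m • x + c) := by
        intro x
        have h1 : HasFDerivAt (fun x : Plane => m • x + c) (m • ContinuousLinearMap.id ℝ Plane) x :=
          ((hasFDerivAt_id x).const_smul m).add_const c
        have h2 := ((huC.differentiable (by norm_num)) (m • x + c)).hasFDerivAt.comp x h1
        have h3 := h2.fderiv
        rw [ContinuousLinearMap.comp_smul, ContinuousLinearMap.comp_id] at h3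
        exact h3
      have hΛ : ∫⁻ x, ‖fderiv ℝ v x‖ₑ ≤ per E := by
        have h1 : ∀ x, ‖fderiv ℝ v x‖ₑ =
            ENNReal.ofReal m * ENNReal.ofReal ‖fderiv ℝ u (m • x + c)‖ := by
          intro x
          rw [hfd, ← ofReal_norm, norm_smul, ENNReal.ofReal_mul (norm_nonneg _), Real.norm_eq_abs,
            abs_of_pos hm0]
        have hcont : Continuous (fderiv ℝ u) := huC.continuous_fderiv (by norm_num)
        simp_rw [h1]
        rw [lintegral_const_mul _ (by fun_prop), lintegral_comp_smul_add hm0 c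
          (f := fun x => ENNReal.ofReal ‖fderiv ℝ u x‖) (by fun_prop), ← mul_assoc,
          ← ENNReal.ofReal_mul hm0.le]
        have h2 : ENNReal.ofReal (m * (m ^ 2)⁻¹) ≤ 1 := by
          rw [ENNReal.ofReal_le_one, ← div_eq_mul_inv, div_le_one (by positivity)]
          nlinarith
        have h3 := lintegral_enorm_fderiv_mollify_le hE hε
        simp_rw [← ofReal_norm] at h3
        exact (mul_le_mul' h2 h3).trans (one_mul _).le
      have hvb : ∀ t : ℝ, 0 < t → Bornology.IsBounded {x | t ≤ v x} := by
        intro t ht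
        obtain ⟨R, hR⟩ := (isBounded_superlevel_mollify hE hfin hε ht).exists_norm_le
        refine isBounded_iff_forall_norm_le.2 ⟨(R + ‖c‖) / m, fun x hx => ?_⟩
        have h1 : ‖m • x + c‖ ≤ R := hR _ hx
        have h2 : ‖m • x‖ ≤ ‖m • x + c‖ + ‖c‖ := by
          have := norm_sub_le (m • x + c) c
          rwa [add_sub_cancel_right] at this
        rw [norm_smul, Real.norm_eq_abs, abs_of_pos hm0] at h2
        rw [le_div_iff₀ hm0]
        linarith
      have hvK : ∀ x, a < v x → x ∈ K := by
        intro x hx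
        obtain ⟨y, hyE, hy⟩ := exists_mem_of_mollify_pos hε (ha.trans hx)
        have hz : o + (m - 1)⁻¹ • (m • x + c - y) ∈ ball o δ := by
          rw [mem_ball, dist_eq_norm, add_sub_cancel_left, norm_smul, norm_inv, Real.norm_eq_abs,
            abs_of_pos (by linarith)]
          rw [dist_comm, dist_eq_norm] at hy
          have hm2 : m - 1 = ε / δ := by rw [hm]; ring
          rw [hm2, inv_div, div_mul_eq_mul_div, div_lt_iff₀ hε]
          gcongr
        have hxe : x = m⁻¹ • y + ((m - 1) / m) • (o + (m - 1)⁻¹ • (m • x + c - y)) := by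
          have hm2 : m - 1 ≠ 0 := by linarith
          ext i
          simp only [hc, PiLp.add_apply, PiLp.smul_apply, PiLp.sub_apply, smul_eq_mul]
          field_simp
          ring
        rw [hxe]
        refine hK (hEK hyE) (ho hz) (by positivity) (div_nonneg (by linarith) hm0.le) ?_
        field_simp
        ring
      have hD := volume_superlevel_le hvC hvb ha hab
        ((hΛ.trans_lt hP.lt_top).ne) hK hKc hvK hρ
      have hD2 : volume {x | b ≤ v x} ≤ X := by
        refine hD.trans (add_le_add_right (sweep_mono ρ ?_) _)
        gcongr
      have hvol : volume {x | b ≤ v x} = ENNReal.ofReal (m ^ 2)⁻¹ * volume {x | b ≤ u x} :=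
        volume_preimage_smul_add hm0 c {x | b ≤ u x}
      rw [hvol] at hD2
      calc volume {x | b ≤ u x}
          = ENNReal.ofReal (m ^ 2) * (ENNReal.ofReal (m ^ 2)⁻¹ * volume {x | b ≤ u x}) := by
            rw [← mul_assoc, ← ENNReal.ofReal_mul (by positivity),
              mul_inv_cancel₀ (by positivity), ENNReal.ofReal_one, one_mul]
        _ ≤ ENNReal.ofReal (m ^ 2) * X := by gcongr
  have key2 : ∀ s : ℝ, 0 < s → volume E ≤ volume {x | closedBall x ρ ⊆ K} +
      (sweep ρ (per E) + per E * ENNReal.ofReal s * ENNReal.ofReal ρ) := by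
    intro s hs
    have h1 : (1 + s)⁻¹ < 1 := inv_lt_one_of_one_lt₀ (by linarith)
    have h0 : 0 < (1 + s)⁻¹ := by positivity
    have h2 := key ((1 - (1 + s)⁻¹) / 2) ((1 + (1 + s)⁻¹) / 2) (by linarith) (by linarith)
      (by linarith)
    rw [show (1 + (1 + s)⁻¹) / 2 - (1 - (1 + s)⁻¹) / 2 = (1 + s)⁻¹ by ring,
      div_ofReal_inv_one_add _ hs] at h2
    exact h2.trans (add_le_add_right (sweep_add_le_add ρ _ _) _)
  have hlim : Tendsto (fun s : ℝ => volume {x | closedBall x ρ ⊆ K} +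
      (sweep ρ (per E) + per E * ENNReal.ofReal s * ENNReal.ofReal ρ)) (𝓝[>] 0)
      (𝓝 (volume {x | closedBall x ρ ⊆ K} + (sweep ρ (per E) + 0))) := by
    refine tendsto_const_nhds.add (tendsto_const_nhds.add ?_)
    have h1 : Tendsto (fun s : ℝ => ENNReal.ofReal s) (𝓝[>] 0) (𝓝 0) := by
      have := (ENNReal.continuous_ofReal.tendsto 0).mono_left (nhdsWithin_le_nhds (s := Ioi 0))
      simpa using this
    have h2 := ENNReal.Tendsto.const_mul (a := per E) h1 (Or.inr hP)
    have h3 := ENNReal.Tendsto.mul_const (b := ENNReal.ofReal ρ) h2 (Or.inr ENNReal.ofReal_ne_top)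
    simpa using h3
  rw [add_zero] at hlim
  exact ge_of_tendsto hlim (eventually_mem_nhdsWithin.mono fun s hs => key2 s hs)

lemma sweep_le_volume_closedBall (R : ℝ) {q : ℝ} (hq : 0 ≤ q) :
    sweep R (ENNReal.ofReal (2 * Real.pi * q)) ≤ volume (closedBall (0 : Plane) q) := by
  have h1 : sweep R (ENNReal.ofReal (2 * Real.pi * q)) ≤
      sweep q (ENNReal.ofReal (2 * Real.pi * q)) := by
    unfold sweep
    rw [← lintegral_indicator measurableSet_Ioo, ← lintegral_indicator measurableSet_Ioo]
    refine lintegral_mono fun t => ?_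
    by_cases ht : t ∈ Ioo 0 R
    · rw [indicator_of_mem ht]
      by_cases htq : t < q
      · rw [indicator_of_mem (show t ∈ Ioo 0 q from ⟨ht.1, htq⟩)]
      · rw [tsub_eq_zero_of_le]
        · exact zero_le
        · have := not_lt.1 htq
          gcongr
    · rw [indicator_of_notMem ht]
      exact zero_le
  have h2 := add_sweep_le_volume_cthickening (D := {(0 : Plane)}) isCompact_singleton
    (convex_singleton _) (singleton_nonempty _) q
  rw [cauchyPer_singleton, zero_add, cthickening_singleton _ hq] at h2
  exact h1.trans (le_add_self.trans h2)

/-- The isoperimetric inequality in the plane. -/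
lemma volume_le_volume_closedBall {E : Set Plane} (hE : MeasurableSet E) (hfin : volume E ≠ ∞)
    {q : ℝ} (hq : 0 ≤ q) (hP : per E = ENNReal.ofReal (2 * Real.pi * q)) (x : Plane) :
    volume E ≤ volume (closedBall x q) := by
  have key : ∀ s : ℝ, 0 < s → volume E ≤ volume (closedBall (0 : Plane) (q * (1 + s))) := by
    intro s hs
    have h1 : (1 + s)⁻¹ < 1 := inv_lt_one_of_one_lt₀ (by linarith)
    have h0 : 0 < (1 + s)⁻¹ := by positivity
    set a := (1 - (1 + s)⁻¹) / 2 with ha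
    set b := (1 + (1 + s)⁻¹) / 2 with hb
    have ha0 : 0 < a := by linarith
    have hab : b - a = (1 + s)⁻¹ := by rw [ha, hb]; ring
    refine volume_le_of_mollify hE (b := b) (by linarith) tendsto_const_nhds fun ε hε => ?_
    obtain ⟨R, hR0, hR⟩ := (isBounded_superlevel_mollify hE hfin hε ha0).exists_pos_norm_le
    have hΛ := lintegral_enorm_fderiv_mollify_le hE hε
    have hD := volume_superlevel_le ((contDiff_mollify hE hε).of_le (by norm_num))
      (fun t ht => isBounded_superlevel_mollify hE hfin hε ht) ha0 (b := b) (by linarith)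
      ((hΛ.trans_lt (by rw [hP]; exact ENNReal.ofReal_lt_top)).ne)
      (convex_closedBall (0 : Plane) R) isClosed_closedBall
      (fun x hx => mem_closedBall_zero_iff.2 (hR x (le_of_lt hx))) (ρ := R + 1) (by linarith)
    have hempty : {x : Plane | closedBall x (R + 1) ⊆ closedBall 0 R} = ∅ := by
      refine eq_empty_of_forall_notMem fun x hx => ?_
      replace hx : closedBall x (R + 1) ⊆ closedBall 0 R := hx
      have hn : ‖(R + 1) • dir 0‖ = R + 1 := by
        rw [norm_smul, norm_dir, mul_one, Real.norm_eq_abs, abs_of_pos (by linarith)]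
      have h2 := hx (show x + (R + 1) • dir 0 ∈ closedBall x (R + 1) by
        rw [mem_closedBall, dist_eq_norm, add_sub_cancel_left, hn])
      have h3 := hx (show x - (R + 1) • dir 0 ∈ closedBall x (R + 1) by
        rw [mem_closedBall, dist_eq_norm, sub_sub_cancel_left, norm_neg, hn])
      rw [mem_closedBall_zero_iff] at h2 h3
      have h4 := norm_sub_le (x + (R + 1) • dir 0) (x - (R + 1) • dir 0)
      rw [show x + (R + 1) • dir 0 - (x - (R + 1) • dir 0) = (2 : ℝ) • ((R + 1) • dir 0) by
        rw [two_smul]; abel, norm_smul, hn, Real.norm_eq_abs, abs_of_pos two_pos] at h4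
      linarith
    rw [hempty, measure_empty, zero_add] at hD
    refine hD.trans ((sweep_mono _ ?_).trans (sweep_le_volume_closedBall (R + 1)
      (q := q * (1 + s)) (by positivity)))
    rw [hab]
    calc (∫⁻ x, ‖fderiv ℝ (mollify E ε hε) x‖ₑ) / ENNReal.ofReal (1 + s)⁻¹
        ≤ ENNReal.ofReal (2 * Real.pi * q) / ENNReal.ofReal (1 + s)⁻¹ := by
          rw [← hP]
          gcongr
      _ = ENNReal.ofReal (2 * Real.pi * (q * (1 + s))) := by
          rw [← ENNReal.ofReal_div_of_pos h0, div_inv_eq_mul, mul_assoc]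
  have hvol : ∀ r : ℝ, volume (closedBall (0 : Plane) r) =
      ENNReal.ofReal r ^ 2 * ENNReal.ofReal Real.pi := by
    intro r
    rw [EuclideanSpace.volume_closedBall_fin_two]
  have hx : volume (closedBall x q) = volume (closedBall (0 : Plane) q) := by
    rw [EuclideanSpace.volume_closedBall_fin_two, EuclideanSpace.volume_closedBall_fin_two]
  have hlim : Tendsto (fun s : ℝ => volume (closedBall (0 : Plane) (q * (1 + s)))) (𝓝[>] 0)
      (𝓝 (volume (closedBall x q))) := by
    simp_rw [hx, hvol]
    refine ENNReal.Tendsto.mul_const ?_ (Or.inr ENNReal.ofReal_ne_top)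
    have hc : Continuous fun s : ℝ => ENNReal.ofReal (q * (1 + s)) ^ 2 :=
      (ENNReal.continuous_pow 2).comp (ENNReal.continuous_ofReal.comp (by fun_prop))
    have := (hc.tendsto 0).mono_left (nhdsWithin_le_nhds (s := Ioi 0))
    simpa using this
  exact ge_of_tendsto hlim (eventually_mem_nhdsWithin.mono fun s hs => key s hs)

/-! ### Inner parallel sets -/

lemma two_mul_enorm_le_cauchyPer_segment (x y : Plane) :
    2 * ‖y - x‖ₑ ≤ cauchyPer (segment ℝ x y) := by
  set w : Plane := !₂[-(y - x) 1, (y - x) 0] with hw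
  have hn : ‖w‖ = ‖y - x‖ := by
    refine (sq_eq_sq₀ (norm_nonneg _) (norm_nonneg _)).1 ?_
    rw [norm_sq_plane, norm_sq_plane]
    simp [hw]
    ring
  have h1 := lintegral_enorm_apply_nor (InnerProductSpace.toDual ℝ Plane w)
  have h2 : ‖(InnerProductSpace.toDual ℝ Plane) w‖ₑ = ‖y - x‖ₑ := by
    rw [← ofReal_norm, ← ofReal_norm, LinearIsometryEquiv.norm_map, hn]
  rw [h2] at h1
  rw [← h1]
  refine lintegral_mono fun θ => ?_
  have h3 : InnerProductSpace.toDual ℝ Plane w (nor θ) = coord θ (y - x) := by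
    rw [InnerProductSpace.toDual_apply_apply, PiLp.inner_apply, Fin.sum_univ_two, coord]
    simp [hw]
    ring
  change ‖InnerProductSpace.toDual ℝ Plane w (nor θ)‖ₑ ≤ volume (coord θ '' segment ℝ x y)
  rw [h3, coord_sub, Real.enorm_eq_ofReal_abs, ← Real.volume_interval]
  have h4 := ordConnected_proj (convex_segment (𝕜 := ℝ) x y).isPreconnected θ
  exact measure_mono (h4.uIcc_subset (mem_image_of_mem _ (left_mem_segment ℝ x y))
    (mem_image_of_mem _ (right_mem_segment ℝ x y)))

lemma cauchyPer_homothety (z : Plane) {m : ℝ} (hm : 0 ≤ m) (S : Set Plane) :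
    cauchyPer (AffineMap.homothety z m '' S) = ENNReal.ofReal m * cauchyPer S := by
  unfold cauchyPer
  rw [← lintegral_const_mul' _ _ ENNReal.ofReal_ne_top]
  refine lintegral_congr fun θ => ?_
  have h1 : coord θ '' (AffineMap.homothety z m '' S) =
      AffineMap.homothety (coord θ z) m '' (coord θ '' S) := by
    rw [image_image, image_image]
    refine image_congr fun x _ => ?_
    simp only [AffineMap.homothety_apply, vsub_eq_sub, vadd_eq_add, coord_add, coord_smul,
      coord_sub, smul_eq_mul]
  rw [h1, Measure.addHaar_image_homothety, Module.finrank_self, pow_one, abs_of_nonneg hm]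

/-- The inner parallel set of `K` at distance `ρ`. -/
def innerParallel (K : Set Plane) (ρ : ℝ) : Set Plane := {x | closedBall x ρ ⊆ K}

lemma mem_innerParallel {K : Set Plane} {ρ : ℝ} {x : Plane} :
    x ∈ innerParallel K ρ ↔ closedBall x ρ ⊆ K := Iff.rfl

lemma innerParallel_eq_iInter (K : Set Plane) (ρ : ℝ) :
    innerParallel K ρ = ⋂ v ∈ closedBall (0 : Plane) ρ, (fun x => x + v) ⁻¹' K := by
  ext x
  simp only [mem_innerParallel, mem_iInter, mem_preimage, mem_closedBall_zero_iff]
  constructor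
  · intro h v hv
    exact h (by rwa [mem_closedBall, dist_eq_norm, add_sub_cancel_left])
  · intro h y hy
    have := h (y - x) (by rwa [mem_closedBall, dist_eq_norm] at hy)
    rwa [add_sub_cancel] at this

lemma isClosed_innerParallel {K : Set Plane} (hK : IsClosed K) (ρ : ℝ) :
    IsClosed (innerParallel K ρ) := by
  rw [innerParallel_eq_iInter]
  exact isClosed_biInter fun v _ => hK.preimage (by fun_prop)

lemma convex_innerParallel {K : Set Plane} (hK : Convex ℝ K) (ρ : ℝ) :
    Convex ℝ (innerParallel K ρ) := by
  rw [innerParallel_eq_iInter]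
  exact convex_iInter₂ fun v _ => hK.translate_preimage_left v

lemma innerParallel_anti (K : Set Plane) {ρ σ : ℝ} (h : ρ ≤ σ) :
    innerParallel K σ ⊆ innerParallel K ρ := fun _ hx => (closedBall_subset_closedBall h).trans hx

lemma innerParallel_subset (K : Set Plane) {ρ : ℝ} (h : 0 ≤ ρ) : innerParallel K ρ ⊆ K :=
  fun _ hx => hx (mem_closedBall_self h)

lemma innerParallel_zero (K : Set Plane) : innerParallel K 0 = K := by
  ext x
  rw [mem_innerParallel, closedBall_zero, singleton_subset_iff]

lemma combo_mem_innerParallel {K : Set Plane} (hK : Convex ℝ K) {ρ σ a b : ℝ} (hρ : 0 ≤ ρ)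
    (hσ : 0 ≤ σ) (ha : 0 ≤ a) (hb : 0 ≤ b) (hab : a + b = 1) {x y : Plane}
    (hx : x ∈ innerParallel K ρ) (hy : y ∈ innerParallel K σ) :
    a • x + b • y ∈ innerParallel K (a * ρ + b * σ) := by
  intro z hz
  set τ := a * ρ + b * σ with hτ
  have hτ0 : 0 ≤ τ := by positivity
  set w := z - (a • x + b • y) with hw
  have hwn : ‖w‖ ≤ τ := by rwa [mem_closedBall, dist_eq_norm] at hz
  rcases hτ0.eq_or_lt with h0 | h0
  · have : w = 0 := norm_le_zero_iff.1 (by linarith)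
    rw [sub_eq_zero.1 this]
    exact hK (innerParallel_subset K hρ hx) (innerParallel_subset K hσ hy) ha hb hab
  · have hmem : ∀ {p : Plane} {s : ℝ}, 0 ≤ s → p + (s / τ) • w ∈ closedBall p s := by
      intro p s hs
      rw [mem_closedBall, dist_eq_norm, add_sub_cancel_left, norm_smul, Real.norm_eq_abs,
        abs_of_nonneg (by positivity), div_mul_eq_mul_div, div_le_iff₀ h0]
      gcongr
    have := hK (hx (hmem hρ)) (hy (hmem hσ)) ha hb hab
    convert this using 1
    have h1 : a • (x + (ρ / τ) • w) + b • (y + (σ / τ) • w) =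
        (a • x + b • y) + (τ / τ) • w := by
      rw [hτ, add_div, add_smul, smul_add, smul_add, smul_smul, smul_smul, mul_div_assoc,
        mul_div_assoc]
      abel
    rw [h1, div_self h0.ne', one_smul, hw, add_sub_cancel]

lemma cthickening_subset_of_innerParallel {K D : Set Plane} (hD : IsCompact D) {ρ : ℝ}
    (hρ : 0 ≤ ρ) (h : D ⊆ innerParallel K ρ) : cthickening ρ D ⊆ K := by
  rw [hD.cthickening_eq_biUnion_closedBall hρ]
  exact iUnion₂_subset fun x hx => h hx

lemma mul_cauchyPer_innerParallel_le {K : Set Plane} (hK : Convex ℝ K) {ρ r l : ℝ} (hρ : 0 ≤ ρ)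
    (hr : 0 ≤ r) (hl : 0 ≤ l) (hl1 : l ≤ 1) (hne : (innerParallel K r).Nonempty) :
    ENNReal.ofReal (1 - l) * cauchyPer (innerParallel K ρ) ≤
      cauchyPer (innerParallel K ((1 - l) * ρ + l * r)) := by
  obtain ⟨z, hz⟩ := hne
  rw [← cauchyPer_homothety z (by linarith)]
  refine cauchyPer_mono ?_
  rintro _ ⟨x, hx, rfl⟩
  have h := combo_mem_innerParallel hK hρ hr (by linarith : 0 ≤ 1 - l) hl (by ring) hx hz
  convert h using 1
  simp only [AffineMap.homothety_apply, vsub_eq_sub, vadd_eq_add, smul_sub, sub_smul, one_smul]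
  abel

lemma exists_innerParallel_subset_thickening {K : Set Plane} (hK : Convex ℝ K) (hKc : IsClosed K)
    {r : ℝ} (hr : 0 < r) (hne : (innerParallel K r).Nonempty)
    (hb : Bornology.IsBounded (innerParallel K r)) {δ : ℝ} (hδ : 0 < δ) :
    ∃ ρ, 0 < ρ ∧ ρ < r ∧ innerParallel K ρ ⊆ thickening δ (innerParallel K r) := by
  obtain ⟨z, hz⟩ := hne
  obtain ⟨R, hR0, hR⟩ := hb.subset_ball_lt 0 z
  set U := thickening δ (innerParallel K r) ∩ ball z R with hU
  have hUo : IsOpen U := isOpen_thickening.inter isOpen_ball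
  have hsub : innerParallel K r ⊆ U := subset_inter (self_subset_thickening hδ _) hR
  have : Nonempty (Ioo 0 r) := ⟨⟨r / 2, by constructor <;> linarith⟩⟩
  obtain ⟨⟨ρ, hρ⟩, hρU⟩ := exists_subset_nhds_of_isCompact
    (V := fun i : Ioo 0 r => innerParallel K i ∩ closedBall z R) (U := U)
    (fun i j => by
      rcases le_total i j with h | h
      · exact ⟨j, inter_subset_inter_left _ (innerParallel_anti K h), subset_rfl⟩
      · exact ⟨i, subset_rfl, inter_subset_inter_left _ (innerParallel_anti K h)⟩)
    (fun i => (isCompact_closedBall z R).inter_left (isClosed_innerParallel hKc i))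
    (fun x hx => by
      refine hUo.mem_nhds (hsub ?_)
      rw [mem_innerParallel, ← closure_ball x hr.ne']
      refine closure_minimal (fun y hy => ?_) hKc
      rw [mem_ball] at hy
      have h0 := dist_nonneg (x := y) (y := x)
      have h1 := (mem_iInter.1 hx ⟨(dist y x + r) / 2, by constructor <;> linarith⟩).1
      exact h1 (show dist y x ≤ (dist y x + r) / 2 by linarith))
  refine ⟨ρ, hρ.1, hρ.2, fun y hy => ?_⟩
  by_cases hyR : y ∈ closedBall z R
  · exact (hρU ⟨hy, hyR⟩).1
  · exfalso
    rw [mem_closedBall, not_le, dist_eq_norm] at hyR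
    have hn : 0 < ‖y - z‖ := hR0.trans hyR
    set l := R / ‖y - z‖ with hl
    have hl1 : l ≤ 1 := (div_le_one hn).2 hyR.le
    have hl0 : 0 ≤ l := by positivity
    have hw : z + l • (y - z) ∈ innerParallel K ρ := by
      have h1 := (convex_innerParallel hK ρ) (innerParallel_anti K hρ.2.le hz) hy
        (by linarith : 0 ≤ 1 - l) hl0 (by ring)
      convert h1 using 1
      rw [smul_sub, sub_smul, one_smul]
      abel
    have hd : dist (z + l • (y - z)) z = R := by
      rw [dist_eq_norm, add_sub_cancel_left, norm_smul, Real.norm_eq_abs, abs_of_nonneg hl0, hl,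
        div_mul_cancel₀ _ hn.ne']
    have h2 := (hρU ⟨hw, hd.le⟩).2
    rw [mem_ball, hd] at h2
    exact lt_irrefl _ h2

lemma isBounded_of_innerParallel {K : Set Plane} (hK : Convex ℝ K) {r ρ : ℝ} (hρ : 0 < ρ)
    (hρr : ρ < r) (hne : (innerParallel K r).Nonempty)
    (hb : Bornology.IsBounded (innerParallel K ρ)) : Bornology.IsBounded K := by
  obtain ⟨z, hz⟩ := hne
  obtain ⟨R, hR⟩ := hb.exists_norm_le
  have hr : 0 < r := hρ.trans hρr
  set l := 1 - ρ / r with hl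
  have hq : ρ / r < 1 := (div_lt_one hr).2 hρr
  have hq0 : 0 < ρ / r := by positivity
  have hl0 : 0 < l := by linarith
  refine isBounded_iff_forall_norm_le.2 ⟨(R + ‖(ρ / r) • z‖) / l, fun y hy => ?_⟩
  rw [← innerParallel_zero K] at hy
  have h1 := combo_mem_innerParallel hK le_rfl hr.le hl0.le hq0.le (by ring) hy hz
  rw [mul_zero, zero_add, div_mul_cancel₀ _ hr.ne'] at h1
  have h2 := hR _ h1
  have h3 := norm_sub_le (l • y + (ρ / r) • z) ((ρ / r) • z)
  rw [add_sub_cancel_right, norm_smul l, Real.norm_eq_abs, abs_of_pos hl0] at h3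
  rw [le_div_iff₀ hl0]
  linarith

/-- If the inner parallel set at the largest radius is bounded and the perimeter `L` is strictly
between the extreme values, some inner parallel set has a parallel body of perimeter `L`. -/
lemma exists_cauchyPer_innerParallel_add_eq {K : Set Plane} (hK : Convex ℝ K) (hKc : IsClosed K)
    (hKb : Bornology.IsBounded K) {r : ℝ} (hr : 0 < r) (hne : (innerParallel K r).Nonempty)
    {L : ℝ≥0∞} (hL0 : L < cauchyPer K)
    (hLr : cauchyPer (innerParallel K r) + ENNReal.ofReal (2 * Real.pi * r) < L) :
    ∃ ρ, 0 < ρ ∧ ρ < r ∧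
      cauchyPer (innerParallel K ρ) + ENNReal.ofReal (2 * Real.pi * ρ) = L := by
  have hb : ∀ ρ, 0 ≤ ρ → Bornology.IsBounded (innerParallel K ρ) := fun ρ hρ =>
    hKb.subset (innerParallel_subset K hρ)
  have hfin : ∀ ρ, 0 ≤ ρ → cauchyPer (innerParallel K ρ) ≠ ∞ := fun ρ hρ =>
    (cauchyPer_lt_top (hb ρ hρ)).ne
  have hLtop : L ≠ ∞ := hL0.ne_top
  set p : ℝ → ℝ := fun ρ => (cauchyPer (innerParallel K ρ)).toReal with hp
  have hanti : ∀ {ρ σ : ℝ}, 0 ≤ ρ → ρ ≤ σ → p σ ≤ p ρ := fun h0 h =>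
    ENNReal.toReal_mono (hfin _ h0) (cauchyPer_mono (innerParallel_anti K h))
  set f : ℝ → ℝ := fun ρ => p ρ + 2 * Real.pi * ρ with hf
  have hof : ∀ {ρ : ℝ}, 0 ≤ ρ → ENNReal.ofReal (f ρ) =
      cauchyPer (innerParallel K ρ) + ENNReal.ofReal (2 * Real.pi * ρ) := by
    intro ρ hρ
    rw [hf, ENNReal.ofReal_add ENNReal.toReal_nonneg (by positivity),
      ENNReal.ofReal_toReal (hfin ρ hρ)]
  have hf0 : ∀ {ρ : ℝ}, 0 ≤ ρ → 0 ≤ f ρ := fun hρ =>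
    add_nonneg ENNReal.toReal_nonneg (by positivity)
  have hLr' : f r < L.toReal := by
    rw [← hof hr.le] at hLr
    exact (ENNReal.ofReal_lt_iff_lt_toReal (hf0 hr.le) hLtop).1 hLr
  obtain ⟨δ, hδ, hδL⟩ : ∃ δ, 0 < δ ∧ f r + 2 * Real.pi * δ < L.toReal := by
    refine ⟨(L.toReal - f r) / (4 * Real.pi), by have := sub_pos.2 hLr'; positivity, ?_⟩
    have : 2 * Real.pi * ((L.toReal - f r) / (4 * Real.pi)) = (L.toReal - f r) / 2 := by
      field_simp
      ring
    linarith
  obtain ⟨s, hs0, hsr, hs⟩ := exists_innerParallel_subset_thickening hK hKc hr hne (hb r hr.le) hδ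
  have hfs : f s < L.toReal := by
    have h1 : cauchyPer (innerParallel K s) ≤
        cauchyPer (innerParallel K r) + ENNReal.ofReal (2 * Real.pi * δ) := by
      refine cauchyPer_le_add (convex_innerParallel hK r).isPreconnected hne (hb r hr.le) hδ.le
        fun x hx => ?_
      obtain ⟨y, hy, hxy⟩ := mem_thickening_iff.1 (hs hx)
      exact ⟨y, hy, hxy.le⟩
    have h2 : p s ≤ p r + 2 * Real.pi * δ := by
      have h3 := ENNReal.toReal_mono
        (ENNReal.add_ne_top.2 ⟨hfin r hr.le, ENNReal.ofReal_ne_top⟩) h1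
      rwa [ENNReal.toReal_add (hfin r hr.le) ENNReal.ofReal_ne_top,
        ENNReal.toReal_ofReal (by positivity)] at h3
    have h4 : 2 * Real.pi * s ≤ 2 * Real.pi * r := by gcongr
    simp only [hf] at hδL ⊢
    linarith
  have hlip : ∀ {ρ σ : ℝ}, 0 ≤ ρ → ρ ≤ σ → σ ≤ s →
      p ρ - p σ ≤ p 0 / (r - s) * (σ - ρ) := by
    intro ρ σ hρ hρσ hσ
    have hd : 0 < r - ρ := by linarith
    set l := (σ - ρ) / (r - ρ) with hl
    have hl0 : 0 ≤ l := div_nonneg (by linarith) hd.le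
    have hl1 : l ≤ 1 := (div_le_one hd).2 (by linarith)
    have h1 := mul_cauchyPer_innerParallel_le hK hρ hr.le hl0 hl1 hne
    have h2 : (1 - l) * ρ + l * r = σ := by
      have : l * (r - ρ) = σ - ρ := div_mul_cancel₀ _ hd.ne'
      linarith
    rw [h2] at h1
    have h3 := ENNReal.toReal_mono (hfin σ (hρ.trans hρσ)) h1
    rw [ENNReal.toReal_mul, ENNReal.toReal_ofReal (by linarith)] at h3
    have h4 : l * p ρ ≤ (σ - ρ) / (r - s) * p 0 := by
      refine mul_le_mul ?_ (hanti le_rfl hρ) ENNReal.toReal_nonneg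
        (div_nonneg (by linarith) (by linarith))
      exact div_le_div_of_nonneg_left (by linarith) (by linarith) (by linarith)
    have h5 : p 0 / (r - s) * (σ - ρ) = (σ - ρ) / (r - s) * p 0 := by ring
    have h6 : (1 - l) * p ρ ≤ p σ := h3
    linarith
  have hpc : ContinuousOn p (Icc 0 s) := by
    have hC : 0 ≤ p 0 / (r - s) := div_nonneg ENNReal.toReal_nonneg (by linarith)
    refine (LipschitzOnWith.of_dist_le_mul (K := ⟨p 0 / (r - s), hC⟩) ?_).continuousOn
    intro x hx y hy
    rw [Real.dist_eq, Real.dist_eq]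
    change |p x - p y| ≤ p 0 / (r - s) * |x - y|
    rcases le_total x y with h | h
    · rw [abs_of_nonneg (sub_nonneg.2 (hanti hx.1 h)), abs_sub_comm x y,
        abs_of_nonneg (sub_nonneg.2 h)]
      exact hlip hx.1 h hy.2
    · rw [abs_sub_comm, abs_of_nonneg (sub_nonneg.2 (hanti hy.1 h)),
        abs_of_nonneg (sub_nonneg.2 h)]
      exact hlip hy.1 h hx.2
  have hfc : ContinuousOn f (Icc 0 s) := hpc.add (by fun_prop)
  have hf0L : L.toReal < f 0 := by
    have h1 : f 0 = (cauchyPer K).toReal := by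
      simp only [hf, hp, innerParallel_zero, mul_zero, add_zero]
    rw [h1]
    exact ENNReal.toReal_strict_mono (cauchyPer_lt_top hKb).ne hL0
  obtain ⟨ρ, hρ, hρL⟩ := intermediate_value_Icc' hs0.le hfc ⟨hfs.le, hf0L.le⟩
  have hρ0 : ρ ≠ 0 := by
    rintro rfl
    linarith
  refine ⟨ρ, lt_of_le_of_ne hρ.1 hρ0.symm, by linarith [hρ.2], ?_⟩
  rw [← hof hρ.1, hρL, ENNReal.ofReal_toReal hLtop]

lemma volume_innerParallel_eq_zero {K : Set Plane} (hK : Convex ℝ K) {r : ℝ}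
    (hr : 0 < r) (hmax : ∀ x ∈ interior K, ∀ s, closedBall x s ⊆ K → s ≤ r) :
    volume (innerParallel K r) = 0 := by
  have h_int : interior (innerParallel K r) = ∅ := by
    refine eq_empty_of_forall_notMem fun x hx => ?_
    obtain ⟨δ, hδ, hball⟩ := Metric.mem_nhds_iff.1 (mem_interior_iff_mem_nhds.1 hx)
    have hxK : x ∈ interior K :=
      mem_interior.2 ⟨ball x r, ball_subset_closedBall.trans
        (mem_innerParallel.1 (interior_subset hx)), isOpen_ball, mem_ball_self hr⟩
    have hd : 0 < r + δ / 2 := by positivity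
    have h1 := hmax x hxK (r + δ / 2) fun y hy => by
      rw [mem_closedBall, dist_eq_norm] at hy
      set w := y - x with hw
      have h2 : x + ((δ / 2) / (r + δ / 2)) • w ∈ innerParallel K r := by
        refine hball ?_
        rw [mem_ball, dist_eq_norm, add_sub_cancel_left, norm_smul, Real.norm_eq_abs,
          abs_of_nonneg (by positivity), div_mul_eq_mul_div, div_lt_iff₀ hd]
        nlinarith
      refine h2 ?_
      have h3 : y - (x + ((δ / 2) / (r + δ / 2)) • w) = (r / (r + δ / 2)) • w := by
        have : r / (r + δ / 2) = 1 - (δ / 2) / (r + δ / 2) := by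
          field_simp
          ring
        rw [this, sub_smul, one_smul, hw]
        abel
      rw [mem_closedBall, dist_eq_norm, h3, norm_smul, Real.norm_eq_abs,
        abs_of_nonneg (by positivity), div_mul_eq_mul_div, div_le_iff₀ hd]
      gcongr
    linarith
  refine measure_mono_null (fun x hx => ?_) ((convex_innerParallel hK r).addHaar_frontier volume)
  rw [frontier, h_int, sdiff_empty]
  exact subset_closure hx

/-- A convex set of large Cauchy perimeter contains compact convex sets of any smaller one. -/
lemma exists_isCompact_convex_cauchyPer_eq {C : Set Plane} (hC : Convex ℝ C) (hCc : IsClosed C)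
    (hne : C.Nonempty) {P : ℝ≥0∞} (hP : P ≠ ∞)
    (h : Bornology.IsBounded C → P ≤ cauchyPer C) :
    ∃ D, IsCompact D ∧ Convex ℝ D ∧ D.Nonempty ∧ D ⊆ C ∧ cauchyPer D = P := by
  obtain ⟨D₀, hD₀, hD₀c, hD₀ne, hD₀C, hPD⟩ : ∃ D, IsCompact D ∧ Convex ℝ D ∧ D.Nonempty ∧
      D ⊆ C ∧ P ≤ cauchyPer D := by
    by_cases hb : Bornology.IsBounded C
    · exact ⟨C, isCompact_of_isClosed_isBounded hCc hb, hC, hne, subset_rfl, h hb⟩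
    · obtain ⟨x, hx⟩ := hne
      have : ∃ y ∈ C, P.toReal ≤ ‖y - x‖ := by
        by_contra! hcon
        refine hb ((isBounded_ball (x := x) (r := P.toReal)).subset fun y hy => ?_)
        rw [mem_ball, dist_eq_norm]
        exact hcon y hy
      obtain ⟨y, hy, hxy⟩ := this
      refine ⟨segment ℝ x y, ?_, convex_segment x y, ⟨x, left_mem_segment ℝ x y⟩,
        hC.segment_subset hx hy, ?_⟩
      · rw [segment_eq_image_lineMap]
        exact isCompact_Icc.image AffineMap.lineMap_continuous
      · refine le_trans ?_ (two_mul_enorm_le_cauchyPer_segment x y)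
        calc P = ENNReal.ofReal P.toReal := (ENNReal.ofReal_toReal hP).symm
          _ ≤ ENNReal.ofReal ‖y - x‖ := by gcongr
          _ = ‖y - x‖ₑ := ofReal_norm _
          _ ≤ 2 * ‖y - x‖ₑ := le_mul_of_one_le_left zero_le one_le_two
  rcases eq_or_ne P 0 with rfl | hP0
  · obtain ⟨x, hx⟩ := hne
    exact ⟨{x}, isCompact_singleton, convex_singleton x, singleton_nonempty x,
      singleton_subset_iff.2 hx, cauchyPer_singleton x⟩
  obtain ⟨z, hz⟩ := hD₀ne
  have hfin := (cauchyPer_lt_top hD₀.isBounded).ne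
  have hpos : cauchyPer D₀ ≠ 0 := fun h0 => hP0 (le_zero_iff.1 (h0 ▸ hPD))
  set m : ℝ := (P / cauchyPer D₀).toReal with hm
  have hm1 : m ≤ 1 := by
    have := ENNReal.toReal_mono ENNReal.one_ne_top (ENNReal.div_le_of_le_mul (by rwa [one_mul]) :
      P / cauchyPer D₀ ≤ 1)
    rwa [ENNReal.toReal_one] at this
  have hm0 : 0 ≤ m := ENNReal.toReal_nonneg
  refine ⟨AffineMap.homothety z m '' D₀, hD₀.image (AffineMap.homothety_continuous z m),
    hD₀c.affine_image _, (nonempty_of_mem hz).image _, ?_, ?_⟩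
  · refine Subset.trans ?_ hD₀C
    rintro _ ⟨x, hx, rfl⟩
    have h1 := hD₀c hz hx (by linarith : 0 ≤ 1 - m) hm0 (by ring)
    convert h1 using 1
    simp only [AffineMap.homothety_apply, vsub_eq_sub, vadd_eq_add, smul_sub, sub_smul, one_smul]
    abel
  · rw [cauchyPer_homothety z hm0, hm, ENNReal.ofReal_toReal (ENNReal.div_ne_top hP hpos),
      ENNReal.div_mul_cancel hpos hfin]

lemma per_congr_ae {E F : Set Plane} (h : E =ᵐ[volume] F) : per E = per F := by
  unfold per perIn
  simp_rw [Measure.restrict_congr_set h]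

lemma per_univ_eq_zero : per (univ : Set Plane) = 0 := by
  unfold per perIn
  refine iSup_eq_bot.2 fun ⟨φ, hφ, hc, _⟩ => ?_
  change ENNReal.ofReal (∫ x in univ, vecDiv φ x) = 0
  rw [Measure.restrict_univ, integral_vecDiv_eq_zero hφ hc, ENNReal.ofReal_zero]

lemma per_closedBall (x : Plane) {q : ℝ} (hq : 0 ≤ q) :
    per (closedBall x q) = ENNReal.ofReal (2 * Real.pi * q) := by
  rcases hq.eq_or_lt with rfl | hq0
  · rw [closedBall_zero, mul_zero, ENNReal.ofReal_zero]
    have := per_le_cauchyPer (D := {x}) isCompact_singleton (convex_singleton x)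
    rwa [cauchyPer_singleton, le_zero_iff] at this
  · rw [← cthickening_singleton x hq,
      per_cthickening isCompact_singleton (convex_singleton x) (singleton_nonempty x) hq0,
      cauchyPer_singleton, zero_add]

lemma per_eq_and_volume_le_cthickening {K : Set Plane} (hK : Convex ℝ K) (hKc : IsClosed K)
    (hKne : K ≠ univ) {o : Plane} {δ : ℝ} (hδ : 0 < δ) (ho : ball o δ ⊆ K) {D : Set Plane}
    (hD : IsCompact D) (hDc : Convex ℝ D) (hDne : D.Nonempty) {ρ : ℝ} (hρ : 0 < ρ)
    (hDv : volume (innerParallel K ρ) ≤ volume D) {L : ℝ≥0∞} (hL : L ≠ ∞)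
    (hDL : cauchyPer D + ENNReal.ofReal (2 * Real.pi * ρ) = L) :
    per (cthickening ρ D) = L ∧ ∀ E' : Set Plane, MeasurableSet E' → E' ⊆ K → per E' = L →
      volume E' ≤ volume (cthickening ρ D) := by
  refine ⟨(per_cthickening hD hDc hDne hρ).trans hDL, fun E' hE' hE'K hE'L => ?_⟩
  have h1 := volume_le_add_sweep hK hKc hKne hδ ho hE' hE'K (hE'L ▸ hL) hρ
  have h2 := add_sweep_le_volume_cthickening hD hDc hDne ρ
  rw [hDL] at h2
  rw [hE'L] at h1
  exact h1.trans (le_trans (add_le_add_left hDv _) h2)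

end PlaneGeom

open PlaneGeom Metric Set in
/-- Existence in convex subregions of the plane: if `G ⊆ ℝ²` is open and convex and either
(i) arbitrarily large disks fit in `cl(G)` (`𝔯(G) = ∞`), or (ii) the supremum `𝔯(G)` of radii
of disks contained in `cl(G)` is attained, then for every `L ∈ [0, Per(G))` the problem of
maximizing area at fixed perimeter `L` among subsets of `cl(G)` has a convex solution. -/
theorem existence_in_convex_subregions (G : Set (EuclideanSpace ℝ (Fin 2)))
    (hGopen : IsOpen G) (hGconv : Convex ℝ G)
    (hr : (∀ r : ℝ, ∃ x ∈ G, Metric.closedBall x r ⊆ closure G) ∨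
      (BddAbove {r : ℝ | 0 ≤ r ∧ ∃ x ∈ G, Metric.closedBall x r ⊆ closure G} ∧
        ∃ x ∈ G, Metric.closedBall x
          (sSup {r : ℝ | 0 ≤ r ∧ ∃ x ∈ G, Metric.closedBall x r ⊆ closure G}) ⊆ closure G))
    (L : ℝ≥0∞) (hL : L < per G) :
    ∃ E : Set (EuclideanSpace ℝ (Fin 2)), MeasurableSet E ∧ E ⊆ closure G ∧ Convex ℝ E ∧
      per E = L ∧ ∀ E' : Set (EuclideanSpace ℝ (Fin 2)), MeasurableSet E' → E' ⊆ closure G →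
        per E' = L → volume E' ≤ volume E := by
  have hLtop : L ≠ ∞ := hL.ne_top
  set K := closure G with hKdef
  have hK : Convex ℝ K := hGconv.closure
  have hKc : IsClosed K := isClosed_closure
  obtain ⟨o, hoG⟩ : G.Nonempty := by
    rcases hr with h | ⟨_, x, hx, _⟩
    · obtain ⟨x, hx, _⟩ := h 0
      exact ⟨x, hx⟩
    · exact ⟨x, hx⟩
  have hintK : interior K = G := by
    have h := hGconv.interior_closure_eq_interior_of_nonempty_interior
      (by rw [hGopen.interior_eq]; exact ⟨o, hoG⟩)
    rwa [hGopen.interior_eq] at h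
  have hKne : K ≠ univ := by
    intro h
    rw [h, interior_univ] at hintK
    rw [← hintK, per_univ_eq_zero] at hL
    exact not_lt_zero hL
  obtain ⟨δ, hδ, hball⟩ := Metric.isOpen_iff.1 hGopen o hoG
  have hballK : ball o δ ⊆ K := hball.trans subset_closure
  set q : ℝ := L.toReal / (2 * Real.pi) with hq
  have hq0 : 0 ≤ q := div_nonneg ENNReal.toReal_nonneg (by positivity)
  have hqL : ENNReal.ofReal (2 * Real.pi * q) = L := by
    rw [hq, mul_div_cancel₀ _ (by positivity), ENNReal.ofReal_toReal hLtop]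
  have hdisk : ∀ x, closedBall x q ⊆ K →
      ∃ E : Set Plane, MeasurableSet E ∧ E ⊆ K ∧ Convex ℝ E ∧ per E = L ∧
        ∀ E' : Set Plane, MeasurableSet E' → E' ⊆ K → per E' = L → volume E' ≤ volume E := by
    intro x hx
    obtain ⟨θ, c, hc⟩ := exists_coord_le hK hKc hKne
    refine ⟨closedBall x q, measurableSet_closedBall, hx, convex_closedBall x q,
      (per_closedBall x hq0).trans hqL, fun E' hE' hE'K hE'L => ?_⟩
    refine volume_le_volume_closedBall hE' ?_ hq0 (hE'L.trans hqL.symm) x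
    refine ((volume_le_per_sq hE' fun x hx => hc x (hE'K hx)).trans_lt ?_).ne
    rw [hE'L]
    exact ENNReal.pow_lt_top hLtop.lt_top
  rcases hr with h | ⟨hbdd, z, hzG, hz⟩
  · obtain ⟨x, _, hx⟩ := h q
    exact hdisk x hx
  set r := sSup {r : ℝ | 0 ≤ r ∧ ∃ x ∈ G, Metric.closedBall x r ⊆ K} with hrdef
  rcases le_or_gt q r with hqr | hqr
  · exact hdisk z ((closedBall_subset_closedBall hqr).trans hz)
  have hmax : ∀ x ∈ interior K, ∀ s, closedBall x s ⊆ K → s ≤ r := by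
    intro x hx s hs
    rw [hintK] at hx
    rcases le_or_gt 0 s with h0 | h0
    · have hm : s ∈ {r : ℝ | 0 ≤ r ∧ ∃ x ∈ G, Metric.closedBall x r ⊆ K} := ⟨h0, x, hx, hs⟩
      exact le_csSup hbdd hm
    · exact h0.le.trans (Real.sSup_nonneg fun _ ht => ht.1)
  have hr0 : 0 < r := by
    have h1 := hmax o (by rwa [hintK]) (δ / 2)
      ((closedBall_subset_ball (by linarith)).trans hballK)
    linarith
  have hzr : z ∈ innerParallel K r := hz
  have hvol := volume_innerParallel_eq_zero hK hr0 hmax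
  have hrL : ENNReal.ofReal (2 * Real.pi * r) ≤ L := by
    rw [← hqL]
    gcongr
  have hfinish : ∀ (ρ : ℝ) (D : Set Plane), 0 < ρ → IsCompact D → Convex ℝ D → D.Nonempty →
      D ⊆ innerParallel K ρ → volume (innerParallel K ρ) ≤ volume D →
      cauchyPer D + ENNReal.ofReal (2 * Real.pi * ρ) = L →
      ∃ E : Set Plane, MeasurableSet E ∧ E ⊆ K ∧ Convex ℝ E ∧ per E = L ∧
        ∀ E' : Set Plane, MeasurableSet E' → E' ⊆ K → per E' = L → volume E' ≤ volume E :=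
    fun ρ D hρ hD hDc hDne hDsub hDv hDL =>
      ⟨cthickening ρ D, isClosed_cthickening.measurableSet,
        cthickening_subset_of_innerParallel hD hρ.le hDsub, hDc.cthickening ρ,
        per_eq_and_volume_le_cthickening hK hKc hKne hδ hballK hD hDc hDne hρ hDv hLtop hDL⟩
  by_cases hcase : Bornology.IsBounded (innerParallel K r) →
      L - ENNReal.ofReal (2 * Real.pi * r) ≤ cauchyPer (innerParallel K r)
  · obtain ⟨D, hD, hDc, hDne, hDsub, hDP⟩ := exists_isCompact_convex_cauchyPer_eq
      (convex_innerParallel hK r) (isClosed_innerParallel hKc r) ⟨z, hzr⟩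
      (ENNReal.sub_ne_top hLtop) hcase
    refine hfinish r D hr0 hD hDc hDne hDsub (by rw [hvol]; exact zero_le) ?_
    rw [hDP, tsub_add_cancel_of_le hrL]
  · push Not at hcase
    obtain ⟨hb, hlt⟩ := hcase
    obtain ⟨s, hs0, hsr, hs⟩ :=
      exists_innerParallel_subset_thickening hK hKc hr0 ⟨z, hzr⟩ hb one_pos
    have hKb := isBounded_of_innerParallel hK hs0 hsr ⟨z, hzr⟩ (hb.thickening.subset hs)
    have hKcpt : IsCompact K := isCompact_of_isClosed_isBounded hKc hKb
    have hperK : L < cauchyPer K := by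
      refine hL.trans_le (le_trans (le_of_eq ?_) (per_le_cauchyPer hKcpt hK))
      refine per_congr_ae (subset_closure.eventuallyLE.antisymm (ae_le_set.2 ?_))
      refine measure_mono_null ?_ (hGconv.addHaar_frontier volume)
      rw [frontier, hGopen.interior_eq]
    obtain ⟨ρ, hρ0, hρr, hρL⟩ := exists_cauchyPer_innerParallel_add_eq hK hKc hKb hr0 ⟨z, hzr⟩
      hperK (lt_tsub_iff_right.1 hlt)
    exact hfinish ρ (innerParallel K ρ) hρ0
      (hKcpt.of_isClosed_subset (isClosed_innerParallel hKc ρ) (innerParallel_subset K hρ0.le))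
      (convex_innerParallel hK ρ) ⟨z, innerParallel_anti K hρr.le hzr⟩ subset_rfl le_rfl hρL
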